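/- The eleven meromorphic Jacobi forms c_0, c_1, c_2, c_3, c_4, d_0, d_2, d_3, d_4, d_5, d_6, viewed as meromorphic functions on ℍ × ℂ^8, are algebraically independent over ℂ. -/

import Mathlib

noncomputable section

open Complex Finset

namespace E8Jacobi

/-- π as a complex number. -/
def πC : ℂ := Real.pi

/-- The E8 lattice as a subset of ℝ^8. -/
def E8Lattice : Set (Fin 8 → ℝ) :=
  {x | ((∀ i, ∃ n : ℤ, x i = n) ∨ (∀ i, ∃ n : ℤ, x i = n + 1/2)) ∧ ∃ m : ℤ, ∑ i, x i = 2 * m}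

/-- Complexification of a real vector. -/
def cv (x : Fin 8 → ℝ) : Fin 8 → ℂ := fun i => (x i : ℂ)

/-- The dot product on ℝ^8. -/
def dotR (x y : Fin 8 → ℝ) : ℝ := ∑ i, x i * y i

/-- The dot product on ℂ^8. -/
def dotC (z w : Fin 8 → ℂ) : ℂ := ∑ i, z i * w i

/-- The Weyl group W(E8): orthogonal matrices preserving the E8 lattice. -/
def WeylE8 : Set (Matrix (Fin 8) (Fin 8) ℝ) :=
  {M | (∀ x y, dotR (M.mulVec x) (M.mulVec y) = dotR x y) ∧
       (∀ x ∈ E8Lattice, M.mulVec x ∈ E8Lattice) ∧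
       (∀ x ∈ E8Lattice, ∃ y ∈ E8Lattice, M.mulVec y = x)}

/-- The complexified (ℂ-linear) action of a real matrix on ℂ^8. -/
def actC (M : Matrix (Fin 8) (Fin 8) ℝ) (z : Fin 8 → ℂ) : Fin 8 → ℂ :=
  fun i => ∑ j, (M i j : ℂ) * z j

/-- A W(E8)-invariant weak Jacobi form of weight `k` and index `m`. -/
structure IsWeakJacobiFormE8 (k : ℤ) (m : ℕ) (φ : ℂ → (Fin 8 → ℂ) → ℂ) : Prop where
  holo : DifferentiableOn ℂ (fun p : ℂ × (Fin 8 → ℂ) => φ p.1 p.2) {p | 0 < p.1.im}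
  weyl_inv : ∀ M ∈ WeylE8, ∀ τ : ℂ, 0 < τ.im → ∀ z, φ τ (actC M z) = φ τ z
  quasi_periodic : ∀ α ∈ E8Lattice, ∀ β ∈ E8Lattice, ∀ τ : ℂ, 0 < τ.im → ∀ z,
    φ τ (fun i => z i + τ * (α i : ℂ) + (β i : ℂ)) =
      Complex.exp (-(m : ℂ) * πC * I * (τ * dotC (cv α) (cv α) + 2 * dotC z (cv α))) * φ τ z
  modular : ∀ a b c d : ℤ, a * d - b * c = 1 → ∀ τ : ℂ, 0 < τ.im → ∀ z,
    φ (((a : ℂ) * τ + (b : ℂ)) / ((c : ℂ) * τ + (d : ℂ))) (fun i => z i / ((c : ℂ) * τ + (d : ℂ))) =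
      ((c : ℂ) * τ + (d : ℂ)) ^ k *
        Complex.exp ((m : ℂ) * πC * I * (c : ℂ) / ((c : ℂ) * τ + (d : ℂ)) * dotC z z) * φ τ z
  fourier : ∃ co : ℕ → E8Lattice → ℂ, ∀ τ : ℂ, 0 < τ.im → ∀ z,
    φ τ z = ∑' (n : ℕ) (w : E8Lattice), co n w *
      Complex.exp (2 * πC * I * dotC (cv w.1) z) * Complex.exp (2 * πC * I * τ) ^ n

/-- Membership in the ring J^{E8}_{*,*} of W(E8)-invariant weak Jacobi forms:
a finite sum of weak Jacobi forms of various weights and indices. -/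
def MemJE8 (φ : ℂ → (Fin 8 → ℂ) → ℂ) : Prop :=
  ∃ (n : ℕ) (k : Fin n → ℤ) (m : Fin n → ℕ) (ψ : Fin n → ℂ → (Fin 8 → ℂ) → ℂ),
    (∀ i, IsWeakJacobiFormE8 (k i) (m i) (ψ i)) ∧
    ∀ τ : ℂ, 0 < τ.im → ∀ z, φ τ z = ∑ i, ψ i τ z

/-- The nome q = e^{2πiτ}. -/
def qExp (τ : ℂ) : ℂ := Complex.exp (2 * πC * I * τ)

/-- The Eisenstein series E4. -/
def E4 (τ : ℂ) : ℂ :=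
  1 + 240 * ∑' n : ℕ+, (n : ℂ) ^ 3 * qExp τ ^ (n : ℕ) / (1 - qExp τ ^ (n : ℕ))

/-- The Eisenstein series E6. -/
def E6 (τ : ℂ) : ℂ :=
  1 - 504 * ∑' n : ℕ+, (n : ℂ) ^ 5 * qExp τ ^ (n : ℕ) / (1 - qExp τ ^ (n : ℕ))

/-- The modular discriminant Δ. -/
def Dl (τ : ℂ) : ℂ := (E4 τ ^ 3 - E6 τ ^ 2) / 1728

/-- The Dedekind eta function. -/
def etaF (τ : ℂ) : ℂ := Complex.exp (2 * πC * I * τ / 24) * ∏' n : ℕ, (1 - qExp τ ^ (n + 1))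

/-- The theta function of the E8 lattice. -/
def Theta (τ : ℂ) (z : Fin 8 → ℂ) : ℂ :=
  ∑' w : E8Lattice, Complex.exp (πC * I * τ * dotC (cv w.1) (cv w.1) + 2 * πC * I * dotC z (cv w.1))

/-- The Jacobi theta function θ1. -/
def th1 (z τ : ℂ) : ℂ :=
  I * ∑' n : ℤ, (-1 : ℂ) ^ n * Complex.exp (2 * πC * I * z * ((n : ℂ) - 1/2)) *
    Complex.exp (πC * I * τ * ((n : ℂ) - 1/2) ^ 2)

/-- The Jacobi theta function θ2. -/
def th2 (z τ : ℂ) : ℂ :=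
  ∑' n : ℤ, Complex.exp (2 * πC * I * z * ((n : ℂ) - 1/2)) *
    Complex.exp (πC * I * τ * ((n : ℂ) - 1/2) ^ 2)

/-- The Jacobi theta function θ3. -/
def th3 (z τ : ℂ) : ℂ :=
  ∑' n : ℤ, Complex.exp (2 * πC * I * z * (n : ℂ)) * Complex.exp (πC * I * τ * (n : ℂ) ^ 2)

/-- The Jacobi theta function θ4. -/
def th4 (z τ : ℂ) : ℂ :=
  ∑' n : ℤ, (-1 : ℂ) ^ n * Complex.exp (2 * πC * I * z * (n : ℂ)) *
    Complex.exp (πC * I * τ * (n : ℂ) ^ 2)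

/-- A1 = Θ(τ,z). -/
def A1 (τ : ℂ) (z : Fin 8 → ℂ) : ℂ := Theta τ z

/-- A_m for m = 2, 3, 5. -/
def AM (m : ℕ) (τ : ℂ) (z : Fin 8 → ℂ) : ℂ :=
  ((m : ℂ) ^ 3 / ((m : ℂ) ^ 3 + 1)) *
    (Theta ((m : ℂ) * τ) (fun i => (m : ℂ) * z i) +
      ((m : ℂ) ^ 4)⁻¹ * ∑ k ∈ Finset.range m, Theta ((τ + (k : ℂ)) / (m : ℂ)) z)

def A2 : ℂ → (Fin 8 → ℂ) → ℂ := AM 2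
def A3 : ℂ → (Fin 8 → ℂ) → ℂ := AM 3
def A5 : ℂ → (Fin 8 → ℂ) → ℂ := AM 5

/-- A4 = Θ(τ,2z). -/
def A4 (τ : ℂ) (z : Fin 8 → ℂ) : ℂ := Theta τ (fun i => 2 * z i)

def ee1 (τ : ℂ) : ℂ := (th3 0 τ ^ 4 + th4 0 τ ^ 4) / 12
def ee2 (τ : ℂ) : ℂ := (th2 0 τ ^ 4 - th4 0 τ ^ 4) / 12
def ee3 (τ : ℂ) : ℂ := (-th2 0 τ ^ 4 - th3 0 τ ^ 4) / 12
def h0 (τ : ℂ) : ℂ := th3 0 (2*τ) * th3 0 (6*τ) + th2 0 (2*τ) * th2 0 (6*τ)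

def B2 (τ : ℂ) (z : Fin 8 → ℂ) : ℂ :=
  (32/5) * (ee1 τ * Theta (2*τ) (fun i => 2 * z i)
    + (1/2^4) * ee3 τ * Theta (τ/2) z + (1/2^4) * ee2 τ * Theta ((τ+1)/2) z)

def B3 (τ : ℂ) (z : Fin 8 → ℂ) : ℂ :=
  (81/80) * (h0 τ ^ 2 * Theta (3*τ) (fun i => 3 * z i)
    - (1/3^5) * ∑ k ∈ Finset.range 3, h0 ((τ + (k:ℂ))/3) ^ 2 * Theta ((τ + (k:ℂ))/3) z)

def B4 (τ : ℂ) (z : Fin 8 → ℂ) : ℂ :=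
  (16/15) * (th4 0 (2*τ) ^ 4 * Theta (4*τ) (fun i => 4 * z i)
    - (1/2^4) * th4 0 (2*τ) ^ 4 * Theta (τ + 1/2) (fun i => 2 * z i)
    - (1/(2^2 * 4^4)) * ∑ k ∈ Finset.range 4, th2 0 ((τ + (k:ℂ))/2) ^ 4 * Theta ((τ + (k:ℂ))/4) z)

def B6 (τ : ℂ) (z : Fin 8 → ℂ) : ℂ :=
  (9/10) * (h0 τ ^ 2 * Theta (6*τ) (fun i => 6 * z i)
    + (1/2^4) * ∑ k ∈ Finset.range 2, h0 (τ + (k:ℂ)) ^ 2 * Theta ((3*τ + 3*(k:ℂ))/2) (fun i => 3 * z i)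
    - (1/(3 * 3^4)) * ∑ k ∈ Finset.range 3, h0 ((τ + (k:ℂ))/3) ^ 2 * Theta ((2*τ + 2*(k:ℂ))/3) (fun i => 2 * z i)
    - (1/(3 * 6^4)) * ∑ k ∈ Finset.range 6, h0 ((τ + (k:ℂ))/3) ^ 2 * Theta ((τ + (k:ℂ))/6) z)

/-- The nine basic W(E8)-invariant holomorphic Jacobi forms A1,…,A5,B2,…,B6. -/
def nineForms : Fin 9 → ℂ → (Fin 8 → ℂ) → ℂ := ![A1, A2, A3, A4, A5, B2, B3, B4, B6]

/- The basic meromorphic Jacobi forms a_i, b_j (Appendix A of the paper). -/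

def a0f (τ : ℂ) (_z : Fin 8 → ℂ) : ℂ := E4 τ / 12

def a2f (τ : ℂ) (z : Fin 8 → ℂ) : ℂ :=
  6 / (E4 τ * Dl τ) * (-(E4 τ) * A2 τ z + A1 τ z ^ 2)

def a3f (τ : ℂ) (z : Fin 8 → ℂ) : ℂ :=
  1 / (9 * E4 τ ^ 2 * Dl τ ^ 2) *
    (-7 * E4 τ ^ 2 * E6 τ * A3 τ z - 20 * E4 τ ^ 3 * B3 τ z
      - 9 * E4 τ * E6 τ * A1 τ z * A2 τ z + 30 * E4 τ ^ 2 * A1 τ z * B2 τ z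
      + 6 * E6 τ * A1 τ z ^ 3)

def a4f (τ : ℂ) (z : Fin 8 → ℂ) : ℂ :=
  1 / (288 * E4 τ ^ 3 * Dl τ ^ 3) *
    (576 * E4 τ ^ 3 * Dl τ * A4 τ z + 32256 * E4 τ ^ 2 * Dl τ * A1 τ z * A3 τ z
      - 9 * E4 τ ^ 5 * A2 τ z ^ 2 - 30 * E4 τ ^ 3 * E6 τ * A2 τ z * B2 τ z
      - 25 * E4 τ ^ 4 * B2 τ z ^ 2
      + (60 * E4 τ ^ 4 - 12 * E4 τ * E6 τ ^ 2) * A1 τ z ^ 2 * A2 τ z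
      + 80 * E4 τ ^ 2 * E6 τ * A1 τ z ^ 2 * B2 τ z
      + (-70 * E4 τ ^ 3 + 6 * E6 τ ^ 2) * A1 τ z ^ 4)

def b0f (τ : ℂ) (_z : Fin 8 → ℂ) : ℂ := E6 τ / 216

def b1f (τ : ℂ) (z : Fin 8 → ℂ) : ℂ := -4 / E4 τ * A1 τ z

def b2f (τ : ℂ) (z : Fin 8 → ℂ) : ℂ :=
  5 / (6 * E4 τ ^ 2 * Dl τ) * (E4 τ ^ 2 * B2 τ z - E6 τ * A1 τ z ^ 2)

def b3f (τ : ℂ) (z : Fin 8 → ℂ) : ℂ :=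
  1 / (108 * E4 τ ^ 3 * Dl τ ^ 2) *
    (-7 * E4 τ ^ 5 * A3 τ z - 20 * E4 τ ^ 3 * E6 τ * B3 τ z
      - 9 * E4 τ ^ 4 * A1 τ z * A2 τ z + 30 * E4 τ ^ 2 * E6 τ * A1 τ z * B2 τ z
      + (16 * E4 τ ^ 3 - 10 * E6 τ ^ 2) * A1 τ z ^ 3)

def b4f (τ : ℂ) (z : Fin 8 → ℂ) : ℂ :=
  1 / (1728 * E4 τ ^ 4 * Dl τ ^ 3) *
    (-8640 * E4 τ ^ 4 * Dl τ * B4 τ z + 138240 * E4 τ ^ 3 * Dl τ * A1 τ z * B3 τ z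
      + 9 * E4 τ ^ 5 * E6 τ * A2 τ z ^ 2 + 30 * E4 τ ^ 6 * A2 τ z * B2 τ z
      + 25 * E4 τ ^ 4 * E6 τ * B2 τ z ^ 2
      - 48 * E4 τ ^ 4 * E6 τ * A1 τ z ^ 2 * A2 τ z
      + (-140 * E4 τ ^ 5 + 60 * E4 τ ^ 2 * E6 τ ^ 2) * A1 τ z ^ 2 * B2 τ z
      + (74 * E4 τ ^ 3 * E6 τ - 10 * E6 τ ^ 3) * A1 τ z ^ 4)

def b5f (τ : ℂ) (z : Fin 8 → ℂ) : ℂ :=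
  1 / (72 * E4 τ ^ 5 * Dl τ ^ 3) *
    (-36288 * E4 τ ^ 4 * Dl τ * A5 τ z - 294 * E4 τ ^ 6 * A2 τ z * A3 τ z
      - 770 * E4 τ ^ 4 * E6 τ * B2 τ z * A3 τ z - 840 * E4 τ ^ 4 * E6 τ * A2 τ z * B3 τ z
      - 2200 * E4 τ ^ 5 * B2 τ z * B3 τ z + 168 * E4 τ ^ 5 * A1 τ z ^ 2 * A3 τ z
      + 480 * E4 τ ^ 3 * E6 τ * A1 τ z ^ 2 * B3 τ z - 621 * E4 τ ^ 5 * A1 τ z * A2 τ z ^ 2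
      + 3525 * E4 τ ^ 4 * A1 τ z * B2 τ z ^ 2 + 1224 * E4 τ ^ 4 * A1 τ z ^ 3 * A2 τ z
      - 240 * E4 τ ^ 2 * E6 τ * A1 τ z ^ 3 * B2 τ z
      + (-456 * E4 τ ^ 3 + 24 * E6 τ ^ 2) * A1 τ z ^ 5)

def b6f (τ : ℂ) (z : Fin 8 → ℂ) : ℂ :=
  1 / (4478976 * E4 τ ^ 6 * Dl τ ^ 5) *
    (-19906560 * E4 τ ^ 6 * Dl τ ^ 2 * B6 τ z
      - 188116992 * E4 τ ^ 4 * E6 τ * Dl τ ^ 2 * A1 τ z * A5 τ z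
      - 5184 * E4 τ ^ 7 * E6 τ * Dl τ * A2 τ z * A4 τ z
      - 8640 * E4 τ ^ 8 * Dl τ * B2 τ z * A4 τ z
      - 103680 * E4 τ ^ 8 * Dl τ * A2 τ z * B4 τ z
      - 172800 * E4 τ ^ 6 * E6 τ * Dl τ * B2 τ z * B4 τ z
      + 12672 * E4 τ ^ 6 * E6 τ * Dl τ * A1 τ z ^ 2 * A4 τ z
      + 17280 * (5 * E4 τ ^ 7 + 9 * E4 τ ^ 4 * E6 τ ^ 2) * Dl τ * A1 τ z ^ 2 * B4 τ z
      + 112896 * E4 τ ^ 7 * E6 τ * Dl τ * A3 τ z ^ 2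
      + 645120 * E4 τ ^ 8 * Dl τ * A3 τ z * B3 τ z
      + 921600 * E4 τ ^ 6 * E6 τ * Dl τ * B3 τ z ^ 2
      - 1717632 * E4 τ ^ 6 * E6 τ * Dl τ * A1 τ z * A2 τ z * A3 τ z
      - 362880 * (4 * E4 τ ^ 7 + 11 * E4 τ ^ 4 * E6 τ ^ 2) * Dl τ * A1 τ z * B2 τ z * A3 τ z
      + 483840 * (4 * E4 τ ^ 7 - 9 * E4 τ ^ 4 * E6 τ ^ 2) * Dl τ * A1 τ z * A2 τ z * B3 τ z
      - 11404800 * E4 τ ^ 5 * E6 τ * Dl τ * A1 τ z * B2 τ z * B3 τ z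
      + 1161216 * E4 τ ^ 5 * E6 τ * Dl τ * A1 τ z ^ 3 * A3 τ z
      - 92160 * (37 * E4 τ ^ 6 - 9 * E4 τ ^ 3 * E6 τ ^ 2) * Dl τ * A1 τ z ^ 3 * B3 τ z
      + (135 * E4 τ ^ 9 * E6 τ + 54 * E4 τ ^ 6 * E6 τ ^ 3) * A2 τ z ^ 3
      + (405 * E4 τ ^ 10 + 540 * E4 τ ^ 7 * E6 τ ^ 2) * A2 τ z ^ 2 * B2 τ z
      + 1575 * E4 τ ^ 8 * E6 τ * A2 τ z * B2 τ z ^ 2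
      + (375 * E4 τ ^ 9 + 500 * E4 τ ^ 6 * E6 τ ^ 2) * B2 τ z ^ 3
      + (-3159 * E4 τ ^ 8 * E6 τ + 1701 * E4 τ ^ 5 * E6 τ ^ 3) * A1 τ z ^ 2 * A2 τ z ^ 2
      + (-3060 * E4 τ ^ 9 - 1800 * E4 τ ^ 6 * E6 τ ^ 2) * A1 τ z ^ 2 * A2 τ z * B2 τ z
      + (6975 * E4 τ ^ 7 * E6 τ - 11025 * E4 τ ^ 4 * E6 τ ^ 3) * A1 τ z ^ 2 * B2 τ z ^ 2
      + (6768 * E4 τ ^ 7 * E6 τ - 3024 * E4 τ ^ 4 * E6 τ ^ 3) * A1 τ z ^ 4 * A2 τ z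
      + (4260 * E4 τ ^ 8 + 1800 * E4 τ ^ 5 * E6 τ ^ 2 + 180 * E4 τ ^ 2 * E6 τ ^ 4) * A1 τ z ^ 4 * B2 τ z
      + (-3692 * E4 τ ^ 6 * E6 τ + 504 * E4 τ ^ 3 * E6 τ ^ 3 - 12 * E6 τ ^ 5) * A1 τ z ^ 6)

/-- The Seiberg–Witten coefficients a_0, …, a_4 (a_1 = 0). -/
def aSW : ℕ → ℂ → (Fin 8 → ℂ) → ℂ
  | 0 => a0f
  | 2 => a2f
  | 3 => a3f
  | 4 => a4f
  | _ => fun _ _ => 0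

/-- The Seiberg–Witten coefficients b_0, …, b_6. -/
def bSW : ℕ → ℂ → (Fin 8 → ℂ) → ℂ
  | 0 => b0f
  | 1 => b1f
  | 2 => b2f
  | 3 => b3f
  | 4 => b4f
  | 5 => b5f
  | 6 => b6f
  | _ => fun _ _ => 0

/-- The translation parameter −b₁/(6b₀). -/
def uShift (τ : ℂ) (z : Fin 8 → ℂ) : ℂ := -(bSW 1 τ z) / (6 * bSW 0 τ z)

/-- The coefficients c_i. -/
def cSW (i : ℕ) (τ : ℂ) (z : Fin 8 → ℂ) : ℂ :=
  ∑ j ∈ Finset.range (i+1), aSW j τ z * (Nat.choose (4-j) (4-i) : ℂ) * uShift τ z ^ (i-j)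

/-- The coefficients d_j. -/
def dSW (j : ℕ) (τ : ℂ) (z : Fin 8 → ℂ) : ℂ :=
  ∑ l ∈ Finset.range (j+1), bSW l τ z * (Nat.choose (6-l) (6-j) : ℂ) * uShift τ z ^ (j-l)

/-- Points of the upper half-plane avoiding the zeros of E4, E6 and Δ
(where all the meromorphic Jacobi forms above are defined). -/
def GoodTau (τ : ℂ) : Prop := 0 < τ.im ∧ E4 τ ≠ 0 ∧ E6 τ ≠ 0 ∧ Dl τ ≠ 0

/-- The eleven generators a_0, a_2, a_3, a_4, b_0, …, b_6 of R. -/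
def abGens : Fin 11 → ℂ → (Fin 8 → ℂ) → ℂ :=
  ![aSW 0, aSW 2, aSW 3, aSW 4, bSW 0, bSW 1, bSW 2, bSW 3, bSW 4, bSW 5, bSW 6]

/-- The eleven generators c_0, …, c_4, d_0, d_2, …, d_6 of R̃. -/
def cdGens : Fin 11 → ℂ → (Fin 8 → ℂ) → ℂ :=
  ![cSW 0, cSW 1, cSW 2, cSW 3, cSW 4, dSW 0, dSW 2, dSW 3, dSW 4, dSW 5, dSW 6]

/-- Membership in the polynomial ring R = ℂ[a_0,a_2,a_3,a_4,b_0,…,b_6]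
(as meromorphic functions on ℍ × ℂ^8). -/
def MemR (φ : ℂ → (Fin 8 → ℂ) → ℂ) : Prop :=
  ∃ P : MvPolynomial (Fin 11) ℂ, ∀ τ : ℂ, GoodTau τ → ∀ z,
    φ τ z = MvPolynomial.eval (fun i => abGens i τ z) P

/-- Membership in the polynomial ring R̃ = ℂ[c_0,…,c_4,d_0,d_2,…,d_6]
(as meromorphic functions on ℍ × ℂ^8). -/
def MemRt (φ : ℂ → (Fin 8 → ℂ) → ℂ) : Prop :=
  ∃ P : MvPolynomial (Fin 11) ℂ, ∀ τ : ℂ, GoodTau τ → ∀ z,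
    φ τ z = MvPolynomial.eval (fun i => cdGens i τ z) P

/- Invariant theory of binary forms. -/

/-- `BinTrans n T α α'` says that `α'` is the coefficient family of the degree-`n`
binary form with coefficients `α` transformed by `T ∈ SL2(ℂ)`. -/
def BinTrans (n : ℕ) (T : Matrix (Fin 2) (Fin 2) ℂ) (α α' : ℕ → ℂ) : Prop :=
  ∀ u v : ℂ,
    ∑ j ∈ Finset.range (n+1), α' j * u ^ (n - j) * v ^ j
      = ∑ i ∈ Finset.range (n+1), α i * (T 0 0 * u + T 0 1 * v) ^ (n - i) *
          (T 1 0 * u + T 1 1 * v) ^ i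

/-- Variables for polynomials in the coefficients of a binary quartic and sextic. -/
abbrev SV := Fin 5 ⊕ Fin 7

/-- Evaluation of a polynomial in the coefficients of the quartic and sextic. -/
def evalSV (Φ : MvPolynomial SV ℂ) (α β : ℕ → ℂ) : ℂ :=
  MvPolynomial.eval (Sum.elim (fun i : Fin 5 => α i.1) (fun j : Fin 7 => β j.1)) Φ

/-- Membership in the ring of joint semiinvariants ℂ[V4 ⊕ V6]^{U2(ℂ)}. -/
def IsSemiinvRingElem (Φ : MvPolynomial SV ℂ) : Prop :=
  ∀ κ : ℂ, ∀ α α' β β' : ℕ → ℂ,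
    BinTrans 4 !![1, κ; 0, 1] α α' → BinTrans 6 !![1, κ; 0, 1] β β' →
      evalSV Φ α' β' = evalSV Φ α β

/-- Membership in the ring of joint invariants ℂ[V4 ⊕ V6]^{SL2(ℂ)}. -/
def IsInvRingElem (Φ : MvPolynomial SV ℂ) : Prop :=
  ∀ T : Matrix (Fin 2) (Fin 2) ℂ, T.det = 1 → ∀ α α' β β' : ℕ → ℂ,
    BinTrans 4 T α α' → BinTrans 6 T β β' → evalSV Φ α' β' = evalSV Φ α β

/-- Variables for joint covariants: coefficients of the two forms together with (u,v). -/
abbrev CVV := (Fin 5 ⊕ Fin 7) ⊕ Fin 2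

/-- Evaluation of a polynomial in the coefficients and (u,v). -/
def evalCov (Ψ : MvPolynomial CVV ℂ) (α β : ℕ → ℂ) (u v : ℂ) : ℂ :=
  MvPolynomial.eval
    (Sum.elim (Sum.elim (fun i : Fin 5 => α i.1) (fun j : Fin 7 => β j.1))
      (fun p : Fin 2 => if p = 0 then u else v)) Ψ

/-- Membership in the ring of joint covariants ℂ[V4 ⊕ V6 ⊕ ℂ²]^{SL2(ℂ)}. -/
def IsCovRingElem (Ψ : MvPolynomial CVV ℂ) : Prop :=
  ∀ T : Matrix (Fin 2) (Fin 2) ℂ, T.det = 1 → ∀ α α' β β' : ℕ → ℂ,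
    BinTrans 4 T α α' → BinTrans 6 T β β' → ∀ u v : ℂ,
      evalCov Ψ α' β' u v = evalCov Ψ α β (T 0 0 * u + T 0 1 * v) (T 1 0 * u + T 1 1 * v)

/-- â_i in ℂ[α, β, α₀⁻¹]. -/
def ahat (α : ℕ → ℂ) (i : ℕ) : ℂ :=
  ∑ j ∈ Finset.range (i+1), α j * (Nat.choose (4-j) (4-i) : ℂ) * (-(α 1)/(4 * α 0)) ^ (i-j)

/-- b̂_i in ℂ[α, β, α₀⁻¹]. -/
def bhat (α β : ℕ → ℂ) (i : ℕ) : ℂ :=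
  ∑ j ∈ Finset.range (i+1), β j * (Nat.choose (6-j) (6-i) : ℂ) * (-(α 1)/(4 * α 0)) ^ (i-j)

/-- ĉ_i in ℂ[α, β, β₀⁻¹]. -/
def chat (α β : ℕ → ℂ) (i : ℕ) : ℂ :=
  ∑ j ∈ Finset.range (i+1), α j * (Nat.choose (4-j) (4-i) : ℂ) * (-(β 1)/(6 * β 0)) ^ (i-j)

/-- d̂_i in ℂ[α, β, β₀⁻¹]. -/
def dhat (β : ℕ → ℂ) (i : ℕ) : ℂ :=
  ∑ j ∈ Finset.range (i+1), β j * (Nat.choose (6-j) (6-i) : ℂ) * (-(β 1)/(6 * β 0)) ^ (i-j)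

/-- The images of the eleven generators of R under ψ. -/
def hatGens (α β : ℕ → ℂ) : Fin 11 → ℂ :=
  ![ahat α 0, ahat α 2, ahat α 3, ahat α 4, bhat α β 0, bhat α β 1, bhat α β 2,
    bhat α β 3, bhat α β 4, bhat α β 5, bhat α β 6]

/-- The images of the eleven generators of R̃ under ψ̃. -/
def cdhatGens (α β : ℕ → ℂ) : Fin 11 → ℂ :=
  ![chat α β 0, chat α β 1, chat α β 2, chat α β 3, chat α β 4, dhat β 0, dhat β 2,
    dhat β 3, dhat β 4, dhat β 5, dhat β 6]

/-- Weights picking out the a-variables among the eleven generators. -/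
def wA : Fin 11 → ℕ := ![1, 1, 1, 1, 0, 0, 0, 0, 0, 0, 0]

/-- Weights picking out the b-variables among the eleven generators. -/
def wB : Fin 11 → ℕ := ![0, 0, 0, 0, 1, 1, 1, 1, 1, 1, 1]

/-- Weights picking out the α-variables. -/
def wSVα : SV → ℕ := Sum.elim (fun _ => 1) (fun _ => 0)

/-- Weights picking out the β-variables. -/
def wSVβ : SV → ℕ := Sum.elim (fun _ => 0) (fun _ => 1)

/-- A joint semiinvariant of the quartic and sextic, of degrees (da, db) and order ω. -/
def IsSemiinvOf (Φ : MvPolynomial SV ℂ) (da db : ℕ) (ω : ℤ) : Prop :=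
  MvPolynomial.IsWeightedHomogeneous wSVα Φ da ∧
  MvPolynomial.IsWeightedHomogeneous wSVβ Φ db ∧
  IsSemiinvRingElem Φ ∧
  ∀ l : ℂ, l ≠ 0 → ∀ α α' β β' : ℕ → ℂ,
    BinTrans 4 !![l, 0; 0, l⁻¹] α α' → BinTrans 6 !![l, 0; 0, l⁻¹] β β' →
      evalSV Φ α' β' = l ^ ω * evalSV Φ α β

/-- Substitution α_i ↦ a_i (with a_1 = 0), β_j ↦ b_j into a polynomial in (α, β). -/
def subAB (Φ : MvPolynomial SV ℂ) : ℂ → (Fin 8 → ℂ) → ℂ :=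
  fun τ z => MvPolynomial.eval
    (Sum.elim (fun i : Fin 5 => aSW i.1 τ z) (fun j : Fin 7 => bSW j.1 τ z)) Φ

/-- The graph of the map ψ_J : a Jacobi form φ = Q(a_i, b_j) is sent to the
polynomial Φ = Q(â_i, b̂_j). -/
def PsiJRel (φ : ℂ → (Fin 8 → ℂ) → ℂ) (Φ : MvPolynomial SV ℂ) : Prop :=
  ∃ Q : MvPolynomial (Fin 11) ℂ,
    (∀ τ : ℂ, GoodTau τ → ∀ z, φ τ z = MvPolynomial.eval (fun i => abGens i τ z) Q) ∧
    (∀ α β : ℕ → ℂ, α 0 ≠ 0 → evalSV Φ α β = MvPolynomial.eval (hatGens α β) Q)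

open UpperHalfPlane ModularForm EisensteinSeries MatrixGroups Filter Topology in
lemma E4_eq (z : ℍ) : E4 z = E₄ z := by
  have hq : ‖qExp z‖ < 1 := by
    have := UpperHalfPlane.norm_exp_two_pi_I_lt_one z
    simpa [qExp, πC] using this
  rw [E4, tsum_pow_div_one_sub_eq_tsum_sigma hq 3,
    EisensteinSeries.q_expansion_bernoulli _ ⟨2, rfl⟩ z,
    show bernoulli 4 = -1/30 by
      rw [bernoulli_eq_bernoulli'_of_ne_one (by norm_num), bernoulli'_four]]
  simp [qExp, πC]
  norm_num

open UpperHalfPlane ModularForm EisensteinSeries MatrixGroups Filter Topology in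
lemma E6_eq (z : ℍ) : E6 z = E₆ z := by
  have hq : ‖qExp z‖ < 1 := by
    have := UpperHalfPlane.norm_exp_two_pi_I_lt_one z
    simpa [qExp, πC] using this
  rw [E6, tsum_pow_div_one_sub_eq_tsum_sigma hq 5,
    EisensteinSeries.q_expansion_bernoulli _ ⟨3, rfl⟩ z]
  have : bernoulli 6 = 1/42 := by decide +kernel
  rw [this]
  simp [qExp, πC]
  norm_num

open UpperHalfPlane ModularForm EisensteinSeries MatrixGroups Filter Topology in
lemma tendsto_E (k : ℕ) (hk : 3 ≤ k) (hk2 : Even k) :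
    Tendsto (fun z : ℍ => E hk z) atImInfty (𝓝 1) := by
  have hanal := ModularFormClass.analyticAt_cuspFunction_zero (E hk) one_pos
    one_mem_strictPeriods_SL
  have h0 : cuspFunction 1 (E hk) 0 = 1 := by
    have := E_qExpansion_coeff_zero hk hk2
    rw [qExpansion_coeff] at this
    simpa using this
  rw [← h0]
  exact (hanal.continuousAt.tendsto.comp (qParam_tendsto_atImInfty one_pos)).congr
    (fun τ ↦ SlashInvariantFormClass.eq_cuspFunction (E hk) τ one_mem_strictPeriods_SL one_ne_zero)

open UpperHalfPlane ModularForm EisensteinSeries MatrixGroups Filter Topology in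
lemma E_S_smul_vadd (k : ℕ) (hk : 3 ≤ k) (n : ℤ) (z : ℍ) :
    E hk (ModularGroup.S • (ModularGroup.T ^ n • z)) = ((z:ℂ) + n) ^ k * E hk z := by
  have hm : ∀ γ : SL(2, ℤ), (γ : GL (Fin 2) ℝ) ∈ 𝒮ℒ := fun γ => ⟨γ, rfl⟩
  have h1 := SlashInvariantForm.slash_action_eqn' (E hk) (hm ModularGroup.S)
    (ModularGroup.T ^ n • z)
  have h2 := SlashInvariantForm.slash_action_eqn' (E hk) (hm (ModularGroup.T ^ n)) z
  have he : ∀ (γ : SL(2, ℤ)) (i j), (γ : GL (Fin 2) ℝ) i j = ((γ i j : ℤ) : ℝ) := fun _ _ _ => rfl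
  simp only [← ModularGroup.sl_moeb, he] at h1 h2
  rw [h1, h2, modular_T_zpow_smul, ModularGroup.coe_T_zpow]
  simp [ModularGroup.S, add_comm]

open UpperHalfPlane in
/-- The point `iT` of the upper half-plane, extended by a constant for `T ≤ 0`. -/
def rayPt (T : ℝ) : ℍ := if h : 0 < T then ⟨Complex.I * T, by simpa using h⟩ else UpperHalfPlane.I

lemma coe_rayPt {T : ℝ} (h : 0 < T) : (rayPt T : ℂ) = I * T := by
  rw [rayPt, dif_pos h]

open UpperHalfPlane Filter Topology in
lemma tendsto_rayPt : Tendsto rayPt atTop atImInfty := by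
  rw [atImInfty, tendsto_comap_iff]
  refine tendsto_id.congr' ?_
  filter_upwards [eventually_gt_atTop 0] with T hT
  simp [← coe_im, coe_rayPt hT]

open Filter Topology in
lemma tendsto_E4 : Tendsto (fun T : ℝ => E4 (I * T)) atTop (𝓝 1) := by
  refine ((tendsto_E 4 (by norm_num) ⟨2, rfl⟩).comp tendsto_rayPt).congr' ?_
  filter_upwards [eventually_gt_atTop 0] with T hT
  rw [← coe_rayPt hT, E4_eq, Function.comp_apply]

open Filter Topology in
lemma tendsto_E6 : Tendsto (fun T : ℝ => E6 (I * T)) atTop (𝓝 1) := by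
  refine ((tendsto_E 6 (by norm_num) ⟨3, rfl⟩).comp tendsto_rayPt).congr' ?_
  filter_upwards [eventually_gt_atTop 0] with T hT
  rw [← coe_rayPt hT, E6_eq, Function.comp_apply]

lemma Dl_ne_zero {T : ℝ} (hT : 0 < T) : Dl (I * T) ≠ 0 := by
  rw [Dl, ← coe_rayPt hT, E4_eq, E6_eq, ← ModularForm.discriminant_eq_E₄_cube_sub_E₆_sq]
  exact ModularForm.discriminant_ne_zero _

open Filter Topology in
lemma eventually_goodTau : ∀ᶠ T : ℝ in atTop, GoodTau (I * T) := by
  filter_upwards [eventually_gt_atTop 0, tendsto_E4.eventually_ne one_ne_zero,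
    tendsto_E6.eventually_ne one_ne_zero] with T hT h4 h6
  exact ⟨by simpa using hT, h4, h6, Dl_ne_zero hT⟩

open MvPolynomial in
lemma eval_weighted_eq_zero_of_infinite (R : MvPolynomial (Fin 2) ℂ) (x y : ℂ) (s : Set ℂ)
    (hs : s.Infinite) (h : ∀ u ∈ s, eval ![u ^ 4 * x, u ^ 6 * y] R = 0) (u : ℂ) :
    eval ![u ^ 4 * x, u ^ 6 * y] R = 0 := by
  set p : Polynomial ℂ := aeval ![Polynomial.X ^ 4 * Polynomial.C x,
    Polynomial.X ^ 6 * Polynomial.C y] R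
  have hp : ∀ u, p.eval u = eval ![u ^ 4 * x, u ^ 6 * y] R := by
    intro u
    rw [← Polynomial.coe_evalRingHom, ← Polynomial.coe_aeval_eq_evalRingHom,
      RingHom.coe_coe]
    simp only [p, ← AlgHom.comp_apply, comp_aeval, ← coe_aeval_eq_eval, RingHom.coe_coe]
    congr 2
    ext i; fin_cases i <;> simp <;> ring
  have : p = 0 := Polynomial.eq_zero_of_infinite_isRoot p
    (hs.mono fun u hu => by simp [Polynomial.IsRoot, hp, h u hu])
  rw [← hp, this, Polynomial.eval_zero]


open UpperHalfPlane ModularForm EisensteinSeries MvPolynomial Filter Topology in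
lemma eval_E_eq_zero (R : MvPolynomial (Fin 2) ℂ) (T₀ : ℝ)
    (h : ∀ T > T₀, eval ![E4 (Complex.I * T), E6 (Complex.I * T)] R = 0) (z : ℍ) :
    eval ![E₄ z, E₆ z] R = 0 := by
  have h4 := UpperHalfPlane.mdifferentiable_iff.1 (E₄ : ModularForm _ 4).holo'
  have h6 := UpperHalfPlane.mdifferentiable_iff.1 (E₆ : ModularForm _ 6).holo'
  have hd : ∀ p : MvPolynomial (Fin 2) ℂ, DifferentiableOn ℂ
      ((fun z : ℍ => eval ![E₄ z, E₆ z] p) ∘ ofComplex) {z | 0 < z.im} := by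
    intro p
    induction p using MvPolynomial.induction_on with
    | C a => simp [Function.comp_def]
    | add p q hp hq => simp only [Function.comp_def, map_add] at hp hq ⊢; exact hp.add hq
    | mul_X p i hp =>
      fin_cases i
      · simp only [Function.comp_def, map_mul, eval_X] at hp ⊢; exact hp.mul h4
      · simp only [Function.comp_def, map_mul, eval_X] at hp ⊢; exact hp.mul h6
  have h0 : (fun z : ℍ => eval ![E₄ z, E₆ z] R) = 0 := by
    set t : ℝ := max T₀ 0 + 1
    have ht : T₀ < t ∧ 0 < t :=
      ⟨(le_max_left _ _).trans_lt (lt_add_one _), (le_max_right T₀ 0).trans_lt (lt_add_one _)⟩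
    refine eq_zero_of_frequently (UpperHalfPlane.mdifferentiable_iff.2 (hd R)) (τ := rayPt t) ?_
    have hc : Tendsto rayPt (𝓝[>] t) (𝓝[≠] rayPt t) := by
      refine tendsto_nhdsWithin_iff.2 ⟨?_, ?_⟩
      · rw [UpperHalfPlane.isOpenEmbedding_coe.isInducing.tendsto_nhds_iff]
        have : Tendsto (fun T : ℝ => Complex.I * T) (𝓝[>] t) (𝓝 (Complex.I * t)) :=
          ((continuous_const.mul Complex.continuous_ofReal).tendsto t).mono_left nhdsWithin_le_nhds
        rw [coe_rayPt ht.2]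
        refine this.congr' ?_
        filter_upwards [self_mem_nhdsWithin] with T hT
        exact (coe_rayPt (ht.2.trans hT)).symm
      · filter_upwards [self_mem_nhdsWithin] with T hT he
        have := congrArg (fun z : ℍ => (z : ℂ)) he
        simp only [coe_rayPt ht.2, coe_rayPt (ht.2.trans hT), mul_eq_mul_left_iff,
          Complex.I_ne_zero, or_false, Complex.ofReal_inj] at this
        exact hT.ne' this
    refine hc.frequently (Eventually.frequently ?_)
    filter_upwards [self_mem_nhdsWithin] with T hT
    rw [← h T (ht.1.trans hT), ← E4_eq, ← E6_eq, coe_rayPt (ht.2.trans hT)]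
  exact congrFun h0 z

open MvPolynomial Filter Topology in
theorem E4_E6_algebraicIndependent (R : MvPolynomial (Fin 2) ℂ) (T₀ : ℝ)
    (h : ∀ T > T₀, eval ![E4 (I * T), E6 (I * T)] R = 0) : R = 0 := by
  have hw : ∀ T : ℝ, ∀ u, eval ![u ^ 4 * E4 (rayPt T), u ^ 6 * E6 (rayPt T)] R = 0 := by
    intro T
    refine eval_weighted_eq_zero_of_infinite R _ _ (Set.range fun n : ℤ => (rayPt T : ℂ) + n)
      (Set.infinite_range_of_injective fun a b hab => by simpa using hab) ?_
    rintro _ ⟨n, rfl⟩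
    have := eval_E_eq_zero R T₀ h (ModularGroup.S • (ModularGroup.T ^ n • rayPt T))
    rwa [E_S_smul_vadd, E_S_smul_vadd, ← E4_eq, ← E6_eq] at this
  set f : ℝ → ℂ := fun T => E4 (I * T) ^ 3 / E6 (I * T) ^ 2
  have hf : Tendsto f atTop (𝓝 1) := by
    have := (tendsto_E4.pow 3).div (tendsto_E6.pow 2) (by simp)
    rwa [one_pow, one_pow, div_one] at this
  set J : Set ℂ := Set.image f {T | 0 < T ∧ E4 (I * T) ≠ 0 ∧ E6 (I * T) ≠ 0}
  have hJ : J.Infinite := by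
    intro hfin
    have h1 : (1 : ℂ) ∉ J := by
      rintro ⟨T, ⟨hT, -, h6⟩, h1⟩
      refine Dl_ne_zero hT ?_
      simp only [f, div_eq_one_iff_eq (pow_ne_zero 2 h6)] at h1
      rw [Dl, h1, sub_self, zero_div]
    have hev := hf.eventually (hfin.isClosed.isOpen_compl.mem_nhds h1)
    obtain ⟨T, hT, hg⟩ := (hev.and eventually_goodTau).exists
    exact hT ⟨T, ⟨by simpa using hg.1, hg.2.1, hg.2.2.1⟩, rfl⟩
  have hX : ∀ Y : ℂ, Y ≠ 0 → {X : ℂ | eval ![X, Y] R = 0}.Infinite := by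
    intro Y hY
    refine Set.Infinite.of_image (fun X => X ^ 3 / Y ^ 2) (hJ.mono ?_)
    rintro _ ⟨T, ⟨hT, h4, h6⟩, rfl⟩
    obtain ⟨X, hX⟩ := IsAlgClosed.exists_pow_nat_eq (f T * Y ^ 2) (n := 3) (by norm_num)
    refine ⟨X, ?_, by simp [hX, hY]⟩
    have hX0 : X ≠ 0 := by
      rintro rfl
      have : f T * Y ^ 2 = 0 := by rw [← hX]; norm_num
      simp [f, h4, h6, hY] at this
    set x := E4 (I * T)
    set y := E6 (I * T)
    have hX' : X ^ 3 * y ^ 2 = Y ^ 2 * x ^ 3 := by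
      rw [hX, show f T = x ^ 3 / y ^ 2 from rfl]; field_simp
    obtain ⟨u, hu⟩ := IsAlgClosed.exists_pow_nat_eq (Y * x / (X * y)) (n := 2) (by norm_num)
    have := hw T u
    rw [coe_rayPt hT] at this
    have e1 : u ^ 4 * x = X := by
      rw [show u ^ 4 = (u ^ 2) ^ 2 by ring, hu]; field_simp
      linear_combination -hX'
    have e2 : u ^ 6 * y = Y := by
      rw [show u ^ 6 = (u ^ 2) ^ 3 by ring, hu]; field_simp
      linear_combination -hX'
    rwa [e1, e2] at this
  have hall : ∀ Y : ℂ, Y ≠ 0 → ∀ X, eval ![X, Y] R = 0 := by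
    intro Y hY X
    set p : Polynomial ℂ := aeval ![Polynomial.X, Polynomial.C Y] R
    have hp : ∀ u, p.eval u = eval ![u, Y] R := by
      intro u
      rw [← Polynomial.coe_evalRingHom, ← Polynomial.coe_aeval_eq_evalRingHom,
        RingHom.coe_coe]
      simp only [p, ← AlgHom.comp_apply, comp_aeval, ← coe_aeval_eq_eval, RingHom.coe_coe]
      congr 2
      ext i; fin_cases i <;> simp
    have : p = 0 := Polynomial.eq_zero_of_infinite_isRoot p
      ((hX Y hY).mono fun u hu => by simpa [Polynomial.IsRoot, hp] using hu)
    rw [← hp, this, Polynomial.eval_zero]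
  refine MvPolynomial.funext_set ![Set.univ, {0}ᶜ] ?_ ?_
  · intro i; fin_cases i
    · exact Set.infinite_univ
    · exact Set.Finite.infinite_compl (Set.finite_singleton 0)
  · intro v hv
    have h1 : v 1 ≠ 0 := by simpa using hv 1 (Set.mem_univ _)
    have := hall (v 1) h1 (v 0)
    rw [show ![v 0, v 1] = v by ext i; fin_cases i <;> rfl] at this
    rw [this, map_zero]

/-! ### The Seiberg–Witten coefficients as polynomials in the nine basic forms -/

def a2Val (x d A1 A2 : ℂ) : ℂ :=
  6 / (x * d) * (-x * A2 + A1 ^ 2)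

def a3Val (x y d A1 A2 A3 B2 B3 : ℂ) : ℂ :=
  1 / (9 * x ^ 2 * d ^ 2) *
    (-7 * x ^ 2 * y * A3 - 20 * x ^ 3 * B3
      - 9 * x * y * A1 * A2 + 30 * x ^ 2 * A1 * B2
      + 6 * y * A1 ^ 3)

def a4Val (x y d A1 A2 A3 A4 B2 : ℂ) : ℂ :=
  1 / (288 * x ^ 3 * d ^ 3) *
    (576 * x ^ 3 * d * A4 + 32256 * x ^ 2 * d * A1 * A3
      - 9 * x ^ 5 * A2 ^ 2 - 30 * x ^ 3 * y * A2 * B2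
      - 25 * x ^ 4 * B2 ^ 2
      + (60 * x ^ 4 - 12 * x * y ^ 2) * A1 ^ 2 * A2
      + 80 * x ^ 2 * y * A1 ^ 2 * B2
      + (-70 * x ^ 3 + 6 * y ^ 2) * A1 ^ 4)

def b1Val (x A1 : ℂ) : ℂ := -4 / x * A1

def b2Val (x y d A1 B2 : ℂ) : ℂ :=
  5 / (6 * x ^ 2 * d) * (x ^ 2 * B2 - y * A1 ^ 2)

def b3Val (x y d A1 A2 A3 B2 B3 : ℂ) : ℂ :=
  1 / (108 * x ^ 3 * d ^ 2) *
    (-7 * x ^ 5 * A3 - 20 * x ^ 3 * y * B3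
      - 9 * x ^ 4 * A1 * A2 + 30 * x ^ 2 * y * A1 * B2
      + (16 * x ^ 3 - 10 * y ^ 2) * A1 ^ 3)

def b4Val (x y d A1 A2 B2 B3 B4 : ℂ) : ℂ :=
  1 / (1728 * x ^ 4 * d ^ 3) *
    (-8640 * x ^ 4 * d * B4 + 138240 * x ^ 3 * d * A1 * B3
      + 9 * x ^ 5 * y * A2 ^ 2 + 30 * x ^ 6 * A2 * B2
      + 25 * x ^ 4 * y * B2 ^ 2
      - 48 * x ^ 4 * y * A1 ^ 2 * A2
      + (-140 * x ^ 5 + 60 * x ^ 2 * y ^ 2) * A1 ^ 2 * B2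
      + (74 * x ^ 3 * y - 10 * y ^ 3) * A1 ^ 4)

def b5Val (x y d A1 A2 A3 A5 B2 B3 : ℂ) : ℂ :=
  1 / (72 * x ^ 5 * d ^ 3) *
    (-36288 * x ^ 4 * d * A5 - 294 * x ^ 6 * A2 * A3
      - 770 * x ^ 4 * y * B2 * A3 - 840 * x ^ 4 * y * A2 * B3
      - 2200 * x ^ 5 * B2 * B3 + 168 * x ^ 5 * A1 ^ 2 * A3
      + 480 * x ^ 3 * y * A1 ^ 2 * B3 - 621 * x ^ 5 * A1 * A2 ^ 2
      + 3525 * x ^ 4 * A1 * B2 ^ 2 + 1224 * x ^ 4 * A1 ^ 3 * A2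
      - 240 * x ^ 2 * y * A1 ^ 3 * B2
      + (-456 * x ^ 3 + 24 * y ^ 2) * A1 ^ 5)

def b6Val (x y d A1 A2 A3 A4 A5 B2 B3 B4 B6 : ℂ) : ℂ :=
  1 / (4478976 * x ^ 6 * d ^ 5) *
    (-19906560 * x ^ 6 * d ^ 2 * B6
      - 188116992 * x ^ 4 * y * d ^ 2 * A1 * A5
      - 5184 * x ^ 7 * y * d * A2 * A4
      - 8640 * x ^ 8 * d * B2 * A4
      - 103680 * x ^ 8 * d * A2 * B4
      - 172800 * x ^ 6 * y * d * B2 * B4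
      + 12672 * x ^ 6 * y * d * A1 ^ 2 * A4
      + 17280 * (5 * x ^ 7 + 9 * x ^ 4 * y ^ 2) * d * A1 ^ 2 * B4
      + 112896 * x ^ 7 * y * d * A3 ^ 2
      + 645120 * x ^ 8 * d * A3 * B3
      + 921600 * x ^ 6 * y * d * B3 ^ 2
      - 1717632 * x ^ 6 * y * d * A1 * A2 * A3
      - 362880 * (4 * x ^ 7 + 11 * x ^ 4 * y ^ 2) * d * A1 * B2 * A3
      + 483840 * (4 * x ^ 7 - 9 * x ^ 4 * y ^ 2) * d * A1 * A2 * B3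
      - 11404800 * x ^ 5 * y * d * A1 * B2 * B3
      + 1161216 * x ^ 5 * y * d * A1 ^ 3 * A3
      - 92160 * (37 * x ^ 6 - 9 * x ^ 3 * y ^ 2) * d * A1 ^ 3 * B3
      + (135 * x ^ 9 * y + 54 * x ^ 6 * y ^ 3) * A2 ^ 3
      + (405 * x ^ 10 + 540 * x ^ 7 * y ^ 2) * A2 ^ 2 * B2
      + 1575 * x ^ 8 * y * A2 * B2 ^ 2
      + (375 * x ^ 9 + 500 * x ^ 6 * y ^ 2) * B2 ^ 3
      + (-3159 * x ^ 8 * y + 1701 * x ^ 5 * y ^ 3) * A1 ^ 2 * A2 ^ 2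
      + (-3060 * x ^ 9 - 1800 * x ^ 6 * y ^ 2) * A1 ^ 2 * A2 * B2
      + (6975 * x ^ 7 * y - 11025 * x ^ 4 * y ^ 3) * A1 ^ 2 * B2 ^ 2
      + (6768 * x ^ 7 * y - 3024 * x ^ 4 * y ^ 3) * A1 ^ 4 * A2
      + (4260 * x ^ 8 + 1800 * x ^ 5 * y ^ 2 + 180 * x ^ 2 * y ^ 4) * A1 ^ 4 * B2
      + (-3692 * x ^ 6 * y + 504 * x ^ 3 * y ^ 3 - 12 * y ^ 5) * A1 ^ 6)


def aVal (x y d : ℂ) (F : Fin 9 → ℂ) : ℕ → ℂ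
  | 0 => x / 12
  | 2 => a2Val x d (F 0) (F 1)
  | 3 => a3Val x y d (F 0) (F 1) (F 2) (F 5) (F 6)
  | 4 => a4Val x y d (F 0) (F 1) (F 2) (F 3) (F 5)
  | _ => 0

def bVal (x y d : ℂ) (F : Fin 9 → ℂ) : ℕ → ℂ
  | 0 => y / 216
  | 1 => b1Val x (F 0)
  | 2 => b2Val x y d (F 0) (F 5)
  | 3 => b3Val x y d (F 0) (F 1) (F 2) (F 5) (F 6)
  | 4 => b4Val x y d (F 0) (F 1) (F 5) (F 6) (F 7)
  | 5 => b5Val x y d (F 0) (F 1) (F 2) (F 4) (F 5) (F 6)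
  | 6 => b6Val x y d (F 0) (F 1) (F 2) (F 3) (F 4) (F 5) (F 6) (F 7) (F 8)
  | _ => 0

def uVal (x y d : ℂ) (F : Fin 9 → ℂ) : ℂ := -(bVal x y d F 1) / (6 * bVal x y d F 0)

def cVal (x y d : ℂ) (F : Fin 9 → ℂ) (i : ℕ) : ℂ :=
  ∑ j ∈ Finset.range (i+1), aVal x y d F j * (Nat.choose (4-j) (4-i) : ℂ) * uVal x y d F ^ (i-j)

def dVal (x y d : ℂ) (F : Fin 9 → ℂ) (j : ℕ) : ℂ :=
  ∑ l ∈ Finset.range (j+1), bVal x y d F l * (Nat.choose (6-l) (6-j) : ℂ) * uVal x y d F ^ (j-l)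

/-- The eleven generators as functions of `E4, E6, Δ` and the nine basic forms. -/
def cdVal (x y d : ℂ) (F : Fin 9 → ℂ) : Fin 11 → ℂ :=
  ![cVal x y d F 0, cVal x y d F 1, cVal x y d F 2, cVal x y d F 3, cVal x y d F 4,
    dVal x y d F 0, dVal x y d F 2, dVal x y d F 3, dVal x y d F 4, dVal x y d F 5, dVal x y d F 6]

lemma cdGens_eq (τ : ℂ) (z : Fin 8 → ℂ) (i : Fin 11) :
    cdGens i τ z = cdVal (E4 τ) (E6 τ) (Dl τ) (fun j => nineForms j τ z) i := by
  have ha : ∀ j, aSW j τ z = aVal (E4 τ) (E6 τ) (Dl τ) (fun j => nineForms j τ z) j := by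
    intro j
    match j with
    | 0 | 1 | 2 | 3 | 4 | (n + 5) => rfl
  have hb : ∀ j, bSW j τ z = bVal (E4 τ) (E6 τ) (Dl τ) (fun j => nineForms j τ z) j := by
    intro j
    match j with
    | 0 | 1 | 2 | 3 | 4 | 5 | 6 | (n + 7) => rfl
  have hu : uShift τ z = uVal (E4 τ) (E6 τ) (Dl τ) (fun j => nineForms j τ z) := by
    rw [uShift, uVal, hb, hb]
  have hc : ∀ j, cSW j τ z = cVal (E4 τ) (E6 τ) (Dl τ) (fun j => nineForms j τ z) j := by
    intro j; simp only [cSW, cVal, ha, hu]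
  have hd : ∀ j, dSW j τ z = dVal (E4 τ) (E6 τ) (Dl τ) (fun j => nineForms j τ z) j := by
    intro j; simp only [dSW, dVal, hb, hu]
  fin_cases i <;> first | exact hc _ | exact hd _

/-- Polynomial functions on `ℂ⁹`. -/
def IsPoly (f : (Fin 9 → ℂ) → ℂ) : Prop :=
  ∃ p : MvPolynomial (Fin 9) ℂ, ∀ F, MvPolynomial.eval F p = f F

lemma IsPoly.const (c : ℂ) : IsPoly fun _ => c := ⟨MvPolynomial.C c, fun F => by simp⟩
lemma IsPoly.coord (i : Fin 9) : IsPoly fun F => F i := ⟨MvPolynomial.X i, fun F => by simp⟩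
lemma IsPoly.add {f g : (Fin 9 → ℂ) → ℂ} (hf : IsPoly f) (hg : IsPoly g) :
    IsPoly fun F => f F + g F := by
  obtain ⟨p, hp⟩ := hf; obtain ⟨q, hq⟩ := hg; exact ⟨p + q, fun F => by simp [hp, hq]⟩
lemma IsPoly.sub {f g : (Fin 9 → ℂ) → ℂ} (hf : IsPoly f) (hg : IsPoly g) :
    IsPoly fun F => f F - g F := by
  obtain ⟨p, hp⟩ := hf; obtain ⟨q, hq⟩ := hg; exact ⟨p - q, fun F => by simp [hp, hq]⟩
lemma IsPoly.neg {f : (Fin 9 → ℂ) → ℂ} (hf : IsPoly f) : IsPoly fun F => -f F := by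
  obtain ⟨p, hp⟩ := hf; exact ⟨-p, fun F => by simp [hp]⟩
lemma IsPoly.mul {f g : (Fin 9 → ℂ) → ℂ} (hf : IsPoly f) (hg : IsPoly g) :
    IsPoly fun F => f F * g F := by
  obtain ⟨p, hp⟩ := hf; obtain ⟨q, hq⟩ := hg; exact ⟨p * q, fun F => by simp [hp, hq]⟩
lemma IsPoly.pow {f : (Fin 9 → ℂ) → ℂ} (hf : IsPoly f) (n : ℕ) : IsPoly fun F => f F ^ n := by
  obtain ⟨p, hp⟩ := hf; exact ⟨p ^ n, fun F => by simp [hp]⟩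
lemma IsPoly.sum {ι : Type*} (s : Finset ι) {f : ι → (Fin 9 → ℂ) → ℂ} (hf : ∀ i, IsPoly (f i)) :
    IsPoly fun F => ∑ i ∈ s, f i F := by
  choose p hp using hf; exact ⟨∑ i ∈ s, p i, fun F => by simp [hp]⟩

lemma isPoly_cdVal (x y d : ℂ) (i : Fin 11) : IsPoly fun F => cdVal x y d F i := by
  have ha : ∀ j, IsPoly fun F => aVal x y d F j := by
    intro j
    match j with
    | 0 => exact IsPoly.const _
    | 1 => exact IsPoly.const _
    | (n + 5) => exact IsPoly.const _
    | 2 | 3 | 4 =>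
      simp only [aVal, a2Val, a3Val, a4Val]
      repeat' first | exact IsPoly.const _ | exact IsPoly.coord _ | apply IsPoly.add |
        apply IsPoly.sub | apply IsPoly.mul
  have hb : ∀ j, IsPoly fun F => bVal x y d F j := by
    intro j
    match j with
    | 0 => exact IsPoly.const _
    | (n + 7) => exact IsPoly.const _
    | 1 | 2 | 3 | 4 | 5 | 6 =>
      simp only [bVal, b1Val, b2Val, b3Val, b4Val, b5Val, b6Val]
      repeat' first | exact IsPoly.const _ | exact IsPoly.coord _ | apply IsPoly.add |
        apply IsPoly.sub | apply IsPoly.mul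
  have hu : IsPoly fun F => uVal x y d F := by
    simp only [uVal, div_eq_mul_inv]
    exact (hb 1).neg.mul (IsPoly.const (6 * (y / 216))⁻¹)
  have hc : ∀ j, IsPoly fun F => cVal x y d F j := fun j =>
    IsPoly.sum _ fun l => ((ha l).mul (IsPoly.const _)).mul (hu.pow _)
  have hd : ∀ j, IsPoly fun F => dVal x y d F j := fun j =>
    IsPoly.sum _ fun l => ((hb l).mul (IsPoly.const _)).mul (hu.pow _)
  fin_cases i <;> first | exact hc _ | exact hd _

lemma exists_eq_of_affine (f : ℂ → ℂ) (c t : ℂ) (hc : c ≠ 0) (hf : ∀ x, f x = c * x + f 0) :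
    ∃ x, f x = t := by
  refine ⟨(t - f 0) / c, ?_⟩
  rw [hf, mul_div_cancel₀ _ hc, sub_add_cancel]

set_option maxHeartbeats 1000000 in
lemma exists_abVal (x y d : ℂ) (hx : x ≠ 0) (hd : d ≠ 0) (hdd : d = (x ^ 3 - y ^ 2) / 1728)
    (a : Fin 3 → ℂ) (b : Fin 6 → ℂ) :
    ∃ F : Fin 9 → ℂ, a2Val x d (F 0) (F 1) = a 0 ∧
      a3Val x y d (F 0) (F 1) (F 2) (F 5) (F 6) = a 1 ∧
      a4Val x y d (F 0) (F 1) (F 2) (F 3) (F 5) = a 2 ∧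
      b1Val x (F 0) = b 0 ∧ b2Val x y d (F 0) (F 5) = b 1 ∧
      b3Val x y d (F 0) (F 1) (F 2) (F 5) (F 6) = b 2 ∧
      b4Val x y d (F 0) (F 1) (F 5) (F 6) (F 7) = b 3 ∧
      b5Val x y d (F 0) (F 1) (F 2) (F 4) (F 5) (F 6) = b 4 ∧
      b6Val x y d (F 0) (F 1) (F 2) (F 3) (F 4) (F 5) (F 6) (F 7) (F 8) = b 5 := by
  have hxy : y ^ 2 - x ^ 3 ≠ 0 := by
    intro h; apply hd; rw [hdd, ← neg_sub, h]; simp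
  obtain ⟨A1, h1⟩ : ∃ A1,
      b1Val x A1 = b 0 := by
    refine ⟨-b 0 * x / 4, ?_⟩
    simp only [b1Val]
    field_simp
  obtain ⟨A2, h2⟩ : ∃ A2,
      a2Val x d A1 A2 = a 0 := by
    refine exists_eq_of_affine (fun A2 => a2Val x d A1 A2)
      (-6 / d) (a 0) (by simpa using hd) ?_
    intro X
    simp only [a2Val]
    field_simp
    ring
  obtain ⟨B2, h3⟩ : ∃ B2,
      b2Val x y d A1 B2 = b 1 := by
    refine exists_eq_of_affine (fun B2 => b2Val x y d A1 B2)
      (5 / (6 * d)) (b 1) (by simpa using hd) ?_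
    intro X
    simp only [b2Val]
    field_simp
    ring
  obtain ⟨A3, B3, h4⟩ : ∃ A3 B3,
      a3Val x y d A1 A2 A3 B2 B3 = a 1 ∧
      b3Val x y d A1 A2 A3 B2 B3 = b 2 := by
    set p := a 1 * (9 * x ^ 2 * d ^ 2) - (- 9 * x * y * A1 * A2 + 30 * x ^ 2 * A1 * B2
      + 6 * y * A1 ^ 3) with hp
    set q := b 2 * (108 * x ^ 3 * d ^ 2) - (- 9 * x ^ 4 * A1 * A2 + 30 * x ^ 2 * y * A1 * B2
      + (16 * x ^ 3 - 10 * y ^ 2) * A1 ^ 3) with hq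
    refine ⟨(p * y - q) / (-7 * x ^ 2 * (y ^ 2 - x ^ 3)),
      (q * y - x ^ 3 * p) / (-20 * x ^ 3 * (y ^ 2 - x ^ 3)), ?_, ?_⟩
    · have e : a 1 = (p + (- 9 * x * y * A1 * A2 + 30 * x ^ 2 * A1 * B2
        + 6 * y * A1 ^ 3)) / (9 * x ^ 2 * d ^ 2) := by rw [hp]; field_simp; ring
      clear_value p q
      rw [e]
      simp only [a3Val]
      field_simp
      ring
    · have e : b 2 = (q + (- 9 * x ^ 4 * A1 * A2 + 30 * x ^ 2 * y * A1 * B2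
        + (16 * x ^ 3 - 10 * y ^ 2) * A1 ^ 3)) / (108 * x ^ 3 * d ^ 2) := by
          rw [hq]; field_simp; ring
      clear_value p q
      rw [e]
      simp only [b3Val]
      field_simp
      ring
  obtain ⟨A4, h5⟩ : ∃ A4,
      a4Val x y d A1 A2 A3 A4 B2 = a 2 := by
    refine exists_eq_of_affine (fun A4 => a4Val x y d A1 A2 A3 A4 B2)
      (1 / (288 * x ^ 3 * d ^ 3) * (576 * x ^ 3 * d)) (a 2) (by simp [hd, hx]) ?_
    intro X
    simp only [a4Val]
    ring
  obtain ⟨B4, h6⟩ : ∃ B4,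
      b4Val x y d A1 A2 B2 B3 B4 = b 3 := by
    refine exists_eq_of_affine (fun B4 => b4Val x y d A1 A2 B2 B3 B4)
      (1 / (1728 * x ^ 4 * d ^ 3) * (-8640 * x ^ 4 * d)) (b 3) (by simp [hd, hx]) ?_
    intro X
    simp only [b4Val]
    ring
  obtain ⟨A5, h7⟩ : ∃ A5,
      b5Val x y d A1 A2 A3 A5 B2 B3 = b 4 := by
    refine exists_eq_of_affine (fun A5 => b5Val x y d A1 A2 A3 A5 B2 B3)
      (1 / (72 * x ^ 5 * d ^ 3) * (-36288 * x ^ 4 * d)) (b 4) (by simp [hd, hx]) ?_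
    intro X
    simp only [b5Val]
    ring
  obtain ⟨B6, h8⟩ : ∃ B6, b6Val x y d A1 A2 A3 A4 A5 B2 B3 B4 B6 = b 5 := by
    refine exists_eq_of_affine (fun B6 => b6Val x y d A1 A2 A3 A4 A5 B2 B3 B4 B6)
      (1 / (4478976 * x ^ 6 * d ^ 5) * (-19906560 * x ^ 6 * d ^ 2)) (b 5) (by simp [hd, hx]) ?_
    intro X
    simp only [b6Val, sub_eq_add_neg, add_assoc]
    rw [mul_zero, zero_add, mul_add]
    congr 1
    ring
  exact ⟨![A1, A2, A3, A4, A5, B2, B3, B4, B6], h2, h4.1, h5, h1, h3, h4.2, h6, h7, h8⟩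

set_option linter.unusedSimpArgs false in
set_option maxHeartbeats 1000000 in
lemma exists_cdVal (x y d : ℂ) (hx : x ≠ 0) (hy : y ≠ 0) (hd : d ≠ 0)
    (hdd : d = (x ^ 3 - y ^ 2) / 1728) (v : Fin 11 → ℂ) (h0 : v 0 = x / 12) (h5 : v 5 = y / 216) :
    ∃ F : Fin 9 → ℂ, cdVal x y d F = v := by
  set u := 3 * v 1 / x with hu
  set b1 := -(y / 36) * u with hb1
  set a2 := v 2 - x / 2 * u ^ 2 with ha2
  set a3 := v 3 - (x / 3 * u ^ 3 + 2 * a2 * u) with ha3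
  set a4 := v 4 - (x / 12 * u ^ 4 + a2 * u ^ 2 + a3 * u) with ha4
  set b2 := v 6 - (y / 216 * 15 * u ^ 2 + b1 * 5 * u) with hb2
  set b3 := v 7 - (y / 216 * 20 * u ^ 3 + b1 * 10 * u ^ 2 + b2 * 4 * u) with hb3
  set b4 := v 8 - (y / 216 * 15 * u ^ 4 + b1 * 10 * u ^ 3 + b2 * 6 * u ^ 2 + b3 * 3 * u) with hb4
  set b5 := v 9 - (y / 216 * 6 * u ^ 5 + b1 * 5 * u ^ 4 + b2 * 4 * u ^ 3 + b3 * 3 * u ^ 2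
    + b4 * 2 * u) with hb5
  set b6 := v 10 - (y / 216 * u ^ 6 + b1 * u ^ 5 + b2 * u ^ 4 + b3 * u ^ 3
    + b4 * u ^ 2 + b5 * u) with hb6
  obtain ⟨F, e1, e2, e3, e4, e5, e6, e7, e8, e9⟩ :=
    exists_abVal x y d hx hd hdd ![a2, a3, a4] ![b1, b2, b3, b4, b5, b6]
  simp only [Matrix.cons_val] at e1 e2 e3 e4 e5 e6 e7 e8 e9
  have eu : uVal x y d F = u := by
    simp only [uVal, bVal, e4, hb1]
    field_simp
    ring
  have ev1 : v 1 = x / 3 * u := by rw [hu]; field_simp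
  clear_value b6 b5 b4 b3 b2 a4 a3 a2 b1 u
  refine ⟨F, ?_⟩
  ext i
  have hch : Nat.choose 4 3 = 4 ∧ Nat.choose 4 2 = 6 ∧ Nat.choose 6 4 = 15 ∧ Nat.choose 5 4 = 5 ∧
      Nat.choose 6 3 = 20 ∧ Nat.choose 5 3 = 10 ∧ Nat.choose 4 3 = 4 ∧ Nat.choose 6 2 = 15 ∧
      Nat.choose 5 2 = 10 ∧ Nat.choose 3 2 = 3 := by decide
  obtain ⟨k1, k2, k3, k4, k5, k6, k7, k8, k9, k10⟩ := hch
  fin_cases i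
  · change cVal x y d F 0 = v 0
    simp [cVal, aVal, h0]
  · change cVal x y d F 1 = v 1
    simp [cVal, aVal, Finset.sum_range_succ, eu, ev1]
    left
    ring
  · change cVal x y d F 2 = v 2
    simp [cVal, aVal, Finset.sum_range_succ, eu, e1, e2, e3, k1, k2]
    linear_combination ha2
  · change cVal x y d F 3 = v 3
    simp [cVal, aVal, Finset.sum_range_succ, eu, e1, e2, e3, k1, k2]
    linear_combination ha3
  · change cVal x y d F 4 = v 4
    simp [cVal, aVal, Finset.sum_range_succ, eu, e1, e2, e3, k1, k2]
    linear_combination ha4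
  · change dVal x y d F 0 = v 5
    simp [dVal, bVal, h5]
  · change dVal x y d F 2 = v 6
    simp [dVal, bVal, Finset.sum_range_succ, eu, e4, e5, e6, e7, e8, e9, k1, k2, k3, k4, k5, k6, k8,
      k9, k10]
    linear_combination hb2
  · change dVal x y d F 3 = v 7
    simp [dVal, bVal, Finset.sum_range_succ, eu, e4, e5, e6, e7, e8, e9, k1, k2, k3, k4, k5, k6, k8,
      k9, k10]
    linear_combination hb3
  · change dVal x y d F 4 = v 8
    simp [dVal, bVal, Finset.sum_range_succ, eu, e4, e5, e6, e7, e8, e9, k1, k2, k3, k4, k5, k6, k8,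
      k9, k10]
    linear_combination hb4
  · change dVal x y d F 5 = v 9
    simp [dVal, bVal, Finset.sum_range_succ, eu, e4, e5, e6, e7, e8, e9, k1, k2, k3, k4, k5, k6, k8,
      k9, k10]
    linear_combination hb5
  · change dVal x y d F 6 = v 10
    simp [dVal, bVal, Finset.sum_range_succ, eu, e4, e5, e6, e7, e8, e9, k1, k2, k3, k4, k5, k6, k8,
      k9, k10]
    linear_combination hb6

open MvPolynomial Filter in
/-- It suffices that, high up on the imaginary axis, the nine basic forms satisfy no polynomial
relation in `z`. -/
theorem eq_zero_of_nineForms_dense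
    (hdense : ∀ᶠ T : ℝ in atTop, ∀ Q : MvPolynomial (Fin 9) ℂ,
      (∀ z, eval (fun i => nineForms i (I * T) z) Q = 0) → Q = 0)
    (P : MvPolynomial (Fin 11) ℂ)
    (hP : ∀ τ : ℂ, GoodTau τ → ∀ z : Fin 8 → ℂ, eval (fun i => cdGens i τ z) P = 0) : P = 0 := by
  have key : ∀ᶠ T : ℝ in atTop, ∀ v : Fin 11 → ℂ, v 0 = E4 (I * T) / 12 → v 5 = E6 (I * T) / 216 →
      eval v P = 0 := by
    filter_upwards [hdense, eventually_goodTau] with T hT hg v h0 h5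
    obtain ⟨F, rfl⟩ := exists_cdVal _ _ _ hg.2.1 hg.2.2.1 hg.2.2.2 rfl v h0 h5
    choose p hp using isPoly_cdVal (E4 (I * T)) (E6 (I * T)) (Dl (I * T))
    have hcomp : ∀ F, eval F (bind₁ p P) =
        eval (cdVal (E4 (I * T)) (E6 (I * T)) (Dl (I * T)) F) P := by
      intro F
      rw [← coe_aeval_eq_eval, ← coe_aeval_eq_eval, RingHom.coe_coe, RingHom.coe_coe, aeval_bind₁]
      congr 2
      ext i
      exact hp i F
    have h := hT (bind₁ p P) fun z => by
      rw [hcomp, ← hP (I * T) hg z]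
      congr 2
      ext i
      exact (cdGens_eq _ _ _).symm
    rw [← hcomp, h, map_zero]
  obtain ⟨T₀, hT₀⟩ := eventually_atTop.1 key
  refine MvPolynomial.funext fun v => ?_
  rw [map_zero]
  set s : Fin 11 → MvPolynomial (Fin 2) ℂ := fun i =>
    if i = 0 then C (1 / 12) * X 0 else if i = 5 then C (1 / 216) * X 1 else C (v i)
  have hs : ∀ w : Fin 2 → ℂ, eval w (bind₁ s P) = eval (fun i => eval w (s i)) P := by
    intro w
    rw [← coe_aeval_eq_eval, ← coe_aeval_eq_eval, RingHom.coe_coe, RingHom.coe_coe, aeval_bind₁]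
  have hR : bind₁ s P = 0 := E4_E6_algebraicIndependent _ T₀ fun T hT => by
    rw [hs]
    refine hT₀ T hT.le _ ?_ ?_
    · simp [s]; ring
    · simp [s]; ring
  have := hs ![12 * v 0, 216 * v 5]
  rw [hR, map_zero] at this
  rw [this]
  congr 2
  ext i
  by_cases h0 : i = 0
  · subst h0; simp [s]
  · by_cases h5 : i = 5
    · subst h5; simp [s]
    · simp [s, h0, h5]

lemma hasSum_pi_prod {n : ℕ} (f : Fin n → ℤ → ℂ) (hf : ∀ i, Summable fun k => ‖f i k‖) :
    Summable (fun x : Fin n → ℤ => ‖∏ i, f i (x i)‖) ∧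
      ∑' x : Fin n → ℤ, ∏ i, f i (x i) = ∏ i, ∑' k, f i k := by
  induction n with
  | zero => exact ⟨Summable.of_finite, by simp⟩
  | succ n ih =>
    obtain ⟨h1, h2⟩ := ih (fun i => f i.succ) fun i => hf i.succ
    have key : ∀ p : ℤ × (Fin n → ℤ), ∏ i, f i (Fin.consEquiv (fun _ => ℤ) p i) =
        f 0 p.1 * ∏ i : Fin n, f i.succ (p.2 i) := by
      intro p
      rw [Fin.prod_univ_succ]
      simp [Fin.consEquiv]
    constructor
    · rw [← (Fin.consEquiv fun _ : Fin (n + 1) => ℤ).summable_iff]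
      refine ((hf 0).mul_of_nonneg h1 (fun _ => norm_nonneg _) (fun _ => norm_nonneg _)).congr ?_
      intro p
      simp only [Function.comp, key, norm_mul]
    · rw [← (Fin.consEquiv fun _ : Fin (n + 1) => ℤ).tsum_eq, Fin.prod_univ_succ, ← h2,
        tsum_mul_tsum_of_summable_norm (hf 0) h1]
      exact tsum_congr key

lemma prod_neg_one_zpow {ι : Type*} (s : Finset ι) (n : ι → ℤ) :
    ∏ i ∈ s, (-1 : ℂ) ^ n i = (-1) ^ ∑ i ∈ s, n i := by
  classical
  induction s using Finset.induction_on with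
  | empty => simp
  | insert a s ha ih =>
    rw [Finset.prod_insert ha, Finset.sum_insert ha, ih, zpow_add₀ (by norm_num)]

/-- Integer vectors with even coordinate sum. -/
abbrev EvenVec : Type := {n : Fin 8 → ℤ // Even (∑ i, n i)}

lemma tsum_evenVec (f : Fin 8 → ℤ → ℂ) (hf : ∀ i, Summable fun k => ‖f i k‖) :
    Summable (fun n : EvenVec => ∏ i, f i (n.1 i)) ∧
    ∑' n : EvenVec, ∏ i, f i (n.1 i) =
      (∏ i, ∑' k, f i k + ∏ i, ∑' k : ℤ, (-1) ^ k * f i k) / 2 := by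
  obtain ⟨h1, h2⟩ := hasSum_pi_prod f hf
  obtain ⟨h3, h4⟩ := hasSum_pi_prod (fun i k => (-1) ^ k * f i k) fun i => by
    refine (hf i).congr fun k => ?_
    simp
  refine ⟨(h1.of_norm).comp_injective Subtype.val_injective, ?_⟩
  rw [← h2, ← h4, ← h1.of_norm.tsum_add h3.of_norm, ← tsum_div_const]
  refine (tsum_subtype {n : Fin 8 → ℤ | Even (∑ i, n i)} (fun n => ∏ i, f i (n i))).trans ?_
  refine tsum_congr fun n => ?_
  rw [Finset.prod_mul_distrib, prod_neg_one_zpow]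
  by_cases h : Even (∑ i, n i)
  · rw [Set.indicator_of_mem (by exact h), h.neg_one_zpow]; ring
  · rw [Set.indicator_of_notMem (by exact h), (Int.not_even_iff_odd.1 h).neg_one_zpow]; ring

/-- The two cosets of the integral part of the `E8` lattice. -/
def evenVecToE8 : EvenVec ⊕ EvenVec → E8Lattice :=
  Sum.elim
    (fun n => ⟨fun i => n.1 i, Or.inl fun i => ⟨n.1 i, rfl⟩, by
      obtain ⟨m, hm⟩ := n.2
      exact ⟨m, by rw [← Int.cast_sum, hm]; push_cast; ring⟩⟩)
    (fun n => ⟨fun i => n.1 i - 1 / 2, Or.inr fun i => ⟨n.1 i - 1, by push_cast; ring⟩, by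
      obtain ⟨m, hm⟩ := n.2
      refine ⟨m - 2, ?_⟩
      rw [Finset.sum_sub_distrib, ← Int.cast_sum, hm]
      simp
      ring⟩)

lemma int_ne_half (a b : ℤ) : (a : ℝ) ≠ b - 1 / 2 := by
  intro h
  have h' : (2 * a : ℝ) = 2 * b - 1 := by linarith
  have h'' : 2 * a = 2 * b - 1 := by exact_mod_cast h'
  omega

lemma evenVecToE8_bijective : Function.Bijective evenVecToE8 := by
  constructor
  · rintro (a | a) (b | b) h
    · have h' := congrArg Subtype.val h
      have : a = b := Subtype.ext (funext fun i => by
        have := congrFun h' i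
        simpa [evenVecToE8] using this)
      rw [this]
    · exact absurd (congrFun (congrArg Subtype.val h) 0) (int_ne_half _ _)
    · exact absurd (congrFun (congrArg Subtype.val h) 0).symm (int_ne_half _ _)
    · have h' := congrArg Subtype.val h
      have : a = b := Subtype.ext (funext fun i => by
        have := congrFun h' i
        simpa [evenVecToE8] using this)
      rw [this]
  · rintro ⟨x, h | h, m, hm⟩
    · have h' := h
      choose n hn using h'
      refine ⟨Sum.inl ⟨n, m, ?_⟩, Subtype.ext (funext fun i => (hn i).symm)⟩
      have : ((∑ i, n i : ℤ) : ℝ) = 2 * m := by push_cast; rw [← hm]; simp [hn]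
      have h2 : ∑ i, n i = 2 * m := by exact_mod_cast this
      omega
    · have h' := h
      choose n hn using h'
      refine ⟨Sum.inr ⟨fun i => n i + 1, m + 2, ?_⟩, Subtype.ext (funext fun i => ?_)⟩
      · have : ((∑ i, n i : ℤ) : ℝ) = 2 * m - 4 := by
          push_cast; rw [← hm]; simp [hn, Finset.sum_add_distrib]; norm_num
        have h2 : ∑ i, n i = 2 * m - 4 := by exact_mod_cast this
        rw [Finset.sum_add_distrib, h2]
        simp
        ring
      · change ((n i + 1 : ℤ) : ℝ) - 1 / 2 = x i
        rw [hn i]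
        push_cast
        ring

lemma summable_norm_jacobiTheta₂_term (z : ℂ) {τ : ℂ} (hτ : 0 < τ.im) :
    Summable fun k : ℤ => ‖jacobiTheta₂_term k z τ‖ :=
  ((summable_jacobiTheta₂_term_iff z τ).2 hτ).norm

lemma neg_one_zpow_mul_jacobiTheta₂_term (k : ℤ) (z τ : ℂ) :
    (-1) ^ k * jacobiTheta₂_term k z τ = jacobiTheta₂_term k (z + 1 / 2) τ := by
  rw [← Complex.exp_pi_mul_I, ← Complex.exp_int_mul, jacobiTheta₂_term, jacobiTheta₂_term,
    ← Complex.exp_add]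
  congr 1
  ring

/-- The theta function of the `E8` lattice in terms of Jacobi theta functions. -/
theorem Theta_eq (τ : ℂ) (hτ : 0 < τ.im) (z : Fin 8 → ℂ) :
    2 * Theta τ z = (∏ i, jacobiTheta₂ (z i) τ + ∏ i, jacobiTheta₂ (z i + 1 / 2) τ) +
      exp (2 * Real.pi * I * τ - Real.pi * I * ∑ i, z i) *
        (∏ i, jacobiTheta₂ (z i - τ / 2) τ + ∏ i, jacobiTheta₂ (z i - τ / 2 + 1 / 2) τ) := by
  obtain ⟨h1, h2⟩ := tsum_evenVec (fun i k => jacobiTheta₂_term k (z i) τ)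
    fun i => summable_norm_jacobiTheta₂_term _ hτ
  obtain ⟨h3, h4⟩ := tsum_evenVec (fun i k => jacobiTheta₂_term k (z i - τ / 2) τ)
    fun i => summable_norm_jacobiTheta₂_term _ hτ
  have e1 : ∀ n : EvenVec, exp (πC * I * τ * dotC (cv (evenVecToE8 (Sum.inl n)).1)
      (cv (evenVecToE8 (Sum.inl n)).1) + 2 * πC * I * dotC z (cv (evenVecToE8 (Sum.inl n)).1)) =
      ∏ i, jacobiTheta₂_term (n.1 i) (z i) τ := by
    intro n
    simp only [jacobiTheta₂_term, ← Complex.exp_sum, dotC, cv, evenVecToE8, Sum.elim_inl, πC,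
      Finset.mul_sum, ← Finset.sum_add_distrib]
    congr 1
    refine Finset.sum_congr rfl fun i _ => ?_
    push_cast
    ring
  have e2 : ∀ n : EvenVec, exp (πC * I * τ * dotC (cv (evenVecToE8 (Sum.inr n)).1)
      (cv (evenVecToE8 (Sum.inr n)).1) + 2 * πC * I * dotC z (cv (evenVecToE8 (Sum.inr n)).1)) =
      exp (2 * Real.pi * I * τ - Real.pi * I * ∑ i, z i) *
        ∏ i, jacobiTheta₂_term (n.1 i) (z i - τ / 2) τ := by
    intro n
    have : (2 * Real.pi * I * τ : ℂ) = ∑ i : Fin 8, Real.pi * I * τ / 4 := by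
      simp
      ring
    rw [this]
    simp only [jacobiTheta₂_term, ← Complex.exp_sum, dotC, cv, evenVecToE8, Sum.elim_inr, πC,
      Finset.mul_sum, ← Finset.sum_add_distrib, ← Finset.sum_sub_distrib, ← Complex.exp_add]
    congr 1
    refine Finset.sum_congr rfl fun i _ => ?_
    push_cast
    ring
  rw [Theta, ← (Equiv.ofBijective _ evenVecToE8_bijective).tsum_eq, Summable.tsum_sum]
  · simp only [Equiv.ofBijective_apply, e1, e2]
    rw [tsum_mul_left, h2, h4]
    simp only [neg_one_zpow_mul_jacobiTheta₂_term, jacobiTheta₂]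
    ring
  · refine h1.congr fun n => ?_
    exact (e1 n).symm
  · refine (h3.mul_left (exp (2 * Real.pi * I * τ - Real.pi * I * ∑ i, z i))).congr fun n => ?_
    exact (e2 n).symm

lemma E8Lattice_add {x y : Fin 8 → ℝ} (hx : x ∈ E8Lattice) (hy : y ∈ E8Lattice) :
    x + y ∈ E8Lattice := by
  obtain ⟨h1, m, hm⟩ := hx
  obtain ⟨h2, l, hl⟩ := hy
  refine ⟨?_, m + l, ?_⟩
  · rcases h1 with h1 | h1 <;> rcases h2 with h2 | h2 <;> choose a ha using h1 <;>
      choose b hb using h2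
    · exact Or.inl fun i => ⟨a i + b i, by simp [ha, hb]⟩
    · exact Or.inr fun i => ⟨a i + b i, by simp [ha, hb]; ring⟩
    · exact Or.inr fun i => ⟨a i + b i, by simp [ha, hb]; ring⟩
    · exact Or.inl fun i => ⟨a i + b i + 1, by simp [ha, hb]; ring⟩
  · simp only [Pi.add_apply, Finset.sum_add_distrib, hm, hl]
    push_cast
    ring

lemma E8Lattice_neg {x : Fin 8 → ℝ} (hx : x ∈ E8Lattice) : -x ∈ E8Lattice := by
  obtain ⟨h1, m, hm⟩ := hx
  refine ⟨?_, -m, ?_⟩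
  · rcases h1 with h1 | h1 <;> choose a ha using h1
    · exact Or.inl fun i => ⟨-a i, by simp [ha]⟩
    · exact Or.inr fun i => ⟨-a i - 1, by simp [ha]; ring⟩
  · simp only [Pi.neg_apply, Finset.sum_neg_distrib, hm]
    push_cast
    ring

/-- The `E8` lattice as an additive subgroup. -/
def E8Group : AddSubgroup (Fin 8 → ℝ) where
  carrier := E8Lattice
  add_mem' := E8Lattice_add
  zero_mem' := ⟨Or.inl fun _ => ⟨0, by simp⟩, 0, by simp⟩
  neg_mem' := E8Lattice_neg

lemma E8Lattice_zsmul {x : Fin 8 → ℝ} (hx : x ∈ E8Lattice) (k : ℤ) : k • x ∈ E8Lattice :=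
  E8Group.zsmul_mem hx k

lemma E8Lattice_sub {x y : Fin 8 → ℝ} (hx : x ∈ E8Lattice) (hy : y ∈ E8Lattice) :
    x - y ∈ E8Lattice :=
  E8Group.sub_mem hx hy

lemma E8Lattice_norm_even {x : Fin 8 → ℝ} (hx : x ∈ E8Lattice) :
    ∃ k : ℤ, dotR x x = 2 * k := by
  obtain ⟨h1, m, hm⟩ := hx
  have key : ∀ a : ℤ, ∃ b : ℤ, a * a + a = 2 * b := fun a => by
    obtain ⟨b, hb⟩ := Int.even_mul_succ_self a
    exact ⟨b, by linarith⟩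
  rcases h1 with h1 | h1 <;> choose a ha using h1 <;> choose b hb using fun i => key (a i)
  · refine ⟨∑ i, b i - m, ?_⟩
    have h2 : ∀ i, x i * x i = 2 * b i - x i := fun i => by
      have : ((a i * a i + a i : ℤ) : ℝ) = (2 * b i : ℤ) := by rw [hb]
      push_cast at this
      rw [ha]
      linarith
    simp only [dotR, h2, Finset.sum_sub_distrib, hm, ← Finset.mul_sum]
    push_cast
    ring
  · refine ⟨∑ i, b i + 1, ?_⟩
    have h2 : ∀ i, x i * x i = 2 * b i + 1 / 4 := fun i => by
      have : ((a i * a i + a i : ℤ) : ℝ) = (2 * b i : ℤ) := by rw [hb]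
      push_cast at this
      rw [ha]
      linarith
    simp only [dotR, h2, Finset.sum_add_distrib, ← Finset.mul_sum]
    push_cast
    simp
    ring

lemma E8Lattice_dot_int {x y : Fin 8 → ℝ} (hx : x ∈ E8Lattice) (hy : y ∈ E8Lattice) :
    ∃ k : ℤ, dotR x y = k := by
  obtain ⟨a, ha⟩ := E8Lattice_norm_even hx
  obtain ⟨b, hb⟩ := E8Lattice_norm_even hy
  obtain ⟨c, hc⟩ := E8Lattice_norm_even (E8Lattice_add hx hy)
  refine ⟨c - a - b, ?_⟩
  have : dotR (x + y) (x + y) = dotR x x + dotR y y + 2 * dotR x y := by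
    simp only [dotR, Finset.mul_sum, ← Finset.sum_add_distrib]
    exact Finset.sum_congr rfl fun i _ => by simp; ring
  push_cast
  linarith

lemma dotC_cv (x y : Fin 8 → ℝ) : dotC (cv x) (cv y) = (dotR x y : ℝ) := by
  simp [dotC, cv, dotR]

lemma Theta_neg (τ : ℂ) (z : Fin 8 → ℂ) : Theta τ (-z) = Theta τ z := by
  let e : E8Lattice ≃ E8Lattice :=
    { toFun w := ⟨-w.1, E8Lattice_neg w.2⟩
      invFun w := ⟨-w.1, E8Lattice_neg w.2⟩
      left_inv w := by simp
      right_inv w := by simp }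
  rw [Theta, Theta, ← e.tsum_eq]
  refine tsum_congr fun w => ?_
  simp [e, dotC, cv]

lemma exp_two_pi_int (k : ℤ) : exp (2 * πC * I * k) = 1 := by
  rw [Complex.exp_eq_one_iff]
  exact ⟨k, by rw [πC]; ring⟩

lemma exp_eq_exp_of_int (k : ℤ) {a b : ℂ} (h : a = b + 2 * πC * I * k) : exp a = exp b := by
  rw [h, Complex.exp_add, exp_two_pi_int, mul_one]

lemma Theta_add_period (τ : ℂ) {α β : Fin 8 → ℝ} (hα : α ∈ E8Lattice) (hβ : β ∈ E8Lattice)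
    (z : Fin 8 → ℂ) :
    Theta τ (fun i => z i + τ * α i + β i) =
      exp (-(πC * I * (τ * dotC (cv α) (cv α) + 2 * dotC z (cv α)))) * Theta τ z := by
  let e : E8Lattice ≃ E8Lattice :=
    { toFun w := ⟨w.1 - α, E8Lattice_sub w.2 hα⟩
      invFun w := ⟨w.1 + α, E8Lattice_add w.2 hα⟩
      left_inv w := by simp
      right_inv w := by simp }
  rw [Theta, Theta, ← e.tsum_eq, ← tsum_mul_left]
  refine tsum_congr fun w => ?_
  obtain ⟨k, hk⟩ := E8Lattice_dot_int hβ (E8Lattice_sub w.2 hα)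
  have hk' : dotC (cv β) (cv (w.1 - α)) = k := by rw [dotC_cv, hk]; simp
  rw [← Complex.exp_add]
  refine exp_eq_exp_of_int k ?_
  rw [← hk']
  simp only [e, Equiv.coe_fn_mk, dotC, cv, Pi.sub_apply, Finset.mul_sum, ← Finset.sum_add_distrib,
    ← Finset.sum_neg_distrib]
  refine Finset.sum_congr rfl fun i _ => ?_
  push_cast
  ring

/-- The root `(1,1,-1,-1,-1,-1,-1,-1)/2`. -/
def rootU : Fin 8 → ℝ := ![1/2, 1/2, -1/2, -1/2, -1/2, -1/2, -1/2, -1/2]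

lemma rootU_mem : rootU ∈ E8Lattice := by
  refine ⟨Or.inr fun i => ?_, -1, ?_⟩
  · refine ⟨(![0, 0, -1, -1, -1, -1, -1, -1] : Fin 8 → ℤ) i, ?_⟩
    fin_cases i <;> norm_num [rootU]
  · norm_num [rootU, Fin.sum_univ_succ]

/-- An element of order six of `W(E8)`. -/
def weylG (K : Type*) [Field K] (z : Fin 8 → K) : Fin 8 → K :=
  let c := (z 0 + z 1 - z 2 - z 3 - z 4 - z 5 - z 6 - z 7) / 4
  ![c - z 0, c - z 1, z 7 + c, z 2 + c, z 3 + c, z 4 + c, z 5 + c, z 6 + c]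

/-- The inverse of `weylG`. -/
def weylGInv (K : Type*) [Field K] (z : Fin 8 → K) : Fin 8 → K :=
  let c := (- z 0 - z 1 - z 2 - z 3 - z 4 - z 5 - z 6 - z 7) / 4
  ![-z 0 - c, -z 1 - c, z 3 + c, z 4 + c, z 5 + c, z 6 + c, z 7 + c, z 2 + c]

lemma weylG_mem {x : Fin 8 → ℝ} (hx : x ∈ E8Lattice) : weylG ℝ x ∈ E8Lattice := by
  obtain ⟨k, hk⟩ := E8Lattice_dot_int hx rootU_mem
  have hy := E8Lattice_sub hx (E8Lattice_zsmul rootU_mem k)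
  have hyd : ∀ i, (x - k • rootU) i = x i - k * rootU i := fun i => by
    simp only [Pi.sub_apply, zsmul_eq_mul]
    rfl
  generalize x - k • rootU = y at hy hyd
  have hxy : weylG ℝ x = ![-y 0, -y 1, y 7, y 2, y 3, y 4, y 5, y 6] := by
    ext i
    simp only [dotR, rootU, Fin.sum_univ_succ] at hk
    simp at hk
    fin_cases i <;> simp [weylG, hyd, rootU, ← hk] <;> ring
  rw [hxy]
  obtain ⟨h1, m, hm⟩ := hy
  rcases h1 with h1 | h1 <;> choose a ha using h1
  · refine ⟨Or.inl fun i => ⟨(![-a 0, -a 1, a 7, a 2, a 3, a 4, a 5, a 6] : Fin 8 → ℤ) i, ?_⟩,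
      m - a 0 - a 1, ?_⟩
    · fin_cases i <;> simp [ha]
    · simp only [Fin.sum_univ_succ] at hm ⊢
      simp [ha] at hm ⊢
      linarith
  · refine ⟨Or.inr fun i => ⟨(![-a 0 - 1, -a 1 - 1, a 7, a 2, a 3, a 4, a 5, a 6] : Fin 8 → ℤ) i,
      ?_⟩, m - a 0 - a 1 - 1, ?_⟩
    · fin_cases i <;> simp [ha] <;> ring
    · simp only [Fin.sum_univ_succ] at hm ⊢
      simp [ha] at hm ⊢
      linarith

lemma weylG_weylGInv {K : Type*} [Field K] [CharZero K] (x : Fin 8 → K) :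
    weylG K (weylGInv K x) = x := by
  ext i
  fin_cases i <;> simp [weylG, weylGInv] <;> ring

lemma weylGInv_weylG (x : Fin 8 → ℝ) : weylGInv ℝ (weylG ℝ x) = x := by
  ext i
  fin_cases i <;> simp [weylG, weylGInv] <;> ring

lemma weylGInv_mem {x : Fin 8 → ℝ} (hx : x ∈ E8Lattice) : weylGInv ℝ x ∈ E8Lattice := by
  obtain ⟨y, hy, hxy⟩ : ∃ y ∈ E8Lattice, y = ![-x 0, -x 1, x 3, x 4, x 5, x 6, x 7, x 2] := by
    refine ⟨_, ?_, rfl⟩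
    obtain ⟨h1, m, hm⟩ := hx
    rcases h1 with h1 | h1 <;> choose a ha using h1
    · refine ⟨Or.inl fun i => ⟨(![-a 0, -a 1, a 3, a 4, a 5, a 6, a 7, a 2] : Fin 8 → ℤ) i, ?_⟩,
        m - a 0 - a 1, ?_⟩
      · fin_cases i <;> simp [ha]
      · simp only [Fin.sum_univ_succ] at hm ⊢
        simp [ha] at hm ⊢
        linarith
    · refine ⟨Or.inr fun i => ⟨(![-a 0 - 1, -a 1 - 1, a 3, a 4, a 5, a 6, a 7, a 2] : Fin 8 → ℤ) i,
        ?_⟩, m - a 0 - a 1 - 1, ?_⟩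
      · fin_cases i <;> simp [ha] <;> ring
      · simp only [Fin.sum_univ_succ] at hm ⊢
        simp [ha] at hm ⊢
        linarith
  obtain ⟨k, hk⟩ := E8Lattice_dot_int hy rootU_mem
  have h := E8Lattice_sub hy (E8Lattice_zsmul rootU_mem k)
  have hyd : ∀ i, (y - k • rootU) i = y i - k * rootU i := fun i => by
    simp only [Pi.sub_apply, zsmul_eq_mul]
    rfl
  have : weylGInv ℝ x = y - k • rootU := by
    ext i
    rw [hyd]
    simp only [dotR, rootU, hxy, Fin.sum_univ_succ] at hk
    simp at hk
    fin_cases i <;> simp [weylGInv, rootU, hxy, ← hk] <;> ring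
  rwa [this]

lemma Theta_weylG (τ : ℂ) (z : Fin 8 → ℂ) : Theta τ (weylG ℂ z) = Theta τ z := by
  let e : E8Lattice ≃ E8Lattice :=
    { toFun w := ⟨weylG ℝ w.1, weylG_mem w.2⟩
      invFun w := ⟨weylGInv ℝ w.1, weylGInv_mem w.2⟩
      left_inv w := Subtype.ext (weylGInv_weylG _)
      right_inv w := Subtype.ext (weylG_weylGInv _) }
  rw [Theta, Theta, ← e.tsum_eq]
  refine tsum_congr fun w => ?_
  have h1 : cv (weylG ℝ w.1) = weylG ℂ (cv w.1) := by
    ext i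
    fin_cases i <;> simp [weylG, cv]
  have h2 : ∀ a b : Fin 8 → ℂ, dotC (weylG ℂ a) (weylG ℂ b) = dotC a b := by
    intro a b
    simp only [dotC, weylG, Fin.sum_univ_succ]
    simp
    ring
  simp only [e, Equiv.coe_fn_mk, h1, h2]

lemma contDiff_Theta (τ : ℂ) (hτ : 0 < τ.im) : ContDiff ℂ 1 (Theta τ) := by
  have h : ContDiff ℂ 1 fun x => jacobiTheta₂ x τ :=
    Differentiable.contDiff fun x => differentiableAt_jacobiTheta₂_fst x hτ
  have : Theta τ = fun z => ((∏ i, jacobiTheta₂ (z i) τ + ∏ i, jacobiTheta₂ (z i + 1 / 2) τ) +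
      exp (2 * Real.pi * I * τ - Real.pi * I * ∑ i, z i) *
        (∏ i, jacobiTheta₂ (z i - τ / 2) τ + ∏ i, jacobiTheta₂ (z i - τ / 2 + 1 / 2) τ)) / 2 := by
    ext z
    rw [← Theta_eq τ hτ z]
    ring
  rw [this]
  have hc : ∀ c : ℂ, ContDiff ℂ 1 fun z : Fin 8 → ℂ => ∏ i, jacobiTheta₂ (z i + c) τ :=
    fun c => contDiff_prod fun i _ => h.comp ((contDiff_apply ℂ ℂ i).add contDiff_const)
  have e0 := hc 0
  have e1 := hc (-(τ / 2))
  have e2 := hc (-(τ / 2) + 1 / 2)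
  simp only [add_zero, ← sub_eq_add_neg, ← add_assoc] at e0 e1 e2
  refine ContDiff.div_const (((e0.add (hc _))).add (ContDiff.mul ?_ (e1.add e2))) _
  fun_prop

/-- The invariance, quasi-periodicity and regularity in `z` shared by all forms of index `m`. -/
structure IsJac (m : ℕ) (τ : ℂ) (f : (Fin 8 → ℂ) → ℂ) : Prop where
  inv : ∀ z, f (weylG ℂ z) = f z
  quasi : ∀ α ∈ E8Lattice, ∀ β ∈ E8Lattice, ∀ z, f (fun i => z i + τ * α i + β i) =
    exp (-(m * (πC * I * (τ * dotC (cv α) (cv α) + 2 * dotC z (cv α))))) * f z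
  smooth : ContDiff ℂ 1 f

lemma IsJac.add {m : ℕ} {τ : ℂ} {f g : (Fin 8 → ℂ) → ℂ} (hf : IsJac m τ f) (hg : IsJac m τ g) :
    IsJac m τ fun z => f z + g z :=
  ⟨fun z => by rw [hf.inv, hg.inv],
    fun α hα β hβ z => by rw [hf.quasi α hα β hβ, hg.quasi α hα β hβ]; ring,
    hf.smooth.add hg.smooth⟩

lemma IsJac.const_mul {m : ℕ} {τ : ℂ} {f : (Fin 8 → ℂ) → ℂ} (hf : IsJac m τ f) (c : ℂ) :
    IsJac m τ fun z => c * f z :=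
  ⟨fun z => by rw [hf.inv], fun α hα β hβ z => by rw [hf.quasi α hα β hβ]; ring,
    contDiff_const.mul hf.smooth⟩

lemma IsJac.sum {ι : Type*} {m : ℕ} {τ : ℂ} {s : Finset ι} {f : ι → (Fin 8 → ℂ) → ℂ}
    (hf : ∀ k ∈ s, IsJac m τ (f k)) : IsJac m τ fun z => ∑ k ∈ s, f k z :=
  ⟨fun z => Finset.sum_congr rfl fun k hk => (hf k hk).inv z,
    fun α hα β hβ z => by
      rw [Finset.mul_sum]
      exact Finset.sum_congr rfl fun k hk => (hf k hk).quasi α hα β hβ z,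
    ContDiff.sum fun k hk => (hf k hk).smooth⟩

lemma isJac_Theta {m c j : ℕ} {K : ℤ} {τ τ' : ℂ} (hτ' : 0 < τ'.im) (hm : m = j * c)
    (h : j * τ' = c * τ + K) : IsJac m τ fun z => Theta τ' fun i => c * z i := by
  refine ⟨fun z => ?_, fun α hα β hβ z => ?_, ?_⟩
  · rw [← Theta_weylG τ' fun i => c * z i]
    congr 1
    ext i
    fin_cases i <;> simp [weylG] <;> ring
  · obtain ⟨k, hk⟩ := E8Lattice_norm_even hα
    have hk' : dotC (cv α) (cv α) = 2 * k := by rw [dotC_cv, hk]; simp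
    have := Theta_add_period τ' (E8Lattice_zsmul hα j)
      (E8Lattice_sub (E8Lattice_zsmul hβ c) (E8Lattice_zsmul hα K)) fun i => c * z i
    have e1 : (fun i => (c : ℂ) * (z i + τ * α i + β i)) = fun i => c * z i +
        τ' * ((((j : ℤ) • α) i : ℝ) : ℂ) + ((((c : ℤ) • β - K • α) i : ℝ) : ℂ) := by
      ext i
      simp
      linear_combination (-(α i : ℂ)) * h
    rw [e1, this]
    congr 1
    refine exp_eq_exp_of_int (-(j * K * k)) ?_
    have e2 : dotC (cv ((j : ℤ) • α)) (cv ((j : ℤ) • α)) = j ^ 2 * dotC (cv α) (cv α) := by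
      simp only [dotC, cv, Finset.mul_sum]
      exact Finset.sum_congr rfl fun i _ => by simp; ring
    have e3 : dotC (fun i => c * z i) (cv ((j : ℤ) • α)) = j * c * dotC z (cv α) := by
      simp only [dotC, cv, Finset.mul_sum]
      exact Finset.sum_congr rfl fun i _ => by simp; ring
    rw [e2, e3, hk', hm]
    push_cast
    linear_combination (-2 * πC * I * k * j) * h
  · exact (contDiff_Theta τ' hτ').comp (by fun_prop)

open MvPolynomial in
/-- A polynomial relation between quasi-periodic functions is weighted homogeneous in the index. -/
lemma eval_scaled_eq_zero {T : ℝ} (hT : 0 < T) {m : Fin 9 → ℕ}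
    {F : Fin 9 → (Fin 8 → ℂ) → ℂ} (hF : ∀ i, IsJac (m i) (I * T) (F i))
    {Q : MvPolynomial (Fin 9) ℂ} (hQ : ∀ z, eval (fun i => F i z) Q = 0) (l : ℂ)
    (z : Fin 8 → ℂ) : eval (fun i => l ^ m i * F i z) Q = 0 := by
  set R : Polynomial ℂ :=
    aeval (fun i => Polynomial.C (F i z) * Polynomial.X ^ m i) Q with hR
  have hRe : ∀ l : ℂ, R.eval l = eval (fun i => l ^ m i * F i z) Q := fun l => by
    rw [hR, ← Polynomial.coe_aeval_eq_eval, ← coe_aeval_eq_eval, RingHom.coe_coe,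
      ← AlgHom.comp_apply, comp_aeval]
    congr 2
    ext i
    simp only [map_mul, map_pow, Polynomial.aeval_X, Polynomial.aeval_C, Algebra.algebraMap_self,
      RingHom.id_apply, mul_comm]
  rw [← hRe]
  let α : Fin 8 → ℝ := ![1, 1, 0, 0, 0, 0, 0, 0]
  have hα : α ∈ E8Lattice := by
    refine ⟨Or.inl fun i => ⟨(![1, 1, 0, 0, 0, 0, 0, 0] : Fin 8 → ℤ) i, ?_⟩, 1, ?_⟩
    · fin_cases i <;> simp [α]
    · norm_num [α, Fin.sum_univ_succ]
  let χ : ℕ → ℂ := fun n => exp (-(πC * I * (I * T * (2 * n ^ 2) + 2 * (n * (z 0 + z 1)))))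
  have hχ : ∀ n, R.eval (χ n) = 0 := fun n => by
    rw [hRe, ← hQ fun i => z i + I * T * (((n : ℤ) • α) i : ℝ) + ((0 : Fin 8 → ℝ) i : ℝ)]
    congr 2
    ext i
    rw [(hF i).quasi _ (E8Lattice_zsmul hα n) 0 E8Group.zero_mem, ← Complex.exp_nat_mul]
    congr 2
    simp only [dotC, cv, α, Fin.sum_univ_succ]
    simp
    ring_nf
    simp
  have hlim : Filter.Tendsto (fun n => ‖χ n‖) Filter.atTop Filter.atTop := by
    have : ∀ n : ℕ, ‖χ n‖ =
        Real.exp (n * (2 * Real.pi * T * n + 2 * Real.pi * (z 0 + z 1).im)) := fun n => by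
      rw [Complex.norm_exp]
      congr 1
      simp [πC, ← Complex.ofReal_natCast, ← Complex.ofReal_pow]
      ring
    simp only [this]
    refine Real.tendsto_exp_atTop.comp (tendsto_natCast_atTop_atTop.atTop_mul_atTop₀ ?_)
    exact Filter.tendsto_atTop_add_const_right _ _
      (tendsto_natCast_atTop_atTop.const_mul_atTop (by positivity))
  by_cases hd : 0 < R.degree
  · have := Polynomial.tendsto_norm_atTop R hd hlim
    simp only [hχ, norm_zero] at this
    exact absurd this (Filter.not_tendsto_const_atTop _ _)
  · rw [Polynomial.eq_C_of_degree_le_zero (not_lt.1 hd)] at hχ ⊢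
    simpa using hχ 0

/-- The `τ`-part of the special point. -/
def pV : Fin 8 → ℝ := ![1, 0, 1/6, 1/6, 1/6, 1/6, 1/6, 1/6]

/-- The real part of the special point. -/
def rV : Fin 8 → ℝ := ![7/12, 1/12, -5/12, -1/4, -1/12, 1/12, 1/4, 5/12]

/-- A point fixed by `weylG` modulo the lattice `τ Λ₈ + Λ₈`. -/
def zPt (τ : ℂ) : Fin 8 → ℂ := fun i => τ * pV i + rV i

/-- The primitive sixth root of unity by which `weylG` acts at the special point. -/
def om6 : ℂ := exp (2 * Real.pi * I / 6)

lemma isPrimitiveRoot_om6 : IsPrimitiveRoot om6 6 := by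
  simpa [om6] using Complex.isPrimitiveRoot_exp 6 (by norm_num)

lemma weylG_zPt_add (τ : ℂ) (h : Fin 8 → ℂ) : weylG ℂ (zPt τ + h) = fun i =>
    (zPt τ + weylG ℂ h) i + τ * ((![-2, 0, 0, 0, 0, 0, 0, 0] : Fin 8 → ℝ) i : ℝ) +
      ((![-1, 0, 1, 0, 0, 0, 0, 0] : Fin 8 → ℝ) i : ℝ) := by
  ext i
  fin_cases i <;> simp [weylG, zPt, pV, rV] <;> ring

lemma IsJac.zPt_add {m : ℕ} {τ : ℂ} {f : (Fin 8 → ℂ) → ℂ} (hf : IsJac m τ f) (h : Fin 8 → ℂ) :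
    f (zPt τ + h) = om6 ^ m * exp (4 * Real.pi * I * m * weylG ℂ h 0) *
      f (zPt τ + weylG ℂ h) := by
  have hα : (![-2, 0, 0, 0, 0, 0, 0, 0] : Fin 8 → ℝ) ∈ E8Lattice := by
    refine ⟨Or.inl fun i => ⟨(![-2, 0, 0, 0, 0, 0, 0, 0] : Fin 8 → ℤ) i, ?_⟩, -1, ?_⟩
    · fin_cases i <;> simp
    · norm_num [Fin.sum_univ_succ]
  have hβ : (![-1, 0, 1, 0, 0, 0, 0, 0] : Fin 8 → ℝ) ∈ E8Lattice := by
    refine ⟨Or.inl fun i => ⟨(![-1, 0, 1, 0, 0, 0, 0, 0] : Fin 8 → ℤ) i, ?_⟩, 0, ?_⟩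
    · fin_cases i <;> simp
    · norm_num [Fin.sum_univ_succ]
  rw [← hf.inv, weylG_zPt_add, hf.quasi _ hα _ hβ, om6, ← Complex.exp_nat_mul, ← Complex.exp_add]
  congr 1
  refine exp_eq_exp_of_int m ?_
  simp only [dotC, cv, Fin.sum_univ_succ]
  simp [zPt, pV, rV, πC]
  ring

lemma IsJac.zPt_eq_zero {m : ℕ} {τ : ℂ} {f : (Fin 8 → ℂ) → ℂ} (hf : IsJac m τ f)
    (hm : ¬ 6 ∣ m) : f (zPt τ) = 0 := by
  have h := hf.zPt_add 0
  have h0 : weylG ℂ 0 = 0 := by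
    ext i
    fin_cases i <;> simp [weylG]
  rw [h0] at h
  simp only [add_zero, Pi.zero_apply, mul_zero, Complex.exp_zero, mul_one] at h
  by_contra hne
  exact hm (isPrimitiveRoot_om6.dvd_of_pow_eq_one _ (mul_right_cancel₀ hne (by rw [← h, one_mul])))

lemma IsJac.fderiv_weylG {m : ℕ} {τ : ℂ} {f : (Fin 8 → ℂ) → ℂ} (hf : IsJac m τ f)
    (hm : ¬ 6 ∣ m) (h : Fin 8 → ℂ) :
    fderiv ℂ f (zPt τ) h = om6 ^ m * fderiv ℂ f (zPt τ) (weylG ℂ h) := by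
  have hd : HasFDerivAt f (fderiv ℂ f (zPt τ)) (zPt τ) :=
    ((hf.smooth.differentiable (by norm_num)) _).hasFDerivAt
  have line : ∀ v : Fin 8 → ℂ,
      HasDerivAt (fun t : ℂ => f (zPt τ + t • v)) (fderiv ℂ f (zPt τ) v) 0 := fun v => by
    have h1 : HasDerivAt (fun t : ℂ => zPt τ + t • v) v 0 := by
      simpa using ((hasDerivAt_id (0 : ℂ)).smul_const v).const_add (zPt τ)
    exact HasFDerivAt.comp_hasDerivAt (f := fun t : ℂ => zPt τ + t • v) 0
      (by simpa using hd) h1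
  have hs : ∀ t : ℂ, weylG ℂ (t • h) = t • weylG ℂ h := fun t => by
    ext i
    fin_cases i <;> simp [weylG] <;> ring
  have h1 := line h
  have h2 : HasDerivAt (fun t : ℂ => exp (4 * Real.pi * I * m * (t * weylG ℂ h 0)))
      (exp (4 * Real.pi * I * m * (0 * weylG ℂ h 0)) *
        (4 * Real.pi * I * m * (1 * weylG ℂ h 0))) 0 :=
    ((((hasDerivAt_id (0 : ℂ)).mul_const _).const_mul _)).cexp
  have h3 := ((h2.const_mul (om6 ^ m)).mul (line (weylG ℂ h)))
  have he : (fun t : ℂ => f (zPt τ + t • h)) = (fun t : ℂ => om6 ^ m *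
      exp (4 * Real.pi * I * m * (t * weylG ℂ h 0))) * fun t => f (zPt τ + t • weylG ℂ h) := by
    ext t
    rw [hf.zPt_add, hs]
    rfl
  rw [he] at h1
  rw [h1.unique h3]
  simp [hf.zPt_eq_zero hm]

/-- The indices of the nine forms. -/
def nineIdx : Fin 9 → ℕ := ![1, 2, 3, 4, 5, 2, 3, 4, 6]

/-- Nondegeneracy of the nine forms at the special point. -/
structure Nondegenerate (τ : ℂ) (F : Fin 9 → (Fin 8 → ℂ) → ℂ) : Prop where
  idx1 : ∃ u, fderiv ℂ (F 0) (zPt τ) u ≠ 0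
  idx2 : ∃ u v, fderiv ℂ (F 1) (zPt τ) u * fderiv ℂ (F 5) (zPt τ) v ≠
    fderiv ℂ (F 1) (zPt τ) v * fderiv ℂ (F 5) (zPt τ) u
  idx3 : ∃ u v, fderiv ℂ (F 2) (zPt τ) u * fderiv ℂ (F 6) (zPt τ) v ≠
    fderiv ℂ (F 2) (zPt τ) v * fderiv ℂ (F 6) (zPt τ) u
  idx4 : ∃ u v, fderiv ℂ (F 3) (zPt τ) u * fderiv ℂ (F 7) (zPt τ) v ≠
    fderiv ℂ (F 3) (zPt τ) v * fderiv ℂ (F 7) (zPt τ) u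
  idx5 : ∃ u, fderiv ℂ (F 4) (zPt τ) u ≠ 0
  idx6 : F 8 (zPt τ) ≠ 0

lemma eq_zero_of_two_by_two {a b x y x' y' : ℂ} (h : a * x + b * y = 0) (h' : a * x' + b * y' = 0)
    (hd : x * y' ≠ x' * y) : a = 0 ∧ b = 0 := by
  have hd' := sub_ne_zero.2 hd
  exact ⟨mul_right_cancel₀ hd' (by linear_combination y' * h - y * h'),
    mul_right_cancel₀ hd' (by linear_combination x * h' - x' * h)⟩

lemma annihilator_eq_zero {τ : ℂ} {F : Fin 9 → (Fin 8 → ℂ) → ℂ}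
    (hF : ∀ i, IsJac (nineIdx i) τ (F i)) (hn : Nondegenerate τ F) {c : Fin 9 → ℂ}
    (hs : ∑ i, c i * (nineIdx i * F i (zPt τ)) = 0)
    (hc : ∀ h, ∑ i, c i * fderiv ℂ (F i) (zPt τ) h = 0) : c = 0 := by
  have h6 : ∀ i : Fin 9, i ≠ 8 → ¬ 6 ∣ nineIdx i := by decide
  have hz : ∀ i : Fin 9, i ≠ 8 → F i (zPt τ) = 0 := fun i hi => (hF i).zPt_eq_zero (h6 i hi)
  have hc8 : c 8 = 0 := by
    rw [Finset.sum_eq_single 8 (fun i _ hi => by rw [hz i hi]; simp) (by simp)] at hs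
    simpa [nineIdx, hn.idx6] using hs
  have hinv : ∀ i : Fin 9, i ≠ 8 → ∀ (n : ℕ) h, fderiv ℂ (F i) (zPt τ) ((weylGInv ℂ)^[n] h) =
      (om6 ^ nineIdx i) ^ n * fderiv ℂ (F i) (zPt τ) h := fun i hi n => by
    induction n with
    | zero => simp
    | succ n ih =>
      intro h
      rw [Function.iterate_succ_apply, ih, (hF i).fderiv_weylG (h6 i hi) (weylGInv ℂ h),
        weylG_weylGInv]
      ring
  have hgroup : ∀ h, (fun k : Fin 5 => ![c 0 * fderiv ℂ (F 0) (zPt τ) h,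
      c 1 * fderiv ℂ (F 1) (zPt τ) h + c 5 * fderiv ℂ (F 5) (zPt τ) h,
      c 2 * fderiv ℂ (F 2) (zPt τ) h + c 6 * fderiv ℂ (F 6) (zPt τ) h,
      c 3 * fderiv ℂ (F 3) (zPt τ) h + c 7 * fderiv ℂ (F 7) (zPt τ) h,
      c 4 * fderiv ℂ (F 4) (zPt τ) h] k) = 0 := fun h => by
    refine Matrix.eq_zero_of_forall_pow_sum_mul_pow_eq_zero
      (f := fun k : Fin 5 => om6 ^ ((k : ℕ) + 1)) (fun a b hab => ?_) fun n => ?_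
    · have := isPrimitiveRoot_om6.pow_inj (by omega) (by omega) hab
      exact Fin.ext (by omega)
    · have := hc ((weylGInv ℂ)^[n] h)
      simp only [Fin.sum_univ_succ] at this ⊢
      simp [hc8] at this ⊢
      rw [← this, hinv 0 (by decide), hinv 1 (by decide), hinv 2 (by decide), hinv 3 (by decide),
        hinv 4 (by decide), hinv 5 (by decide), hinv 6 (by decide), hinv 7 (by decide)]
      simp [nineIdx]
      ring
  have g0 : ∀ h, c 0 * fderiv ℂ (F 0) (zPt τ) h = 0 := fun h => congrFun (hgroup h) 0
  have g1 : ∀ h, c 1 * fderiv ℂ (F 1) (zPt τ) h + c 5 * fderiv ℂ (F 5) (zPt τ) h = 0 :=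
    fun h => congrFun (hgroup h) 1
  have g2 : ∀ h, c 2 * fderiv ℂ (F 2) (zPt τ) h + c 6 * fderiv ℂ (F 6) (zPt τ) h = 0 :=
    fun h => congrFun (hgroup h) 2
  have g3 : ∀ h, c 3 * fderiv ℂ (F 3) (zPt τ) h + c 7 * fderiv ℂ (F 7) (zPt τ) h = 0 :=
    fun h => congrFun (hgroup h) 3
  have g4 : ∀ h, c 4 * fderiv ℂ (F 4) (zPt τ) h = 0 := fun h => congrFun (hgroup h) 4
  obtain ⟨u₁, h₁⟩ := hn.idx1
  obtain ⟨u₂, v₂, h₂⟩ := hn.idx2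
  obtain ⟨u₃, v₃, h₃⟩ := hn.idx3
  obtain ⟨u₄, v₄, h₄⟩ := hn.idx4
  obtain ⟨u₅, h₅⟩ := hn.idx5
  have e0 := (mul_eq_zero.1 (g0 u₁)).resolve_right h₁
  have e4 := (mul_eq_zero.1 (g4 u₅)).resolve_right h₅
  have e1 := eq_zero_of_two_by_two (g1 u₂) (g1 v₂) h₂
  have e2 := eq_zero_of_two_by_two (g2 u₃) (g2 v₃) h₃
  have e3 := eq_zero_of_two_by_two (g3 u₄) (g3 v₄) h₄
  ext i
  fin_cases i
  exacts [e0, e1.1, e2.1, e3.1, e4, e1.2, e2.2, e3.2, hc8]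

open MvPolynomial in
lemma eq_zero_of_nondegenerate {T : ℝ} (hT : 0 < T) {F : Fin 9 → (Fin 8 → ℂ) → ℂ}
    (hF : ∀ i, IsJac (nineIdx i) (I * T) (F i)) (hn : Nondegenerate (I * T) F)
    {Q : MvPolynomial (Fin 9) ℂ} (hQ : ∀ z, eval (fun i => F i z) Q = 0) : Q = 0 := by
  let G : ℂ × (Fin 8 → ℂ) → Fin 9 → ℂ := fun x i => x.1 ^ nineIdx i * F i x.2
  set z₀ := zPt (I * T) with hz₀
  let G' : ℂ × (Fin 8 → ℂ) →L[ℂ] (Fin 9 → ℂ) := ContinuousLinearMap.pi fun i =>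
    (nineIdx i * F i z₀) • ContinuousLinearMap.fst ℂ ℂ (Fin 8 → ℂ) +
      (fderiv ℂ (F i) z₀).comp (ContinuousLinearMap.snd ℂ ℂ (Fin 8 → ℂ))
  have hG : HasStrictFDerivAt G G' (1, z₀) := by
    refine hasStrictFDerivAt_pi.2 fun i => ?_
    have h1 : HasStrictFDerivAt (fun x : ℂ × (Fin 8 → ℂ) => x.1 ^ nineIdx i)
        ((nineIdx i * (1 : ℂ) ^ (nineIdx i - 1)) • ContinuousLinearMap.fst ℂ ℂ (Fin 8 → ℂ))
        (1, z₀) :=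
      (hasStrictDerivAt_pow (nineIdx i) (1 : ℂ)).comp_hasStrictFDerivAt (1, z₀)
        hasStrictFDerivAt_fst
    have h2 : HasStrictFDerivAt (fun x : ℂ × (Fin 8 → ℂ) => F i x.2)
        ((fderiv ℂ (F i) z₀).comp (ContinuousLinearMap.snd ℂ ℂ (Fin 8 → ℂ))) (1, z₀) :=
      HasStrictFDerivAt.comp (1, z₀)
        ((hF i).smooth.contDiffAt.hasStrictFDerivAt one_ne_zero) hasStrictFDerivAt_snd
    refine (h1.mul h2).congr_fderiv ?_
    ext x <;> simp
    ring
  have hsurj : (G' : ℂ × (Fin 8 → ℂ) →ₗ[ℂ] (Fin 9 → ℂ)).range = ⊤ := by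
    by_contra hne
    obtain ⟨φ, hφ0, hφ⟩ := Submodule.exists_le_ker_of_lt_top _ (lt_top_iff_ne_top.2 hne)
    have hv : ∀ x, ∑ i, φ (Pi.single i 1) * G' x i = 0 := fun x => by
      have h1 : φ (G' x) = 0 := hφ ⟨x, rfl⟩
      rw [← h1, LinearMap.pi_apply_eq_sum_univ φ (G' x)]
      refine Finset.sum_congr rfl fun i _ => ?_
      rw [smul_eq_mul, mul_comm]
      congr 2
      ext j
      simp [Pi.single_apply, eq_comm]
    have hc := annihilator_eq_zero hF hn (c := fun i => φ (Pi.single i 1))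
      (by simpa [G'] using hv (1, 0)) fun h => by simpa [G'] using hv (0, h)
    refine hφ0 (LinearMap.pi_ext' fun i => LinearMap.ext_ring ?_)
    simpa using congrFun hc i
  have hmap := hG.map_nhds_eq_of_surj hsurj
  have hrange : Set.range G ∈ nhds (G (1, z₀)) := by
    rw [← hmap]
    exact Filter.mem_map.2 (Filter.univ_mem' fun x => ⟨x, rfl⟩)
  obtain ⟨ε, hε, hball⟩ := Metric.mem_nhds_iff.1 hrange
  refine MvPolynomial.funext_set (fun i => Metric.ball (G (1, z₀) i) ε)
    (fun i => infinite_of_mem_nhds _ (Metric.ball_mem_nhds _ hε)) fun x hx => ?_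
  rw [← ball_pi _ hε] at hx
  obtain ⟨⟨l, z⟩, rfl⟩ := hball hx
  rw [map_zero]
  exact eval_scaled_eq_zero hT hF hQ l z

section NineForms
variable {τ : ℂ}

lemma isJac_Theta_mul {m : ℕ} (c j : ℕ) (K : ℤ) {C τ' : ℂ} (hC : C = c) (hτ : 0 < τ.im)
    (hc : 0 < c) (hm : m = j * c) (h : j * τ' = c * τ + K) :
    IsJac m τ fun z => Theta τ' fun i => C * z i := by
  have him : (j : ℝ) * τ'.im = c * τ.im := by simpa using congrArg Complex.im h
  have hτ' : 0 < τ'.im := by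
    have : 0 < (j : ℝ) * τ'.im := him ▸ mul_pos (Nat.cast_pos.2 hc) hτ
    exact pos_of_mul_pos_right this (Nat.cast_nonneg _)
  rw [hC]
  exact isJac_Theta hτ' hm h

lemma isJac_Theta_one (m : ℕ) (K : ℤ) {τ' : ℂ} (hτ : 0 < τ.im)
    (h : m * τ' = τ + K) : IsJac m τ (Theta τ') := by
  simpa using isJac_Theta_mul (C := 1) 1 m K (by simp) hτ one_pos (by simp) (by simpa using h)

lemma isJac_A1 (hτ : 0 < τ.im) : IsJac 1 τ (A1 τ) :=
  isJac_Theta_one 1 0 hτ (by simp)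

lemma IsJac.sub {m : ℕ} {f g : (Fin 8 → ℂ) → ℂ} (hf : IsJac m τ f) (hg : IsJac m τ g) :
    IsJac m τ fun z => f z - g z := by
  simpa [sub_eq_add_neg] using hf.add (hg.const_mul (-1))

lemma isJac_AM {m : ℕ} (hm : 0 < m) (hτ : 0 < τ.im) : IsJac m τ (AM m τ) := by
  change IsJac m τ fun z => AM m τ z
  unfold AM
  refine .const_mul (.add ?_ (.const_mul (.sum fun k _ => ?_) _)) _
  · exact isJac_Theta_mul m 1 0 rfl hτ hm (by simp) (by simp)
  · exact isJac_Theta_one m k hτ (by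
      rw [mul_div_cancel₀ _ (Nat.cast_ne_zero.2 hm.ne')]; simp)

lemma isJac_A4 (hτ : 0 < τ.im) : IsJac 4 τ (A4 τ) :=
  isJac_Theta_mul 2 2 0 (by simp) hτ two_pos rfl (by simp)

lemma isJac_B2 (hτ : 0 < τ.im) : IsJac 2 τ (B2 τ) := by
  change IsJac 2 τ fun z => B2 τ z
  unfold B2
  refine .const_mul (.add (.add (.const_mul ?_ _) (.const_mul ?_ _)) (.const_mul ?_ _)) _
  · exact isJac_Theta_mul 2 1 0 (by simp) hτ two_pos rfl (by simp)
  · exact isJac_Theta_one 2 0 hτ (by simp; ring)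
  · exact isJac_Theta_one 2 1 hτ (by simp; ring)

lemma isJac_B3 (hτ : 0 < τ.im) : IsJac 3 τ (B3 τ) := by
  change IsJac 3 τ fun z => B3 τ z
  unfold B3
  refine .const_mul (.sub (.const_mul ?_ _) (.const_mul (.sum fun k _ => .const_mul ?_ _) _)) _
  · exact isJac_Theta_mul 3 1 0 (by simp) hτ three_pos rfl (by simp)
  · exact isJac_Theta_one 3 k hτ (by simp; ring)

lemma isJac_B4 (hτ : 0 < τ.im) : IsJac 4 τ (B4 τ) := by
  change IsJac 4 τ fun z => B4 τ z
  unfold B4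
  refine .const_mul (.sub (.sub (.const_mul ?_ _) (.const_mul ?_ _))
    (.const_mul (.sum fun k _ => .const_mul ?_ _) _)) _
  · exact isJac_Theta_mul 4 1 0 (by simp) hτ four_pos rfl (by simp)
  · exact isJac_Theta_mul 2 2 1 (by simp) hτ two_pos rfl (by simp; ring)
  · exact isJac_Theta_one 4 k hτ (by simp; ring)

lemma isJac_B6 (hτ : 0 < τ.im) : IsJac 6 τ (B6 τ) := by
  change IsJac 6 τ fun z => B6 τ z
  unfold B6
  refine .const_mul (.sub (.sub (.add (.const_mul ?_ _)
    (.const_mul (.sum fun k _ => .const_mul ?_ _) _))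
    (.const_mul (.sum fun k _ => .const_mul ?_ _) _))
    (.const_mul (.sum fun k _ => .const_mul ?_ _) _)) _
  · exact isJac_Theta_mul 6 1 0 (by simp) hτ (by norm_num) rfl (by simp)
  · exact isJac_Theta_mul 3 2 (3 * k) (by simp) hτ three_pos rfl (by simp; ring)
  · exact isJac_Theta_mul 2 3 (2 * k) (by simp) hτ two_pos rfl (by simp; ring)
  · exact isJac_Theta_one 6 k hτ (by simp; ring)

lemma isJac_nineForms (hτ : 0 < τ.im) (i : Fin 9) : IsJac (nineIdx i) τ (nineForms i τ) := by
  fin_cases i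
  exacts [isJac_A1 hτ, isJac_AM two_pos hτ, isJac_AM three_pos hτ, isJac_A4 hτ,
    isJac_AM (m := 5) (by norm_num) hτ, isJac_B2 hτ, isJac_B3 hτ, isJac_B4 hτ, isJac_B6 hτ]

end NineForms

section Asymptotic

open Asymptotics Topology

/-- A primitive twelfth root of unity. -/
def z12 : ℂ := exp (2 * Real.pi * I / 12)

lemma z12_ne_zero : z12 ≠ 0 := Complex.exp_ne_zero _

lemma isPrimitiveRoot_z12 : IsPrimitiveRoot z12 12 := by
  simpa [z12] using Complex.isPrimitiveRoot_exp 12 (by norm_num)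

lemma norm_z12 : ‖z12‖ = 1 := isPrimitiveRoot_z12.norm'_eq_one (by norm_num)

lemma z12_pow_six : z12 ^ 6 = -1 := by
  rw [z12, ← Complex.exp_nat_mul, ← Complex.exp_pi_mul_I]
  congr 1
  push_cast
  ring

lemma z12_pow_four : z12 ^ 4 = z12 ^ 2 - 1 := by
  have h2 : z12 ^ 2 + 1 ≠ 0 := fun h => by
    refine isPrimitiveRoot_z12.pow_ne_one_of_pos_of_lt (l := 4) (by norm_num) (by norm_num) ?_
    linear_combination (z12 ^ 2 - 1) * h
  exact mul_left_cancel₀ h2 (by linear_combination z12_pow_six)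

/-- The numerator of a normalized Jacobi theta series at a twelfth root of unity. -/
def phi (j e : ℤ) (σ : ℂ) : ℂ := ∑' n : ℤ, σ ^ (6 * n ^ 2 + 2 * j * n).toNat * z12 ^ (e * n)

/-- The logarithmic derivative of `phi` with respect to the root of unity. -/
def psi (j e : ℤ) (σ : ℂ) : ℂ :=
  ∑' n : ℤ, (n : ℂ) * (σ ^ (6 * n ^ 2 + 2 * j * n).toNat * z12 ^ (e * n))

/-- The integer ring of the twelfth cyclotomic field in the basis `1, ζ, ζ², ζ³`. -/
abbrev Cyc := ℤ × ℤ × ℤ × ℤ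

namespace Cyc

/-- The embedding into `ℂ`. -/
def toC (a : Cyc) : ℂ := a.1 + a.2.1 * z12 + a.2.2.1 * z12 ^ 2 + a.2.2.2 * z12 ^ 3

/-- Multiplication by `c ζ^r`. -/
def smulPow (c : ℤ) : ℕ → Cyc → Cyc
  | 0, a => (c * a.1, c * a.2.1, c * a.2.2.1, c * a.2.2.2)
  | r + 1, a => smulPow c r (-a.2.2.2, a.1, a.2.1 + a.2.2.2, a.2.2.1)

lemma toC_add (a b : Cyc) : toC (a + b) = toC a + toC b := by
  simp [toC]
  ring

lemma toC_smulPow (c : ℤ) (r : ℕ) (a : Cyc) : toC (smulPow c r a) = c * z12 ^ r * toC a := by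
  induction r generalizing a with
  | zero => simp [toC, smulPow]; ring
  | succ r ih =>
    rw [smulPow, ih]
    simp [toC]
    linear_combination (-(c * z12 ^ r * a.2.2.2 : ℂ)) * z12_pow_four

end Cyc

/-- The value at `σ` of the polynomial with the given coefficients. -/
def toS : List Cyc → ℂ → ℂ
  | [], _ => 0
  | a :: l, σ => a.toC + σ * toS l σ

/-- Addition of polynomials. -/
def addL : List Cyc → List Cyc → List Cyc
  | [], l => l
  | l, [] => l
  | a :: l, b :: l' => (a + b) :: addL l l'

lemma toS_addL (l l' : List Cyc) (σ : ℂ) : toS (addL l l') σ = toS l σ + toS l' σ := by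
  induction l generalizing l' with
  | nil => simp [addL, toS]
  | cons a l ih =>
    cases l' with
    | nil => simp [addL, toS]
    | cons b l' =>
      simp only [addL, toS, ih, Cyc.toC_add]
      ring

lemma toS_replicate_append (k : ℕ) (l : List Cyc) (σ : ℂ) :
    toS (List.replicate k (0 : Cyc) ++ l) σ = σ ^ k * toS l σ := by
  induction k with
  | zero => simp
  | succ k ih =>
    rw [List.replicate_succ, List.cons_append, toS, ih]
    simp [Cyc.toC]
    ring

lemma toS_map_smulPow (c : ℤ) (r : ℕ) (l : List Cyc) (σ : ℂ) :
    toS (l.map (Cyc.smulPow c r)) σ = c * z12 ^ r * toS l σ := by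
  induction l with
  | nil => simp [toS]
  | cons a l ih =>
    rw [List.map_cons, toS, toS, ih, Cyc.toC_smulPow]
    ring

lemma continuous_toS (l : List Cyc) : Continuous (toS l) := by
  induction l with
  | nil => exact continuous_const
  | cons a l ih => exact continuous_const.add (continuous_id.mul ih)

/-- `f` agrees with the polynomial `l` up to terms of order `M` at the origin. -/
def Ap (M : ℕ) (f : ℂ → ℂ) (l : List Cyc) : Prop :=
  (fun σ => f σ - toS l σ) =O[𝓝 0] fun σ => σ ^ M

lemma Ap.isBigO_one {M : ℕ} {f : ℂ → ℂ} {l : List Cyc} (h : Ap M f l) :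
    f =O[𝓝 0] fun _ => (1 : ℂ) := by
  have h1 : (fun σ : ℂ => σ ^ M) =O[𝓝 0] fun _ => (1 : ℂ) :=
    (continuous_pow M).continuousAt.norm.isBoundedUnder_le.isBigO_one ℂ
  have h2 : toS l =O[𝓝 0] fun _ => (1 : ℂ) :=
    (continuous_toS l).continuousAt.norm.isBoundedUnder_le.isBigO_one ℂ
  simpa using (IsBigO.trans h h1).add h2

lemma Ap.add {M : ℕ} {f g : ℂ → ℂ} {l l' : List Cyc} (hf : Ap M f l) (hg : Ap M g l') :
    Ap M (fun σ => f σ + g σ) (addL l l') := by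
  refine (IsBigO.add hf hg).congr_left fun σ => ?_
  rw [toS_addL]
  ring

lemma isBigO_toS_take (M : ℕ) (l : List Cyc) :
    (fun σ => toS l σ - toS (l.take M) σ) =O[𝓝 0] fun σ => σ ^ M := by
  induction M generalizing l with
  | zero => simpa [toS] using
      ((continuous_toS l).continuousAt (x := (0 : ℂ))).norm.isBoundedUnder_le.isBigO_one ℂ
  | succ M ih =>
    cases l with
    | nil => simpa [toS] using isBigO_zero _ _
    | cons a l =>
      simp only [List.take_succ_cons, toS, add_sub_add_left_eq_sub, ← mul_sub, pow_succ']
      exact (isBigO_refl _ _).mul (ih l)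

lemma Ap.take {M : ℕ} {f : ℂ → ℂ} {l : List Cyc} (hf : Ap M f l) : Ap M f (l.take M) :=
  (IsBigO.add hf (isBigO_toS_take M l)).congr_left fun σ => by ring

lemma Ap.smulPow {M : ℕ} {f : ℂ → ℂ} {l : List Cyc} (hf : Ap M f l) (c : ℤ) (r : ℕ) :
    Ap M (fun σ => c * z12 ^ r * f σ) (l.map (Cyc.smulPow c r)) := by
  refine (IsBigO.const_mul_left hf (c * z12 ^ r)).congr_left fun σ => ?_
  rw [toS_map_smulPow]
  ring

lemma Ap.shift {M : ℕ} {f : ℂ → ℂ} {l : List Cyc} (hf : Ap M f l) (k : ℕ) :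
    Ap M (fun σ => σ ^ k * f σ) ((List.replicate k (0 : Cyc) ++ l).take M) := by
  refine Ap.take ?_
  have h1 : (fun σ : ℂ => σ ^ k) =O[𝓝 0] fun _ => (1 : ℂ) :=
    (continuous_pow k).continuousAt.norm.isBoundedUnder_le.isBigO_one ℂ
  refine ((h1.mul hf).congr_left fun σ => ?_).congr_right fun σ => by rw [one_mul]
  rw [toS_replicate_append]
  ring

/-- The value at `σ` of a sparse polynomial given by triples (exponent, coefficient, root). -/
def sparseS (S : List (ℕ × ℤ × ℕ)) (σ : ℂ) : ℂ :=
  (S.map fun s => σ ^ s.1 * (s.2.1 * z12 ^ s.2.2)).sum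

/-- The truncated product of a polynomial with a sparse polynomial. -/
def mulT (M : ℕ) (l : List Cyc) : List (ℕ × ℤ × ℕ) → List Cyc
  | [] => []
  | s :: S => addL ((List.replicate s.1 (0 : Cyc) ++ l.map (Cyc.smulPow s.2.1 s.2.2)).take M)
      (mulT M l S)

lemma Ap.zero (M : ℕ) : Ap M (fun _ => 0) [] := by
  simpa [Ap, toS] using isBigO_zero _ _

lemma Ap.mulT {M : ℕ} {f : ℂ → ℂ} {l : List Cyc} (hf : Ap M f l) (S : List (ℕ × ℤ × ℕ)) :
    Ap M (fun σ => sparseS S σ * f σ) (mulT M l S) := by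
  induction S with
  | nil => simpa [sparseS, E8Jacobi.mulT] using Ap.zero M
  | cons s S ih =>
    have := ((hf.smulPow s.2.1 s.2.2).shift s.1).add ih
    refine IsBigO.congr_left this fun σ => ?_
    simp only [sparseS, List.map_cons, List.sum_cons]
    rw [E8Jacobi.mulT]
    ring

lemma Ap.mul_sparse {M : ℕ} {f g : ℂ → ℂ} {l : List Cyc} {S : List (ℕ × ℤ × ℕ)}
    (hg : (fun σ => g σ - sparseS S σ) =O[𝓝 0] fun σ => σ ^ M) (hf : Ap M f l) :
    Ap M (fun σ => g σ * f σ) (E8Jacobi.mulT M l S) := by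
  have h1 := (hg.mul hf.isBigO_one).congr_right fun σ => mul_one _
  refine (IsBigO.add h1 (hf.mulT S)).congr_left fun σ => ?_
  ring

/-- The terms of order less than `M` of `phi` (for `w = 1`) and of `psi` (for `w = id`),
for `M ≤ 40`. -/
def thetaTerms (w : ℤ → ℤ) (M : ℕ) (j e : ℤ) : List (ℕ × ℤ × ℕ) :=
  (([-3, -2, -1, 0, 1, 2, 3] : List ℤ).map fun n =>
    ((6 * n ^ 2 + 2 * j * n).toNat, w n, (e * n % 12).toNat)).filter fun s => s.1 < M

lemma z12_zpow_emod (e : ℤ) : z12 ^ (e % 12).toNat = z12 ^ e := by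
  rw [← zpow_natCast, Int.toNat_of_nonneg (Int.emod_nonneg _ (by norm_num))]
  conv_rhs => rw [← Int.emod_add_mul_ediv e 12, zpow_add₀ z12_ne_zero, zpow_mul]
  have : z12 ^ (12 : ℤ) = 1 := by exact_mod_cast isPrimitiveRoot_z12.pow_eq_one
  rw [this, one_zpow, mul_one]

lemma isBigO_sparseS_filter (M : ℕ) (S : List (ℕ × ℤ × ℕ)) :
    (fun σ => sparseS S σ - sparseS (S.filter fun s => s.1 < M) σ) =O[𝓝 0] fun σ => σ ^ M := by
  induction S with
  | nil => simpa [sparseS] using isBigO_zero _ _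
  | cons s S ih =>
    by_cases h : s.1 < M
    · simpa [sparseS, h] using ih
    · have h1 : (fun σ : ℂ => σ ^ s.1 * (s.2.1 * z12 ^ s.2.2)) =O[𝓝 0] fun σ => σ ^ M := by
        have h2 : (fun σ : ℂ => σ ^ (s.1 - M) * (s.2.1 * z12 ^ s.2.2)) =O[𝓝 0] fun _ => (1 : ℂ) :=
          (((continuous_pow _).mul continuous_const).continuousAt).norm.isBoundedUnder_le.isBigO_one
            ℂ
        refine ((isBigO_refl (fun σ : ℂ => σ ^ M) (𝓝 0)).mul h2).congr (fun σ => ?_) fun σ => ?_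
        · rw [← mul_assoc, ← pow_add, Nat.add_sub_cancel' (not_lt.1 h)]
        · rw [mul_one]
      refine (h1.add ih).congr_left fun σ => ?_
      simp [sparseS, h]
      ring

lemma summable_abs_mul_geometric : Summable fun n : ℤ => (1 + |(n : ℝ)|) * (1 / 2) ^ n.natAbs := by
  have h : Summable fun n : ℕ => (1 + (n : ℝ)) * (1 / 2) ^ n := by
    have h1 := summable_geometric_of_lt_one (r := (1 / 2 : ℝ)) (by norm_num) (by norm_num)
    have h2 := summable_pow_mul_geometric_of_norm_lt_one (R := ℝ) 1 (r := 1 / 2) (by norm_num)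
    refine (h1.add h2).congr fun n => ?_
    simp
    ring
  refine Summable.of_nat_of_neg (h.congr fun n => ?_) (h.congr fun n => ?_) <;> simp

lemma toNat_theta_exponent {j n : ℤ} (hj : |j| ≤ 3) (hn : 4 ≤ |n|) :
    40 + n.natAbs ≤ (6 * n ^ 2 + 2 * j * n).toNat := by
  have h1 : |j * n| ≤ 3 * |n| := by
    rw [abs_mul]
    exact mul_le_mul_of_nonneg_right hj (abs_nonneg _)
  have h2 := neg_abs_le (j * n)
  have h3 : n ^ 2 = |n| ^ 2 := (sq_abs n).symm
  have h4 : (n.natAbs : ℤ) = |n| := Int.natCast_natAbs n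
  have : (40 + n.natAbs : ℤ) ≤ 6 * n ^ 2 + 2 * j * n := by
    rw [h3, h4]
    nlinarith
  omega

lemma isBigO_theta_sub_terms {w : ℤ → ℤ} (hw : ∀ n, |w n| ≤ 1 + |n|) {M : ℕ} (hM : M ≤ 40)
    {j e : ℤ} (hj : |j| ≤ 3) :
    (fun σ => ∑' n : ℤ, (w n : ℂ) * (σ ^ (6 * n ^ 2 + 2 * j * n).toNat * z12 ^ (e * n)) -
      sparseS (thetaTerms w M j e) σ) =O[𝓝 0] fun σ => σ ^ M := by
  set S : List (ℕ × ℤ × ℕ) := ([-3, -2, -1, 0, 1, 2, 3] : List ℤ).map fun n =>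
    ((6 * n ^ 2 + 2 * j * n).toNat, w n, (e * n % 12).toNat) with hS
  let s : Finset ℤ := {-3, -2, -1, 0, 1, 2, 3}
  let t : ℂ → ℤ → ℂ := fun σ n =>
    (w n : ℂ) * (σ ^ (6 * n ^ 2 + 2 * j * n).toNat * z12 ^ (e * n))
  have hsS : ∀ σ, ∑ n ∈ s, t σ n = sparseS S σ := fun σ => by
    simp only [sparseS, hS, List.map_map, Function.comp_def, z12_zpow_emod]
    simp only [s, t, List.map_cons, List.map_nil, List.sum_cons, List.sum_nil]
    rw [Finset.sum_insert (by decide), Finset.sum_insert (by decide),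
      Finset.sum_insert (by decide), Finset.sum_insert (by decide),
      Finset.sum_insert (by decide), Finset.sum_insert (by decide), Finset.sum_singleton]
    ring
  have hmem : ∀ n : ℤ, n ∉ s → 4 ≤ |n| := fun n hn => by
    by_contra h
    have h1 := abs_lt.1 (not_le.1 h)
    refine hn ?_
    obtain ⟨h2, h3⟩ := h1
    interval_cases n <;> decide
  let B : ℝ := ∑' n : ℤ, (1 + |(n : ℝ)|) * (1 / 2) ^ n.natAbs
  have key : (fun σ => ∑' n : ℤ, t σ n - ∑ n ∈ s, t σ n) =O[𝓝 0] fun σ => σ ^ M := by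
    refine IsBigO.of_bound B ?_
    filter_upwards [Metric.ball_mem_nhds (0 : ℂ) (by norm_num : (0 : ℝ) < 1 / 2)] with σ hσ
    have hσ : ‖σ‖ ≤ 1 / 2 := by simpa using (mem_ball_zero_iff.1 hσ).le
    have hb : ∀ n : ℤ, ‖(if n ∈ s then 0 else t σ n)‖ ≤
        (1 + |(n : ℝ)|) * (1 / 2) ^ n.natAbs * ‖σ‖ ^ M := fun n => by
      split_ifs with h
      · rw [norm_zero]; positivity
      · have hn := toNat_theta_exponent hj (hmem n h)
        have hwn : ‖(w n : ℂ)‖ ≤ 1 + |(n : ℝ)| := by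
          rw [Complex.norm_intCast]
          exact_mod_cast hw n
        have h1 : ‖σ‖ ^ (6 * n ^ 2 + 2 * j * n).toNat ≤ (1 / 2) ^ n.natAbs * ‖σ‖ ^ M := by
          calc ‖σ‖ ^ (6 * n ^ 2 + 2 * j * n).toNat ≤ ‖σ‖ ^ (n.natAbs + M) :=
                pow_le_pow_of_le_one (norm_nonneg _) (by linarith) (by omega)
            _ = ‖σ‖ ^ n.natAbs * ‖σ‖ ^ M := pow_add _ _ _
            _ ≤ _ := by gcongr
        simp only [t, norm_mul, norm_pow, norm_zpow, norm_z12, one_zpow, mul_one]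
        exact (mul_le_mul hwn h1 (by positivity) (by positivity)).trans_eq (mul_assoc _ _ _).symm
    have hsum : Summable fun n => if n ∈ s then 0 else t σ n :=
      Summable.of_norm_bounded (summable_abs_mul_geometric.mul_right _) hb
    have hts : Summable (t σ) := by
      refine (hsum.add (summable_of_ne_finset_zero (s := s)
        (f := fun n => if n ∈ s then t σ n else 0) fun n hn => by simp [hn])).congr fun n => ?_
      by_cases h : n ∈ s <;> simp [h]
    have hsub : ∑' n, t σ n - ∑ n ∈ s, t σ n = ∑' n, if n ∈ s then 0 else t σ n := by
      have h2 : ∑ n ∈ s, t σ n = ∑' n, if n ∈ s then t σ n else 0 := by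
        rw [tsum_eq_sum (s := s) fun n hn => by simp [hn]]
        exact Finset.sum_congr rfl fun n hn => by simp [hn]
      rw [h2, ← hts.tsum_sub (summable_of_ne_finset_zero (s := s) fun n hn => by simp [hn])]
      refine tsum_congr fun n => ?_
      by_cases h : n ∈ s <;> simp [h]
    rw [hsub, norm_pow]
    refine tsum_of_norm_bounded ?_ hb
    exact summable_abs_mul_geometric.hasSum.mul_right _
  refine (key.add (isBigO_sparseS_filter M S)).congr_left fun σ => ?_
  rw [hsS, thetaTerms, ← hS]
  ring

lemma phi_sub_terms {M : ℕ} (hM : M ≤ 40) {j e : ℤ} (hj : |j| ≤ 3) :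
    (fun σ => phi j e σ - sparseS (thetaTerms (fun _ => 1) M j e) σ) =O[𝓝 0] fun σ => σ ^ M := by
  simpa [phi] using isBigO_theta_sub_terms (w := fun _ => 1) (fun n => by simp) hM hj

lemma psi_sub_terms {M : ℕ} (hM : M ≤ 40) {j e : ℤ} (hj : |j| ≤ 3) :
    (fun σ => psi j e σ - sparseS (thetaTerms id M j e) σ) =O[𝓝 0] fun σ => σ ^ M :=
  isBigO_theta_sub_terms (w := id) (fun n => by simp) hM hj

/-- The product of the theta series attached to a list of triples `(j, e, v)`. -/
def prodPhi : List (ℤ × ℤ × ℤ) → ℂ → ℂ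
  | [], _ => 1
  | s :: L, σ => phi s.1 s.2.1 σ * prodPhi L σ

/-- The derivative of `prodPhi` in the direction `v`. -/
def dprodPhi : List (ℤ × ℤ × ℤ) → ℂ → ℂ
  | [], _ => 0
  | s :: L, σ => s.2.2 * (psi s.1 s.2.1 σ * prodPhi L σ) + phi s.1 s.2.1 σ * dprodPhi L σ

/-- The truncation of `prodPhi`. -/
def prodT (M : ℕ) : List (ℤ × ℤ × ℤ) → List Cyc
  | [] => [(1, 0, 0, 0)]
  | s :: L => mulT M (prodT M L) (thetaTerms (fun _ => 1) M s.1 s.2.1)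

/-- The truncation of `dprodPhi`. -/
def dprodT (M : ℕ) : List (ℤ × ℤ × ℤ) → List Cyc
  | [] => []
  | s :: L => addL (if s.2.2 = 0 then [] else
      (mulT M (prodT M L) (thetaTerms id M s.1 s.2.1)).map (Cyc.smulPow s.2.2 0))
    (mulT M (dprodT M L) (thetaTerms (fun _ => 1) M s.1 s.2.1))

lemma ap_prodPhi {M : ℕ} (hM : M ≤ 40) {L : List (ℤ × ℤ × ℤ)} (hL : ∀ s ∈ L, |s.1| ≤ 3) :
    Ap M (prodPhi L) (prodT M L) := by
  induction L with
  | nil =>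
    refine (isBigO_zero _ _).congr_left fun σ => ?_
    simp [prodPhi, prodT, toS, Cyc.toC]
  | cons s L ih =>
    exact Ap.mul_sparse (phi_sub_terms hM (hL s (by simp))) (ih fun t ht => hL t (by simp [ht]))

lemma ap_dprodPhi {M : ℕ} (hM : M ≤ 40) {L : List (ℤ × ℤ × ℤ)} (hL : ∀ s ∈ L, |s.1| ≤ 3) :
    Ap M (dprodPhi L) (dprodT M L) := by
  induction L with
  | nil => exact Ap.zero M
  | cons s L ih =>
    have hL' : ∀ t ∈ L, |t.1| ≤ 3 := fun t ht => hL t (by simp [ht])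
    have h1 := Ap.mul_sparse (psi_sub_terms hM (hL s (by simp)) (e := s.2.1)) (ap_prodPhi hM hL')
    have h2 := Ap.mul_sparse (phi_sub_terms hM (hL s (by simp)) (e := s.2.1)) (ih hL')
    refine Ap.add ?_ h2
    split_ifs with h
    · simpa [h] using Ap.zero M
    · simpa using h1.smulPow s.2.2 0

/-- The local parameter `exp (2πiτ/12)`. -/
def sg (τ : ℂ) : ℂ := exp (2 * Real.pi * I * τ / 12)

lemma sg_ne_zero (τ : ℂ) : sg τ ≠ 0 := Complex.exp_ne_zero _

lemma two_mul_mul_le {j n : ℤ} (hj : |j| ≤ 3) : 0 ≤ 6 * n ^ 2 + 2 * j * n := by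
  obtain ⟨h1, h2⟩ := abs_le.1 hj
  rcases le_total n 0 with h | h
  · rcases h.eq_or_lt with rfl | h
    · simp
    · nlinarith
  · rcases h.eq_or_lt with rfl | h
    · simp
    · nlinarith

lemma jacobiTheta₂_term_twelfth (n : ℤ) {j e : ℤ} (hj : |j| ≤ 3) (τ : ℂ) :
    jacobiTheta₂_term n (e / 12 + j * τ / 6) τ =
      sg τ ^ (6 * n ^ 2 + 2 * j * n).toNat * z12 ^ (e * n) := by
  rw [← zpow_natCast, Int.toNat_of_nonneg (two_mul_mul_le hj), sg, z12, ← Complex.exp_int_mul,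
    ← Complex.exp_int_mul, ← Complex.exp_add, jacobiTheta₂_term]
  congr 1
  push_cast
  ring

lemma jacobiTheta₂_twelfth {j e : ℤ} (hj : |j| ≤ 3) (τ : ℂ) :
    jacobiTheta₂ (e / 12 + j * τ / 6) τ = phi j e (sg τ) := by
  simp only [jacobiTheta₂, phi, jacobiTheta₂_term_twelfth _ hj]

lemma jacobiTheta₂'_twelfth {j e : ℤ} (hj : |j| ≤ 3) (τ : ℂ) :
    jacobiTheta₂' (e / 12 + j * τ / 6) τ = 2 * Real.pi * I * psi j e (sg τ) := by
  simp only [jacobiTheta₂', psi, jacobiTheta₂'_term, jacobiTheta₂_term_twelfth _ hj,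
    ← tsum_mul_left]
  exact tsum_congr fun n => by ring

/-- A product of Jacobi theta functions along the line with direction `v`. -/
def jprod (τ : ℂ) : List (ℤ × ℤ × ℤ) → ℂ → ℂ
  | [], _ => 1
  | s :: L, t => jacobiTheta₂ (s.2.1 / 12 + s.1 * τ / 6 + t * s.2.2) τ * jprod τ L t

lemma jprod_eq (τ : ℂ) (L : List (ℤ × ℤ × ℤ)) (t : ℂ) : jprod τ L t =
    (L.map fun s => jacobiTheta₂ (s.2.1 / 12 + s.1 * τ / 6 + t * s.2.2) τ).prod := by
  induction L with
  | nil => rfl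
  | cons s L ih => simp [jprod, ih]

lemma jprod_zero (τ : ℂ) {L : List (ℤ × ℤ × ℤ)} (hL : ∀ s ∈ L, |s.1| ≤ 3) :
    jprod τ L 0 = prodPhi L (sg τ) := by
  induction L with
  | nil => rfl
  | cons s L ih =>
    rw [jprod, prodPhi, ih fun t ht => hL t (by simp [ht]), zero_mul, add_zero,
      jacobiTheta₂_twelfth (hL s (by simp))]

lemma hasDerivAt_jprod {τ : ℂ} (hτ : 0 < τ.im) {L : List (ℤ × ℤ × ℤ)}
    (hL : ∀ s ∈ L, |s.1| ≤ 3) :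
    HasDerivAt (jprod τ L) (2 * Real.pi * I * dprodPhi L (sg τ)) 0 := by
  induction L with
  | nil => simpa [dprodPhi, jprod] using hasDerivAt_const (0 : ℂ) (1 : ℂ)
  | cons s L ih =>
    have hs := hL s (by simp)
    have hL' : ∀ t ∈ L, |t.1| ≤ 3 := fun t ht => hL t (by simp [ht])
    have h1 : HasDerivAt (fun t : ℂ => (s.2.1 / 12 + s.1 * τ / 6 + t * s.2.2 : ℂ)) s.2.2 0 := by
      simpa using ((hasDerivAt_id (0 : ℂ)).mul_const (s.2.2 : ℂ)).const_add
        (s.2.1 / 12 + s.1 * τ / 6 : ℂ)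
    have h2 := hasDerivAt_jacobiTheta₂_fst (s.2.1 / 12 + s.1 * τ / 6 + 0 * s.2.2) hτ
    have h3 := (h2.comp (0 : ℂ) h1).mul (ih hL')
    refine (h3.congr_deriv ?_).congr_of_eventuallyEq (Filter.Eventually.of_forall fun t => rfl)
    simp only [Function.comp_apply, zero_mul, add_zero, jacobiTheta₂_twelfth hs,
      jacobiTheta₂'_twelfth hs, jprod_zero τ hL', dprodPhi]
    ring

lemma jacobiTheta₂_add_natCast_mul (n : ℕ) (z τ : ℂ) : jacobiTheta₂ (z + n * τ) τ =
    exp (-(Real.pi * I * (n ^ 2 * τ + 2 * n * z))) * jacobiTheta₂ z τ := by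
  induction n with
  | zero => simp
  | succ n ih =>
    have h : z + ((n + 1 : ℕ) : ℂ) * τ = z + n * τ + τ := by push_cast; ring
    rw [h, jacobiTheta₂_add_left', ih, ← mul_assoc, ← Complex.exp_add]
    congr 2
    push_cast
    ring

/-- The vector with first two entries `a` and all others `b`. -/
def tJ (a b : ℤ) : Fin 8 → ℤ := ![a, a, b, b, b, b, b, b]

/-- The list of triples `(J i, e i + s, v i)`. -/
def trip (J e v : Fin 8 → ℤ) (s : ℤ) : List (ℤ × ℤ × ℤ) := List.ofFn fun i => (J i, e i + s, v i)

lemma abs_fst_le_of_mem_trip {J e v : Fin 8 → ℤ} {s : ℤ} (hJ : ∀ i, |J i| ≤ 3)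
    (t : ℤ × ℤ × ℤ) (ht : t ∈ trip J e v s) : |t.1| ≤ 3 := by
  obtain ⟨i, rfl⟩ := (List.mem_ofFn' _ _).1 ht
  exact hJ i

lemma abs_tJ_le {a b : ℤ} (ha : |a| ≤ 3) (hb : |b| ≤ 3) (i : Fin 8) : |tJ a b i| ≤ 3 := by
  fin_cases i <;> assumption

lemma jprod_trip (τ : ℂ) (J e v : Fin 8 → ℤ) (s : ℤ) (t : ℂ) : jprod τ (trip J e v s) t =
    ∏ i, jacobiTheta₂ ((e i + s) / 12 + J i * τ / 6 + t * v i) τ := by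
  rw [jprod_eq, trip, List.map_ofFn, List.prod_ofFn]
  simp

/-- The line through the special point for the parameter `τ`. -/
def lineZ (j : ℕ) (τ : ℂ) (e v : Fin 8 → ℤ) (t : ℂ) : Fin 8 → ℂ :=
  fun i => j * τ * pV i + e i / 12 + t * v i

lemma Theta_lineZ {τ : ℂ} (hτ : 0 < τ.im) (j : ℕ) (e v : Fin 8 → ℤ) (hv : ∑ i, v i = 0) (t : ℂ) :
    exp (Real.pi * I * (j ^ 2 * τ + 2 * j * (e 0 / 12 + t * v 0))) *
      (2 * Theta τ (lineZ j τ e v t)) =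
    (jprod τ (trip (tJ 0 j) e v 0) t + (-1) ^ j * jprod τ (trip (tJ 0 j) e v 6) t) +
    exp (Real.pi * I * ((2 - j) * τ - (∑ i, e i : ℤ) / 12)) *
      (jprod τ (trip (tJ (-3) (j - 3)) e v 0) t +
        (-1) ^ j * jprod τ (trip (tJ (-3) (j - 3)) e v 6) t) := by
  have hG : ∀ s : ℤ, ∏ i, jacobiTheta₂ (lineZ j τ e v t i + s / 12) τ =
      exp (-(Real.pi * I * (j ^ 2 * τ + 2 * j * ((e 0 + s) / 12 + t * v 0)))) *
        jprod τ (trip (tJ 0 j) e v s) t := fun s => by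
    rw [jprod_trip, Fin.prod_univ_succ, Fin.prod_univ_succ (n := 7), ← mul_assoc]
    have h0 : lineZ j τ e v t 0 + s / 12 =
        ((e 0 + s) / 12 + (tJ 0 j 0 : ℤ) * τ / 6 + t * v 0) + j * τ := by
      simp [lineZ, pV, tJ]; ring
    rw [h0, jacobiTheta₂_add_natCast_mul]
    congr 1
    · simp [tJ]
    · refine Finset.prod_congr rfl fun i _ => ?_
      congr 1
      fin_cases i <;> simp [lineZ, pV, tJ] <;> ring
  have hH : ∀ s : ℤ, ∏ i, jacobiTheta₂ (lineZ j τ e v t i - τ / 2 + s / 12) τ =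
      exp (-(Real.pi * I * (j ^ 2 * τ + 2 * j * ((e 0 + s) / 12 - τ / 2 + t * v 0)))) *
        jprod τ (trip (tJ (-3) (j - 3)) e v s) t := fun s => by
    rw [jprod_trip, Fin.prod_univ_succ, Fin.prod_univ_succ (n := 7), ← mul_assoc]
    have h0 : lineZ j τ e v t 0 - τ / 2 + s / 12 =
        ((e 0 + s) / 12 + (tJ (-3) (j - 3) 0 : ℤ) * τ / 6 + t * v 0) + j * τ := by
      simp [lineZ, pV, tJ]; ring
    rw [h0, jacobiTheta₂_add_natCast_mul]
    congr 1
    · congr 2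
      simp only [tJ, Matrix.cons_val_zero]
      push_cast
      ring
    · refine Finset.prod_congr rfl fun i _ => ?_
      congr 1
      fin_cases i <;> simp [lineZ, pV, tJ] <;> ring
  have hG0 := hG 0
  have hG6 := hG 6
  have hH0 := hH 0
  have hH6 := hH 6
  have h12 : ((6 : ℤ) : ℂ) / 12 = 1 / 2 := by norm_num
  rw [h12] at hG6 hH6
  simp only [Int.cast_zero, zero_div, add_zero] at hG0 hH0
  have hsum : ∑ i, lineZ j τ e v t i = 2 * j * τ + (∑ i, e i : ℤ) / 12 := by
    have hv' : (∑ i, (v i : ℂ)) = 0 := by exact_mod_cast congrArg (Int.cast (R := ℂ)) hv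
    simp only [Fin.sum_univ_eight] at hv'
    simp [lineZ, pV, Fin.sum_univ_eight]
    linear_combination t * hv'
  have hm : ((-1 : ℂ)) ^ j = exp (-(Real.pi * I * j)) := by
    rw [← Complex.exp_pi_mul_I, ← Complex.exp_nat_mul]
    refine exp_eq_exp_of_int j ?_
    simp only [πC]
    push_cast
    ring
  rw [Theta_eq τ hτ, hG0, hG6, hH0, hH6, hsum, hm]
  set X := exp (Real.pi * I * (j ^ 2 * τ + 2 * j * (e 0 / 12 + t * v 0))) with hX
  have h1 : X * exp (-(Real.pi * I * (j ^ 2 * τ + 2 * j * (e 0 / 12 + t * v 0)))) = 1 := by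
    rw [hX, ← Complex.exp_add, add_neg_cancel, Complex.exp_zero]
  have h2 : X * exp (-(Real.pi * I * (j ^ 2 * τ + 2 * j * ((e 0 + (6 : ℤ)) / 12 + t * v 0)))) =
      exp (-(Real.pi * I * j)) := by
    rw [hX, ← Complex.exp_add]
    congr 1
    push_cast
    ring
  have h3 : X * (exp (2 * Real.pi * I * τ -
        Real.pi * I * (2 * j * τ + (∑ i, e i : ℤ) / 12)) *
      exp (-(Real.pi * I * (j ^ 2 * τ + 2 * j * (e 0 / 12 - τ / 2 + t * v 0))))) =
      exp (Real.pi * I * ((2 - j) * τ - (∑ i, e i : ℤ) / 12)) := by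
    rw [hX, ← Complex.exp_add, ← Complex.exp_add]
    congr 1
    ring
  have h4 : X * (exp (2 * Real.pi * I * τ -
        Real.pi * I * (2 * j * τ + (∑ i, e i : ℤ) / 12)) *
      exp (-(Real.pi * I * (j ^ 2 * τ + 2 * j * ((e 0 + (6 : ℤ)) / 12 - τ / 2 + t * v 0))))) =
      exp (Real.pi * I * ((2 - j) * τ - (∑ i, e i : ℤ) / 12)) * exp (-(Real.pi * I * j)) := by
    rw [hX, ← Complex.exp_add, ← Complex.exp_add, ← Complex.exp_add]
    congr 1
    push_cast
    ring
  linear_combination jprod τ (trip (tJ 0 j) e v 0) t * h1 + jprod τ (trip (tJ 0 j) e v 6) t * h2 +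
    jprod τ (trip (tJ (-3) (j - 3)) e v 0) t * h3 + jprod τ (trip (tJ (-3) (j - 3)) e v 6) t * h4

/-- The normalized product expansion of a rescaled theta function at the special point:
its value for `F = prodPhi`, its derivative for `F = dprodPhi`. -/
def blk (F : List (ℤ × ℤ × ℤ) → ℂ → ℂ) (j : ℕ) (e v : Fin 8 → ℤ) (σ : ℂ) : ℂ :=
  σ ^ (6 * j - 12) *
      (F (trip (tJ 0 j) e v 0) σ + ((-1) ^ j : ℤ) * z12 ^ 0 * F (trip (tJ 0 j) e v 6) σ) +
    σ ^ (12 - 6 * j) * ((1 : ℤ) * z12 ^ ((-((∑ i, e i) / 2)) % 12).toNat *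
      (F (trip (tJ (-3) (j - 3)) e v 0) σ +
        ((-1) ^ j : ℤ) * z12 ^ 0 * F (trip (tJ (-3) (j - 3)) e v 6) σ))

/-- The truncation of `blk`. -/
def blkT (F : List (ℤ × ℤ × ℤ) → List Cyc) (M j : ℕ) (e v : Fin 8 → ℤ) : List Cyc :=
  addL ((List.replicate (6 * j - 12) (0 : Cyc) ++
      addL (F (trip (tJ 0 j) e v 0))
        ((F (trip (tJ 0 j) e v 6)).map (Cyc.smulPow ((-1) ^ j) 0))).take M)
    ((List.replicate (12 - 6 * j) (0 : Cyc) ++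
      (addL (F (trip (tJ (-3) (j - 3)) e v 0))
        ((F (trip (tJ (-3) (j - 3)) e v 6)).map (Cyc.smulPow ((-1) ^ j) 0))).map
        (Cyc.smulPow 1 ((-((∑ i, e i) / 2)) % 12).toNat)).take M)

lemma ap_blk {F : List (ℤ × ℤ × ℤ) → ℂ → ℂ} {G : List (ℤ × ℤ × ℤ) → List Cyc} {M : ℕ}
    (h : ∀ L, (∀ s ∈ L, |s.1| ≤ 3) → Ap M (F L) (G L)) {j : ℕ} (hj : j ≤ 3) (e v : Fin 8 → ℤ) :
    Ap M (blk F j e v) (blkT G M j e v) := by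
  have hG : ∀ s, Ap M (F (trip (tJ 0 j) e v s)) (G (trip (tJ 0 j) e v s)) := fun s =>
    h _ (abs_fst_le_of_mem_trip (abs_tJ_le (by norm_num) (abs_le.2 ⟨by omega, by omega⟩)))
  have hH : ∀ s, Ap M (F (trip (tJ (-3) (j - 3)) e v s)) (G (trip (tJ (-3) (j - 3)) e v s)) :=
    fun s =>
    h _ (abs_fst_le_of_mem_trip (abs_tJ_le (by norm_num) (abs_le.2 ⟨by omega, by omega⟩)))
  exact (((hG 0).add ((hG 6).smulPow _ 0)).shift _).add
    ((((hH 0).add ((hH 6).smulPow _ 0)).smulPow 1 _).shift _)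

lemma sg_pow_mul_exp {τ : ℂ} {j : ℕ} {e : Fin 8 → ℤ} (he : Even (∑ i, e i)) :
    sg τ ^ (6 * j - 12) * exp (Real.pi * I * ((2 - j) * τ - (∑ i, e i : ℤ) / 12)) =
      sg τ ^ (12 - 6 * j) * z12 ^ ((-((∑ i, e i) / 2)) % 12).toNat := by
  obtain ⟨s, hs⟩ := he
  have h2 : (∑ i, e i) / 2 = s := by omega
  rw [z12_zpow_emod, h2, hs, z12, sg, ← Complex.exp_int_mul, ← Complex.exp_nat_mul,
    ← Complex.exp_nat_mul, ← Complex.exp_add, ← Complex.exp_add]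
  have h : ((6 * j - 12 : ℕ) : ℂ) = ((12 - 6 * j : ℕ) : ℂ) + 6 * j - 12 := by
    have : (6 * j - 12 : ℕ) + 12 = (12 - 6 * j : ℕ) + 6 * j := by omega
    have := congrArg (Nat.cast (R := ℂ)) this
    simp only [Nat.cast_add, Nat.cast_mul, Nat.cast_ofNat] at this
    linear_combination this
  congr 1
  rw [h]
  push_cast
  ring

lemma Theta_lineZ_zero {τ : ℂ} (hτ : 0 < τ.im) {j : ℕ} (hj : j ≤ 3) {e : Fin 8 → ℤ}
    (he : Even (∑ i, e i)) :
    2 * sg τ ^ (6 * j - 12) * Theta τ (lineZ j τ e 0 0) =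
      exp (-(Real.pi * I * (j ^ 2 * τ + 2 * j * (e 0 / 12)))) * blk prodPhi j e 0 (sg τ) := by
  have h := Theta_lineZ hτ j e 0 (by simp) 0
  simp only [jprod_zero τ (abs_fst_le_of_mem_trip (abs_tJ_le (a := 0) (b := j) (by norm_num)
    (abs_le.2 ⟨by omega, by omega⟩))), jprod_zero τ (abs_fst_le_of_mem_trip
    (abs_tJ_le (a := -3) (b := j - 3) (by norm_num) (abs_le.2 ⟨by omega, by omega⟩))), zero_mul,
    add_zero] at h
  have hs := sg_pow_mul_exp (τ := τ) (j := j) he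
  rw [Complex.exp_neg, blk, eq_inv_mul_iff_mul_eq₀ (Complex.exp_ne_zero _)]
  push_cast
  linear_combination sg τ ^ (6 * j - 12) * h + hs * (prodPhi (trip (tJ (-3) (j - 3)) e 0 0) (sg τ)
    + (-1) ^ j * prodPhi (trip (tJ (-3) (j - 3)) e 0 6) (sg τ))

lemma deriv_Theta_lineZ {τ : ℂ} (hτ : 0 < τ.im) {j : ℕ} (hj : j ≤ 3) {e v : Fin 8 → ℤ}
    (he : Even (∑ i, e i)) (hv : ∑ i, v i = 0) (h0 : Theta τ (lineZ j τ e v 0) = 0) {d : ℂ}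
    (hd : HasDerivAt (fun t => Theta τ (lineZ j τ e v t)) d 0) :
    sg τ ^ (6 * j - 12) * d = Real.pi * I *
      exp (-(Real.pi * I * (j ^ 2 * τ + 2 * j * (e 0 / 12)))) * blk dprodPhi j e v (sg τ) := by
  have hG : ∀ s, HasDerivAt (jprod τ (trip (tJ 0 j) e v s)) _ 0 := fun s =>
    hasDerivAt_jprod hτ (abs_fst_le_of_mem_trip (abs_tJ_le (a := 0) (b := j) (by norm_num)
      (abs_le.2 ⟨by omega, by omega⟩)))
  have hH : ∀ s, HasDerivAt (jprod τ (trip (tJ (-3) (j - 3)) e v s)) _ 0 := fun s =>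
    hasDerivAt_jprod hτ (abs_fst_le_of_mem_trip (abs_tJ_le (a := -3) (b := j - 3) (by norm_num)
      (abs_le.2 ⟨by omega, by omega⟩)))
  have hR := ((hG 0).add ((hG 6).const_mul ((-1) ^ j))).add
    (((hH 0).add ((hH 6).const_mul ((-1) ^ j))).const_mul
      (exp (Real.pi * I * ((2 - j) * τ - (∑ i, e i : ℤ) / 12))))
  have hE : DifferentiableAt ℂ (fun t : ℂ =>
      exp (Real.pi * I * (j ^ 2 * τ + 2 * j * (e 0 / 12 + t * v 0)))) 0 := by fun_prop
  have hL := hE.hasDerivAt.mul (hd.const_mul 2)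
  have heq := hL.unique (hR.congr_of_eventuallyEq
    (Filter.Eventually.of_forall fun t => Theta_lineZ hτ j e v hv t))
  rw [h0] at heq
  simp only [zero_mul, mul_zero, add_zero, zero_add] at heq
  have hs := sg_pow_mul_exp (τ := τ) (j := j) he
  rw [mul_comm (Real.pi * I : ℂ), mul_assoc, Complex.exp_neg, blk,
    eq_inv_mul_iff_mul_eq₀ (Complex.exp_ne_zero _)]
  push_cast
  linear_combination sg τ ^ (6 * j - 12) * heq / 2 + Real.pi * I * hs *
    (dprodPhi (trip (tJ (-3) (j - 3)) e v 0) (sg τ)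
    + (-1) ^ j * dprodPhi (trip (tJ (-3) (j - 3)) e v 6) (sg τ))

/-- Twelve times the real part of the special point, combined with `-K` times the `τ`-part. -/
def eZ (c K : ℤ) : Fin 8 → ℤ := fun i =>
  c * (![7, 1, -5, -3, -1, 1, 3, 5] : Fin 8 → ℤ) i - K * (![12, 0, 2, 2, 2, 2, 2, 2] : Fin 8 → ℤ) i

lemma sum_eZ (c K : ℤ) : ∑ i, eZ c K i = 2 * (4 * c - 12 * K) := by
  simp [eZ, Fin.sum_univ_eight]
  ring

lemma even_sum_eZ (c K : ℤ) : Even (∑ i, eZ c K i) := ⟨4 * c - 12 * K, by rw [sum_eZ]; ring⟩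

/-- The common automorphy factor of the functions of index `m` at the special point. -/
def Em (m : ℕ) (τ : ℂ) : ℂ := exp (-(Real.pi * I * (m * τ + 7 * m / 6)))

lemma IsJac.hasDerivAt {m : ℕ} {τ : ℂ} {f : (Fin 8 → ℂ) → ℂ} (hf : IsJac m τ f) (z v : Fin 8 → ℂ) :
    HasDerivAt (fun t : ℂ => f (fun i => z i + t * v i)) (fderiv ℂ f z v) 0 := by
  have hd : HasFDerivAt f (fderiv ℂ f z) (z + (0 : ℂ) • v) := by
    simpa using ((hf.smooth.differentiable (by norm_num)) z).hasFDerivAt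
  have h1 : HasDerivAt (fun t : ℂ => z + t • v) v 0 := by
    simpa using ((hasDerivAt_id (0 : ℂ)).smul_const v).const_add z
  exact HasFDerivAt.comp_hasDerivAt (f := fun t : ℂ => z + t • v) 0 hd h1

/-- Direct rescaling. -/
lemma scaled_zPt {τ τ' : ℂ} {c j K : ℕ} (h : j * τ' = c * τ + K) (v : Fin 8 → ℤ) (t : ℂ) :
    (fun i => c * (zPt τ i + t * v i)) = lineZ j τ' (eZ c K) (fun i => c * v i) t := by
  ext i
  simp only [lineZ, zPt, h]
  fin_cases i <;> simp [pV, rV, eZ] <;> ring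

lemma exp_eq_Em {τ τ' : ℂ} {c j K m : ℕ} (hm : m = j * c) (h : j * τ' = c * τ + K) :
    exp (-(Real.pi * I * (j ^ 2 * τ' + 2 * j * (eZ c K 0 / 12)))) = Em m τ * (-1) ^ (j * K) := by
  rw [← Complex.exp_pi_mul_I, ← Complex.exp_nat_mul, Em, ← Complex.exp_add, hm]
  refine exp_eq_exp_of_int 0 ?_
  simp [eZ]
  linear_combination (-(Real.pi * I * j)) * h

lemma im_of_mul_eq {τ τ' : ℂ} {c j K : ℕ} (hτ : 0 < τ.im) (hc : 0 < c) (hj : 0 < j)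
    (h : j * τ' = c * τ + K) : 0 < τ'.im := by
  have := congrArg Complex.im h
  simp at this
  have h1 : (0 : ℝ) < c * τ.im := by positivity
  exact pos_of_mul_pos_right (this ▸ h1) (by positivity)

lemma fderiv_direct {τ τ' C : ℂ} {c j K m : ℕ} (hτ : 0 < τ.im) (hc : 0 < c) (hj : 0 < j)
    (hj3 : j ≤ 3) (hm : m = j * c) (h6 : ¬ 6 ∣ m) (hC : C = c) (h : j * τ' = c * τ + K)
    {v : Fin 8 → ℤ} (hv : ∑ i, v i = 0) :
    sg τ' ^ (6 * j - 12) * fderiv ℂ (fun z => Theta τ' fun i => C * z i) (zPt τ)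
      (fun i => (v i : ℂ)) =
    Real.pi * I * Em m τ * (-1) ^ (j * K) * blk dprodPhi j (eZ c K) (fun i => c * v i) (sg τ') := by
  have hJ : IsJac m τ fun z => Theta τ' fun i => C * z i :=
    isJac_Theta_mul c j K hC hτ hc hm (by exact_mod_cast h)
  have h0 := hJ.zPt_eq_zero h6
  have hd := hJ.hasDerivAt (zPt τ) fun i => (v i : ℂ)
  subst hC
  simp only [scaled_zPt h] at hd
  have h0' : Theta τ' (lineZ j τ' (eZ c K) (fun i => c * v i) 0) = 0 := by
    rw [← scaled_zPt h]
    simpa using h0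
  rw [deriv_Theta_lineZ (im_of_mul_eq hτ hc hj h) hj3 (even_sum_eZ c K)
    (by rw [← Finset.mul_sum, hv, mul_zero]) h0' hd, exp_eq_Em hm h]
  ring

lemma value_direct {τ τ' C : ℂ} {c j K m : ℕ} (hτ : 0 < τ.im) (hc : 0 < c) (hj : 0 < j)
    (hj3 : j ≤ 3) (hm : m = j * c) (hC : C = c) (h : j * τ' = c * τ + K) :
    2 * sg τ' ^ (6 * j - 12) * Theta τ' (fun i => C * zPt τ i) =
      Em m τ * (-1) ^ (j * K) * blk prodPhi j (eZ c K) 0 (sg τ') := by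
  have h1 := Theta_lineZ_zero (im_of_mul_eq hτ hc hj h) hj3 (even_sum_eZ c K)
  rw [exp_eq_Em hm h] at h1
  rw [← h1, hC]
  have := scaled_zPt h 0 0
  simp only [zero_mul, add_zero] at this
  rw [this]
  congr 2

lemma six_pV_mem : (fun i => 6 * pV i) ∈ E8Lattice := by
  refine ⟨Or.inl fun i => ⟨(![6, 0, 1, 1, 1, 1, 1, 1] : Fin 8 → ℤ) i, ?_⟩, 6, ?_⟩
  · fin_cases i <;> simp [pV]
  · simp [pV, Fin.sum_univ_eight]
    norm_num

lemma Theta_reflect (τ : ℂ) (z : Fin 8 → ℂ) : Theta τ z =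
    exp (Real.pi * I * (42 * τ - 12 * ∑ i, z i * pV i)) * Theta τ fun i => 6 * τ * pV i - z i := by
  have h := Theta_add_period τ six_pV_mem (β := 0) E8Group.zero_mem (-z)
  rw [Theta_neg] at h
  have h2 : (fun i => 6 * τ * pV i - z i) =
      fun i => (-z) i + τ * ((6 * pV i : ℝ) : ℂ) + ((0 : Fin 8 → ℝ) i : ℝ) := by
    ext i
    simp
    ring
  rw [h2, h, ← mul_assoc, ← Complex.exp_add]
  have h3 : Real.pi * I * (42 * τ - 12 * ∑ i, z i * pV i) + -(πC * I * (τ *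
      dotC (cv fun i => 6 * pV i) (cv fun i => 6 * pV i) + 2 * dotC (-z) (cv fun i => 6 * pV i)))
      = 0 := by
    simp [dotC, cv, πC, Fin.sum_univ_eight, pV]
    ring
  rw [h3, Complex.exp_zero, one_mul]

lemma reflect_zPt {τ τ' : ℂ} {m K : ℕ} (hm : m ≤ 6) (h : m * τ' = τ + K) (v : Fin 8 → ℤ) (t : ℂ) :
    (fun i => 6 * τ' * pV i - (zPt τ i + t * v i)) =
      lineZ (6 - m) τ' (fun i => -eZ 1 K i) (fun i => -v i) t := by
  have h' : τ = m * τ' - K := by rw [h]; ring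
  ext i
  simp only [lineZ, zPt, h', Nat.cast_sub hm]
  fin_cases i <;> simp [pV, rV, eZ] <;> ring

lemma reflect_exp {τ τ' : ℂ} {m K : ℕ} (hm : m ≤ 6) (hm3 : 3 ≤ m) (h : m * τ' = τ + K) :
    sg τ' ^ (12 * (m - 3)) * (exp (Real.pi * I * (42 * τ' - 12 * ∑ i, zPt τ i * pV i)) *
      exp (-(Real.pi * I * ((6 - m : ℕ) ^ 2 * τ' + 2 * (6 - m : ℕ) * ((-eZ 1 K 0 : ℤ) / 12))))) =
      Em m τ * (-1) ^ (m * K) := by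
  rw [← Complex.exp_pi_mul_I, ← Complex.exp_nat_mul, Em, sg, ← Complex.exp_nat_mul,
    ← Complex.exp_add, ← Complex.exp_add, ← Complex.exp_add]
  have h' : τ = m * τ' - K := by rw [h]; ring
  refine exp_eq_exp_of_int (7 * K - m * K - K * (6 - m)) ?_
  rw [h', Nat.cast_mul, Nat.cast_sub hm, Nat.cast_sub hm3]
  simp [eZ, zPt, pV, rV, Fin.sum_univ_eight, πC]
  ring

lemma fderiv_reflect {τ τ' : ℂ} {m K : ℕ} (hτ : 0 < τ.im) (hm4 : 4 ≤ m) (hm5 : m ≤ 5)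
    (h : m * τ' = τ + K) {v : Fin 8 → ℤ} (hv : ∑ i, v i = 0) :
    sg τ' ^ (12 * (m - 3)) * fderiv ℂ (Theta τ') (zPt τ) (fun i => (v i : ℂ)) =
    Real.pi * I * Em m τ * (-1) ^ (m * K) *
      blk dprodPhi (6 - m) (fun i => -eZ 1 K i) (fun i => -v i) (sg τ') := by
  have hJ : IsJac m τ (Theta τ') := isJac_Theta_one m K hτ (by exact_mod_cast h)
  have h0 := hJ.zPt_eq_zero (by omega)
  have hd := hJ.hasDerivAt (zPt τ) fun i => (v i : ℂ)
  have him : 0 < τ'.im := im_of_mul_eq (c := 1) (j := m) (K := K) hτ one_pos (by omega)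
    (by simpa using h)
  set L := lineZ (6 - m) τ' (fun i => -eZ 1 K i) (fun i => -v i) with hL
  have hz : Theta τ' (L 0) = 0 := by
    rw [hL, ← reflect_zPt (by omega) h v 0]
    simp only [zero_mul, add_zero]
    have := Theta_reflect τ' (zPt τ)
    rw [h0, eq_comm] at this
    exact (mul_eq_zero.1 this).resolve_left (Complex.exp_ne_zero _)
  have hLd : DifferentiableAt ℂ (fun t => Theta τ' (L t)) 0 := by
    have h1 : DifferentiableAt ℂ L 0 := by
      rw [hL]
      unfold lineZ
      fun_prop
    exact ((contDiff_Theta τ' him).differentiable (by norm_num) _).comp _ h1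
  have hE : DifferentiableAt ℂ (fun t : ℂ => exp (Real.pi * I * (42 * τ' -
      12 * ∑ i, (zPt τ i + t * v i) * pV i))) 0 := by fun_prop
  have hp := hE.hasDerivAt.mul hLd.hasDerivAt
  have heq := hd.unique (hp.congr_of_eventuallyEq (Filter.Eventually.of_forall fun t => by
    simp only [Pi.mul_apply]
    rw [hL, ← reflect_zPt (by omega) h v t, ← Theta_reflect]))
  rw [hz] at heq
  simp only [zero_mul, mul_zero, add_zero, zero_add] at heq
  have hD := deriv_Theta_lineZ him (j := 6 - m) (by omega) (e := fun i => -eZ 1 K i)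
    (by simpa using even_sum_eZ 1 K) (v := fun i => -v i) (by simpa using hv) hz hLd.hasDerivAt
  have h12 : 6 * (6 - m) - 12 = 0 := by omega
  rw [h12, pow_zero, one_mul] at hD
  rw [heq, hD]
  linear_combination Real.pi * I * blk dprodPhi (6 - m) (fun i => -eZ 1 K i) (fun i => -v i) (sg τ')
    * reflect_exp (by omega) (by omega) h

lemma value_reflect {τ τ' : ℂ} {m K : ℕ} (hτ : 0 < τ.im) (hm4 : 4 ≤ m) (hm6 : m ≤ 6)
    (h : m * τ' = τ + K) :
    2 * sg τ' ^ (12 * (m - 3)) * Theta τ' (zPt τ) = Em m τ * (-1) ^ (m * K) *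
      blk prodPhi (6 - m) (fun i => -eZ 1 K i) 0 (sg τ') := by
  have him : 0 < τ'.im := im_of_mul_eq (c := 1) (j := m) (K := K) hτ one_pos (by omega)
    (by simpa using h)
  have h1 := Theta_lineZ_zero him (j := 6 - m) (by omega) (e := fun i => -eZ 1 K i)
    (by simpa using even_sum_eZ 1 K)
  have h12 : 6 * (6 - m) - 12 = 0 := by omega
  rw [h12, pow_zero, mul_one] at h1
  have h2 := reflect_zPt (by omega) h 0 0
  simp only [zero_mul, add_zero] at h2
  have h3 : lineZ (6 - m) τ' (fun i => -eZ 1 K i) (fun i => -(0 : Fin 8 → ℤ) i) 0 =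
      lineZ (6 - m) τ' (fun i => -eZ 1 K i) 0 0 := by
    ext i
    simp [lineZ]
  rw [h3] at h2
  rw [Theta_reflect, h2]
  linear_combination sg τ' ^ (12 * (m - 3)) *
    exp (Real.pi * I * (42 * τ' - 12 * ∑ i, zPt τ i * pV i)) * h1 +
    blk prodPhi (6 - m) (fun i => -eZ 1 K i) 0 (sg τ') * reflect_exp (by omega) (by omega) h

open Filter

/-- Equality of polynomials up to trailing zeros. -/
def eqZ : List Cyc → List Cyc → Bool
  | [], l => l.all (· == 0)
  | l, [] => l.all (· == 0)
  | a :: l, b :: l' => a == b && eqZ l l'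

lemma toS_of_all {l : List Cyc} (h : l.all (· == 0) = true) (σ : ℂ) : toS l σ = 0 := by
  induction l with
  | nil => rfl
  | cons a l ih =>
    simp only [List.all_cons, Bool.and_eq_true, beq_iff_eq] at h
    rw [toS, ih h.2, h.1]
    simp [Cyc.toC]

lemma toS_of_eqZ {l l' : List Cyc} (h : eqZ l l' = true) (σ : ℂ) : toS l σ = toS l' σ := by
  induction l generalizing l' with
  | nil =>
    rw [eqZ] at h
    rw [toS_of_all h]
    rfl
  | cons a l ih =>
    cases l' with
    | nil =>
      rw [eqZ] at h
      · rw [toS_of_all h]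
        rfl
      · simp
    | cons b l' =>
      rw [eqZ, Bool.and_eq_true, beq_iff_eq] at h
      rw [toS, toS, h.1, ih h.2]

/-- The polynomial given by pairs (number of preceding zero coefficients, coefficient). -/
def gaps : List (ℕ × Cyc) → List Cyc
  | [] => []
  | (n, a) :: L => List.replicate n 0 ++ a :: gaps L

lemma toS_gaps_nil (σ : ℂ) : toS (gaps []) σ = 0 := rfl

lemma toS_gaps_cons (n : ℕ) (a : Cyc) (L : List (ℕ × Cyc)) (σ : ℂ) :
    toS (gaps ((n, a) :: L)) σ = σ ^ n * (a.toC + σ * toS (gaps L) σ) := by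
  rw [gaps, toS_replicate_append, toS]

/-- The local parameter of index `m` on the imaginary axis. -/
def ep (m : ℕ) (T : ℝ) : ℂ := sg (I * T / m)

lemma ep_ne_zero (m : ℕ) (T : ℝ) : ep m T ≠ 0 := sg_ne_zero _

lemma tendsto_ep {m : ℕ} (hm : 0 < m) : Tendsto (ep m) atTop (𝓝 0) := by
  rw [tendsto_zero_iff_norm_tendsto_zero]
  have h : ∀ T : ℝ, ‖ep m T‖ = Real.exp (-(2 * Real.pi / (12 * m) * T)) := fun T => by
    have : (2 * Real.pi * I * (I * T / m) / 12 : ℂ) =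
        ((-(2 * Real.pi / (12 * m) * T) : ℝ) : ℂ) := by
      have hm' : (m : ℂ) ≠ 0 := by exact_mod_cast hm.ne'
      push_cast
      field_simp
      rw [I_sq]
      ring
    rw [ep, sg, this, ← Complex.ofReal_exp, Complex.norm_real,
      Real.norm_of_nonneg (Real.exp_pos _).le]
  simp only [h]
  exact Real.tendsto_exp_neg_atTop_nhds_zero.comp
    (tendsto_id.const_mul_atTop (by positivity : 0 < 2 * Real.pi / (12 * m)))

lemma sg_eq_ep {τ' : ℂ} {c j K m : ℕ} {T : ℝ} (hc : 0 < c) (hj : 0 < j) (hm : m = j * c)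
    (h : j * τ' = c * (I * T) + K) : sg τ' = ep m T ^ (c ^ 2) * sg (K / j) := by
  have hj' : (j : ℂ) ≠ 0 := by exact_mod_cast hj.ne'
  have hc' : (c : ℂ) ≠ 0 := by exact_mod_cast hc.ne'
  have h' : τ' = (c * (I * T) + K) / j := by rw [← h, mul_div_cancel_left₀ _ hj']
  rw [ep, sg, sg, sg, ← Complex.exp_nat_mul, ← Complex.exp_add, h', hm]
  congr 1
  push_cast
  field_simp

lemma Ap.expand {M : ℕ} {f : ℂ → ℂ} {l : List Cyc} (hA : Ap (M + 1) f l) {m : ℕ} (hm : 0 < m)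
    {n : ℕ} (hn : 0 < n) (u : ℂ) : ∃ R : ℝ → ℂ, Tendsto R atTop (𝓝 0) ∧
      ∀ T, f (ep m T ^ n * u) = toS l (ep m T ^ n * u) + ep m T ^ (n * M) * R T := by
  have hσ : Tendsto (fun T => ep m T ^ n * u) atTop (𝓝 0) := by
    simpa [hn.ne'] using ((tendsto_ep hm).pow n).mul_const u
  refine ⟨fun T => (f (ep m T ^ n * u) - toS l (ep m T ^ n * u)) / ep m T ^ (n * M), ?_,
    fun T => ?_⟩
  · have h1 := IsBigO.comp_tendsto hA hσ
    have h2 : (fun T => ((ep m T ^ (n * M))⁻¹ : ℂ)) =O[atTop] fun T => (ep m T ^ (n * M))⁻¹ :=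
      isBigO_refl _ _
    refine ((h1.mul h2).congr (fun T => ?_) fun T => ?_).trans_tendsto
      (g'' := fun T => ep m T ^ n * u ^ (M + 1)) ?_
    · simp only [Function.comp_apply, div_eq_mul_inv]
    · have := ep_ne_zero m T
      simp only [Function.comp_apply]
      field_simp
      ring
    · simpa [hn.ne'] using ((tendsto_ep hm).pow n).mul_const (u ^ (M + 1))
  · rw [mul_div_cancel₀ _ (pow_ne_zero _ (ep_ne_zero m T))]
    ring

lemma im_I_mul {T : ℝ} (hT : 0 < T) : 0 < (I * T : ℂ).im := by simpa using hT

/-- The expansion of the derivative of a directly rescaled theta function. -/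
lemma expand_direct {c j K m M : ℕ} (hc : 0 < c) (hj : 0 < j) (hj3 : j ≤ 3) (hm : m = j * c)
    (h6 : ¬ 6 ∣ m) (hM : M + 1 ≤ 40) {v : Fin 8 → ℤ} (hv : ∑ i, v i = 0) {l : List (ℕ × Cyc)}
    (hl : eqZ (blkT (dprodT (M + 1)) (M + 1) j (eZ c K) fun i => c * v i) (gaps l) = true) :
    ∃ R : ℝ → ℂ, Tendsto R atTop (𝓝 0) ∧ ∀ T : ℝ, 0 < T → ∀ τ' C : ℂ, C = c →
      j * τ' = c * (I * T) + K →
      (ep m T ^ c ^ 2 * sg (K / j)) ^ (6 * j - 12) *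
        fderiv ℂ (fun z => Theta τ' fun i => C * z i) (zPt (I * T)) (fun i => (v i : ℂ)) =
      Real.pi * I * Em m (I * T) * (-1) ^ (j * K) *
        (toS (gaps l) (ep m T ^ c ^ 2 * sg (K / j)) + ep m T ^ (c ^ 2 * M) * R T) := by
  obtain ⟨R, hR, h⟩ := (ap_blk (fun L hL => ap_dprodPhi hM hL) hj3 (eZ c K)
    (fun i => c * v i)).expand (m := m) (by rw [hm]; positivity) (n := c ^ 2) (by positivity)
    (sg (K / j))
  refine ⟨R, hR, fun T hT τ' C hC hτ' => ?_⟩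
  rw [← sg_eq_ep hc hj hm hτ', fderiv_direct (im_I_mul hT) hc hj hj3 hm h6 hC hτ' hv,
    sg_eq_ep hc hj hm hτ', h, toS_of_eqZ hl]

/-- The expansion of the value of a directly rescaled theta function. -/
lemma expand_value_direct {c j K m M : ℕ} (hc : 0 < c) (hj : 0 < j) (hj3 : j ≤ 3) (hm : m = j * c)
    (hM : M + 1 ≤ 40) {l : List (ℕ × Cyc)}
    (hl : eqZ (blkT (prodT (M + 1)) (M + 1) j (eZ c K) 0) (gaps l) = true) :
    ∃ R : ℝ → ℂ, Tendsto R atTop (𝓝 0) ∧ ∀ T : ℝ, 0 < T → ∀ τ' C : ℂ, C = c →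
      j * τ' = c * (I * T) + K →
      2 * (ep m T ^ c ^ 2 * sg (K / j)) ^ (6 * j - 12) *
        Theta τ' (fun i => C * zPt (I * T) i) =
      Em m (I * T) * (-1) ^ (j * K) *
        (toS (gaps l) (ep m T ^ c ^ 2 * sg (K / j)) + ep m T ^ (c ^ 2 * M) * R T) := by
  obtain ⟨R, hR, h⟩ := (ap_blk (fun L hL => ap_prodPhi hM hL) hj3 (eZ c K) 0).expand (m := m)
    (by rw [hm]; positivity) (n := c ^ 2) (by positivity) (sg (K / j))
  refine ⟨R, hR, fun T hT τ' C hC hτ' => ?_⟩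
  rw [← sg_eq_ep hc hj hm hτ', value_direct (im_I_mul hT) hc hj hj3 hm hC hτ',
    sg_eq_ep hc hj hm hτ', h, toS_of_eqZ hl]

/-- The expansion of the derivative of a reflected theta function. -/
lemma expand_reflect {K m M : ℕ} (hm4 : 4 ≤ m) (hm5 : m ≤ 5)
    (hM : M + 1 ≤ 40) {v : Fin 8 → ℤ} (hv : ∑ i, v i = 0) {l : List (ℕ × Cyc)}
    (hl : eqZ (blkT (dprodT (M + 1)) (M + 1) (6 - m) (fun i => -eZ 1 K i) fun i => -v i)
      (gaps l) = true) :
    ∃ R : ℝ → ℂ, Tendsto R atTop (𝓝 0) ∧ ∀ T : ℝ, 0 < T → ∀ τ' : ℂ, m * τ' = I * T + K →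
      (ep m T * sg (K / m)) ^ (12 * (m - 3)) *
        fderiv ℂ (Theta τ') (zPt (I * T)) (fun i => (v i : ℂ)) =
      Real.pi * I * Em m (I * T) * (-1) ^ (m * K) *
        (toS (gaps l) (ep m T * sg (K / m)) + ep m T ^ M * R T) := by
  obtain ⟨R, hR, h⟩ := (ap_blk (fun L hL => ap_dprodPhi hM hL) (j := 6 - m) (by omega)
    (fun i => -eZ 1 K i) (fun i => -v i)).expand (m := m) (by omega) (n := 1) one_pos
    (sg (K / m))
  refine ⟨R, hR, fun T hT τ' hτ' => ?_⟩
  have hs : sg τ' = ep m T * sg (K / m) := by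
    simpa using sg_eq_ep (c := 1) (j := m) (m := m) one_pos (by omega) (by simp)
      (by simpa using hτ')
  simp only [pow_one, one_mul] at h
  rw [← hs, fderiv_reflect (im_I_mul hT) hm4 hm5 hτ' hv, hs, h, toS_of_eqZ hl]

/-- The expansion of the value of a reflected theta function. -/
lemma expand_value_reflect {K m M : ℕ} (hm4 : 4 ≤ m) (hm6 : m ≤ 6)
    (hM : M + 1 ≤ 40) {l : List (ℕ × Cyc)}
    (hl : eqZ (blkT (prodT (M + 1)) (M + 1) (6 - m) (fun i => -eZ 1 K i) 0) (gaps l) = true) :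
    ∃ R : ℝ → ℂ, Tendsto R atTop (𝓝 0) ∧ ∀ T : ℝ, 0 < T → ∀ τ' : ℂ, m * τ' = I * T + K →
      2 * (ep m T * sg (K / m)) ^ (12 * (m - 3)) * Theta τ' (zPt (I * T)) =
      Em m (I * T) * (-1) ^ (m * K) *
        (toS (gaps l) (ep m T * sg (K / m)) + ep m T ^ M * R T) := by
  obtain ⟨R, hR, h⟩ := (ap_blk (fun L hL => ap_prodPhi hM hL) (j := 6 - m) (by omega)
    (fun i => -eZ 1 K i) 0).expand (m := m) (by omega) (n := 1) one_pos
    (sg (K / m))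
  refine ⟨R, hR, fun T hT τ' hτ' => ?_⟩
  have hs : sg τ' = ep m T * sg (K / m) := by
    simpa using sg_eq_ep (c := 1) (j := m) (m := m) one_pos (by omega) (by simp)
      (by simpa using hτ')
  simp only [pow_one, one_mul] at h
  rw [← hs, value_reflect (im_I_mul hT) hm4 hm6 hτ', hs, h, toS_of_eqZ hl]

/-- `f` equals `N` times `p` up to terms of order higher than `M` in the local parameter. -/
def Ex (m : ℕ) (N : ℝ → ℂ) (M : ℕ) (f : ℝ → ℂ) (p : ℂ → ℂ) : Prop :=
  ∃ R : ℝ → ℂ, Tendsto R atTop (𝓝 0) ∧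
    ∀ T : ℝ, 0 < T → f T = N T * (p (ep m T) + ep m T ^ M * R T)

namespace Ex

variable {m M : ℕ} {N f g : ℝ → ℂ} {p q : ℂ → ℂ}

lemma add (hf : Ex m N M f p) (hg : Ex m N M g q) :
    Ex m N M (fun T => f T + g T) (fun x => p x + q x) := by
  obtain ⟨R, hR, h⟩ := hf
  obtain ⟨S, hS, h'⟩ := hg
  exact ⟨fun T => R T + S T, by simpa using hR.add hS,
    fun T hT => by simp only [h T hT, h' T hT]; ring⟩

lemma const_mul (hf : Ex m N M f p) (c : ℂ) :
    Ex m N M (fun T => c * f T) (fun x => c * p x) := by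
  obtain ⟨R, hR, h⟩ := hf
  exact ⟨fun T => c * R T, by simpa using hR.const_mul c, fun T hT => by simp only [h T hT]; ring⟩

lemma tendsto_poly (hm : 0 < m) (hp : Continuous p) :
    Tendsto (fun T => p (ep m T)) atTop (𝓝 (p 0)) :=
  (hp.tendsto 0).comp (tendsto_ep hm)

lemma mul (hm : 0 < m) (hg : Ex m (fun _ => 1) M g q) (hf : Ex m N M f p) (hq : Continuous q)
    (hp : Continuous p) : Ex m N M (fun T => g T * f T) (fun x => q x * p x) := by
  obtain ⟨R, hR, h⟩ := hf
  obtain ⟨S, hS, h'⟩ := hg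
  refine ⟨fun T => q (ep m T) * R T + S T * p (ep m T) + ep m T ^ M * (S T * R T), ?_,
    fun T hT => by simp only [h T hT, h' T hT]; ring⟩
  simpa using (((tendsto_poly hm hq).mul hR).add (hS.mul (tendsto_poly hm hp))).add
    (((tendsto_ep hm).pow M).mul (hS.mul hR))

lemma congr_poly (hm : 0 < m) (hf : Ex m N M f p) (r : ℂ → ℂ) (hr : Continuous r)
    (h : ∀ x, p x = q x + x ^ (M + 1) * r x) : Ex m N M f q := by
  obtain ⟨R, hR, h'⟩ := hf
  refine ⟨fun T => R T + ep m T * r (ep m T), ?_, fun T hT => by simp only [h' T hT, h]; ring⟩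
  simpa using hR.add ((tendsto_ep hm).mul (tendsto_poly hm hr))

lemma congr (hf : Ex m N M f p) (hg : ∀ T, 0 < T → g T = f T) (h : ∀ x, p x = q x) :
    Ex m N M g q := by
  obtain ⟨R, hR, h'⟩ := hf
  exact ⟨R, hR, fun T hT => by rw [hg T hT, h' T hT, h]⟩

lemma mono (hm : 0 < m) {M' : ℕ} (hM : M' ≤ M) (hf : Ex m N M f p) : Ex m N M' f p := by
  obtain ⟨k, rfl⟩ := Nat.exists_eq_add_of_le hM
  obtain ⟨R, hR, h⟩ := hf
  refine ⟨fun T => ep m T ^ k * R T, ?_, fun T hT => by simp only [h T hT]; ring⟩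
  simpa using ((tendsto_ep hm).pow k).mul hR

lemma shift (k : ℕ) (hf : Ex m N M f p) :
    Ex m N (M + k) (fun T => ep m T ^ k * f T) (fun x => x ^ k * p x) := by
  obtain ⟨R, hR, h⟩ := hf
  exact ⟨R, hR, fun T hT => by simp only [h T hT]; ring⟩

lemma pow (hm : 0 < m) (hf : Ex m (fun _ => 1) M f p) (hp : Continuous p) (n : ℕ) :
    Ex m (fun _ => 1) M (fun T => f T ^ n) (fun x => p x ^ n) := by
  induction n with
  | zero => exact ⟨0, tendsto_const_nhds, by simp⟩
  | succ n ih => simpa only [pow_succ] using ih.mul hm hf (hp.pow n) hp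

/-- The leading coefficient. -/
lemma leading {c : ℂ} (hf : Ex m N M f fun x => c * x ^ M) :
    ∃ g : ℝ → ℂ, Tendsto g atTop (𝓝 c) ∧ ∀ T, 0 < T → f T = N T * ep m T ^ M * g T := by
  obtain ⟨R, hR, h⟩ := hf
  exact ⟨fun T => c + R T, by simpa using hR.const_add c, fun T hT => by simp only [h T hT]; ring⟩

end Ex

lemma Ap.ex {M : ℕ} {f : ℂ → ℂ} {l : List Cyc} (hA : Ap (M + 1) f l) {l' : List (ℕ × Cyc)}
    (hl : eqZ l (gaps l') = true) {m : ℕ} (hm : 0 < m) {n : ℕ} (hn : 0 < n) (u : ℂ) :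
    Ex m (fun _ => 1) (n * M) (fun T => f (ep m T ^ n * u)) fun x => toS (gaps l') (x ^ n * u) := by
  obtain ⟨R, hR, h⟩ := hA.expand hm hn u
  exact ⟨R, hR, fun T _ => by simp only [h, toS_of_eqZ hl, one_mul]⟩

/-- The normalizing factor of the derivatives of forms of index `m` at the special point. -/
def Nm (m : ℕ) (T : ℝ) : ℂ := Real.pi * I * Em m (I * T)

lemma Em_ne_zero (m : ℕ) (τ : ℂ) : Em m τ ≠ 0 := Complex.exp_ne_zero _

lemma Nm_ne_zero (m : ℕ) (T : ℝ) : Nm m T ≠ 0 := by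
  simp [Nm, Em_ne_zero, Real.pi_ne_zero]

/-- The derivative of a rescaled theta function at the special point. -/
def dTh (τ' C τ : ℂ) (v : Fin 8 → ℤ) : ℂ :=
  fderiv ℂ (fun z => Theta τ' fun i => C * z i) (zPt τ) fun i => (v i : ℂ)

lemma ex_direct {c j K m M : ℕ} (hc : 0 < c) (hj : 0 < j) (hj3 : j ≤ 3) (hm : m = j * c)
    (h6 : ¬ 6 ∣ m) (hM : M + 1 ≤ 40) {v : Fin 8 → ℤ} (hv : ∑ i, v i = 0) {l : List (ℕ × Cyc)}
    (hl : eqZ (blkT (dprodT (M + 1)) (M + 1) j (eZ c K) fun i => c * v i) (gaps l) = true)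
    {C : ℂ} (hC : C = c) {τ' : ℝ → ℂ} (hτ' : ∀ T : ℝ, j * τ' T = c * (I * T) + K) {W : ℂ}
    (hW : W * sg (K / j) ^ (6 * j - 12) = (-1) ^ (j * K)) :
    Ex m (Nm m) (c ^ 2 * M) (fun T => ep m T ^ (c ^ 2 * (6 * j - 12)) * dTh (τ' T) C (I * T) v)
      fun x => W * toS (gaps l) (x ^ c ^ 2 * sg (K / j)) := by
  obtain ⟨R, hR, h⟩ := expand_direct (K := K) hc hj hj3 hm h6 hM hv hl
  refine ⟨fun T => W * R T, by simpa using hR.const_mul W, fun T hT => ?_⟩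
  have h1 := h T hT (τ' T) C hC (hτ' T)
  have hu : sg (K / j) ^ (6 * j - 12) ≠ 0 := pow_ne_zero _ (sg_ne_zero _)
  rw [← hW, mul_pow, ← pow_mul] at h1
  refine mul_left_cancel₀ hu ?_
  simp only [dTh, Nm]
  linear_combination h1

lemma ex_value_direct {c j K m M : ℕ} (hc : 0 < c) (hj : 0 < j) (hj3 : j ≤ 3) (hm : m = j * c)
    (hM : M + 1 ≤ 40) {l : List (ℕ × Cyc)}
    (hl : eqZ (blkT (prodT (M + 1)) (M + 1) j (eZ c K) 0) (gaps l) = true)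
    {C : ℂ} (hC : C = c) {τ' : ℝ → ℂ} (hτ' : ∀ T : ℝ, j * τ' T = c * (I * T) + K) {W : ℂ}
    (hW : W * sg (K / j) ^ (6 * j - 12) = (-1) ^ (j * K)) :
    Ex m (fun T => Em m (I * T) / 2) (c ^ 2 * M)
      (fun T => ep m T ^ (c ^ 2 * (6 * j - 12)) * Theta (τ' T) fun i => C * zPt (I * T) i)
      fun x => W * toS (gaps l) (x ^ c ^ 2 * sg (K / j)) := by
  obtain ⟨R, hR, h⟩ := expand_value_direct (K := K) hc hj hj3 hm hM hl
  refine ⟨fun T => W * R T, by simpa using hR.const_mul W, fun T hT => ?_⟩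
  have h1 := h T hT (τ' T) C hC (hτ' T)
  have hu : sg (K / j) ^ (6 * j - 12) ≠ 0 := pow_ne_zero _ (sg_ne_zero _)
  rw [← hW, mul_pow, ← pow_mul] at h1
  refine mul_left_cancel₀ hu ?_
  linear_combination h1 / 2

lemma ex_reflect {K m M : ℕ} (hm4 : 4 ≤ m) (hm5 : m ≤ 5)
    (hM : M + 1 ≤ 40) {v : Fin 8 → ℤ} (hv : ∑ i, v i = 0) {l : List (ℕ × Cyc)}
    (hl : eqZ (blkT (dprodT (M + 1)) (M + 1) (6 - m) (fun i => -eZ 1 K i) fun i => -v i)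
      (gaps l) = true) {τ' : ℝ → ℂ} (hτ' : ∀ T : ℝ, m * τ' T = I * T + K) {W : ℂ}
    (hW : W * sg (K / m) ^ (12 * (m - 3)) = (-1) ^ (m * K)) :
    Ex m (Nm m) M (fun T => ep m T ^ (12 * (m - 3)) * dTh (τ' T) 1 (I * T) v)
      fun x => W * toS (gaps l) (x * sg (K / m)) := by
  obtain ⟨R, hR, h⟩ := expand_reflect (K := K) hm4 hm5 hM hv hl
  refine ⟨fun T => W * R T, by simpa using hR.const_mul W, fun T hT => ?_⟩
  have h1 := h T hT (τ' T) (hτ' T)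
  have hu : sg (K / m) ^ (12 * (m - 3)) ≠ 0 := pow_ne_zero _ (sg_ne_zero _)
  rw [← hW, mul_pow] at h1
  refine mul_left_cancel₀ hu ?_
  simp only [dTh, Nm, one_mul]
  linear_combination h1

lemma ex_value_reflect {K m M : ℕ} (hm4 : 4 ≤ m) (hm6 : m ≤ 6)
    (hM : M + 1 ≤ 40) {l : List (ℕ × Cyc)}
    (hl : eqZ (blkT (prodT (M + 1)) (M + 1) (6 - m) (fun i => -eZ 1 K i) 0) (gaps l) = true)
    {τ' : ℝ → ℂ} (hτ' : ∀ T : ℝ, m * τ' T = I * T + K) {W : ℂ}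
    (hW : W * sg (K / m) ^ (12 * (m - 3)) = (-1) ^ (m * K)) :
    Ex m (fun T => Em m (I * T) / 2) M
      (fun T => ep m T ^ (12 * (m - 3)) * Theta (τ' T) (zPt (I * T)))
      fun x => W * toS (gaps l) (x * sg (K / m)) := by
  obtain ⟨R, hR, h⟩ := expand_value_reflect (K := K) hm4 hm6 hM hl
  refine ⟨fun T => W * R T, by simpa using hR.const_mul W, fun T hT => ?_⟩
  have h1 := h T hT (τ' T) (hτ' T)
  have hu : sg (K / m) ^ (12 * (m - 3)) ≠ 0 := pow_ne_zero _ (sg_ne_zero _)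
  rw [← hW, mul_pow] at h1
  refine mul_left_cancel₀ hu ?_
  linear_combination h1 / 2

lemma sg_div_pow {K j n r : ℕ} (hj : 0 < j) (h : n * K = r * j) :
    sg (K / j) ^ n = z12 ^ r := by
  have hj' : (j : ℂ) ≠ 0 := by exact_mod_cast hj.ne'
  have h' : (n * K : ℂ) = r * j := by exact_mod_cast h
  rw [sg, z12, ← Complex.exp_nat_mul, ← Complex.exp_nat_mul]
  congr 1
  field_simp
  linear_combination h'

lemma hasFDerivAt_Theta_mul {τ' : ℂ} (hτ' : 0 < τ'.im) (C : ℂ) (z : Fin 8 → ℂ) :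
    HasFDerivAt (fun z => Theta τ' fun i => C * z i)
      (fderiv ℂ (fun z => Theta τ' fun i => C * z i) z) z := by
  have h : ContDiff ℂ 1 (fun z : Fin 8 → ℂ => Theta τ' fun i => C * z i) :=
    (contDiff_Theta τ' hτ').comp (by fun_prop)
  exact ((h.differentiable (by norm_num)) z).hasFDerivAt

/- Theta constants. -/

lemma th3_zero (τ : ℂ) : th3 0 τ = phi 0 0 (sg τ) := by
  rw [← jacobiTheta₂_twelfth (by norm_num), th3, jacobiTheta₂]
  refine tsum_congr fun n => ?_
  rw [jacobiTheta₂_term, ← Complex.exp_add, πC]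
  congr 1
  push_cast
  ring

lemma th4_zero (τ : ℂ) : th4 0 τ = phi 0 6 (sg τ) := by
  rw [← jacobiTheta₂_twelfth (by norm_num), th4, jacobiTheta₂]
  refine tsum_congr fun n => ?_
  rw [jacobiTheta₂_term, πC, ← Complex.exp_pi_mul_I, ← Complex.exp_int_mul, ← Complex.exp_add,
    ← Complex.exp_add]
  congr 1
  push_cast
  ring

lemma th2_zero (τ : ℂ) : th2 0 τ = exp (Real.pi * I * τ / 4) * phi (-3) 0 (sg τ) := by
  rw [← jacobiTheta₂_twelfth (by norm_num), th2, jacobiTheta₂, ← tsum_mul_left]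
  refine tsum_congr fun n => ?_
  rw [jacobiTheta₂_term, πC, ← Complex.exp_add, ← Complex.exp_add]
  congr 1
  push_cast
  ring

lemma th2_zero_pow_four (τ : ℂ) : th2 0 τ ^ 4 = sg τ ^ 6 * phi (-3) 0 (sg τ) ^ 4 := by
  rw [th2_zero, mul_pow, sg, ← Complex.exp_nat_mul, ← Complex.exp_nat_mul]
  congr 2
  push_cast
  ring

/-- The series of `h0` in the parameter of `2 τ`. -/
def hs (s : ℂ) : ℂ := phi 0 0 s * phi 0 0 (s ^ 3) + s ^ 6 * (phi (-3) 0 s * phi (-3) 0 (s ^ 3))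

lemma h0_eq (τ : ℂ) : h0 τ = hs (sg (2 * τ)) := by
  have h3 : sg (6 * τ) = sg (2 * τ) ^ 3 := by
    rw [sg, sg, ← Complex.exp_nat_mul]
    congr 1
    push_cast
    ring
  have h6 : exp (Real.pi * I * (2 * τ) / 4) * exp (Real.pi * I * (6 * τ) / 4) = sg (2 * τ) ^ 6 := by
    rw [sg, ← Complex.exp_nat_mul, ← Complex.exp_add]
    congr 1
    push_cast
    ring
  rw [h0, hs, th3_zero, th3_zero, th2_zero, th2_zero, h3, ← h6]
  ring

lemma ex_phi {M : ℕ} (hM : M + 1 ≤ 40) {j e : ℤ} (hj : |j| ≤ 3) {l : List (ℕ × Cyc)}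
    (hl : eqZ (prodT (M + 1) [(j, e, 0)]) (gaps l) = true) {m : ℕ} (hm : 0 < m) {n : ℕ}
    (hn : 0 < n) (u : ℂ) : Ex m (fun _ => 1) (n * M) (fun T => phi j e (ep m T ^ n * u))
      fun x => toS (gaps l) (x ^ n * u) := by
  have h := (ap_prodPhi (M := M + 1) hM (L := [(j, e, 0)]) (by simpa using hj)).ex hl hm hn u
  exact h.congr (fun T _ => by simp [prodPhi]) fun _ => rfl

lemma continuous_toS_gaps (l : List (ℕ × Cyc)) (n : ℕ) (u : ℂ) :
    Continuous fun x : ℂ => toS (gaps l) (x ^ n * u) :=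
  (continuous_toS _).comp (by fun_prop)

/-- The expansion of `h0 ^ 2` to second order. -/
lemma ex_hs_sq {m : ℕ} (hm : 0 < m) {n : ℕ} (hn : 0 < n) (u : ℂ) :
    Ex m (fun _ => 1) (n * 12) (fun T => hs (ep m T ^ n * u) ^ 2)
      fun x => 1 + 12 * (x ^ n * u) ^ 6 + 36 * (x ^ n * u) ^ 12 := by
  have e1 := (ex_phi (M := 12) (j := 0) (e := 0) (by norm_num) (by norm_num)
    (l := [(0, (1, 0, 0, 0)), (5, (2, 0, 0, 0))]) (by decide +kernel) hm hn u)
  have e2 := (ex_phi (M := 4) (j := 0) (e := 0) (by norm_num) (by norm_num)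
    (l := [(0, (1, 0, 0, 0))]) (by decide +kernel) hm (n := n * 3) (by omega) (u ^ 3)).mono
    hm (M' := n * 12) (by omega)
  have e3 := (ex_phi (M := 6) (j := -3) (e := 0) (by norm_num) (by norm_num)
    (l := [(0, (2, 0, 0, 0))]) (by decide +kernel) hm hn u)
  have e4 := (ex_phi (M := 2) (j := -3) (e := 0) (by norm_num) (by norm_num)
    (l := [(0, (2, 0, 0, 0))]) (by decide +kernel) hm (n := n * 3) (by omega) (u ^ 3)).mono
    hm (M' := n * 6) (by omega)
  have e5 := e1.mul hm e2 (continuous_toS_gaps _ _ _) (continuous_toS_gaps _ _ _)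
  have e6 := (((e3.mul hm e4 (continuous_toS_gaps _ _ _) (continuous_toS_gaps _ _ _)).shift
    (n * 6)).const_mul (u ^ 6)).mono hm (M' := n * 12) (by omega)
  have e7 := e5.add e6
  have e8 : Ex m (fun _ => 1) (n * 12) (fun T => hs (ep m T ^ n * u))
      fun x => 1 + 6 * (x ^ n * u) ^ 6 := by
    refine e7.congr (fun T _ => ?_) fun x => ?_
    · have : (ep m T ^ n * u) ^ 3 = ep m T ^ (n * 3) * u ^ 3 := by ring
      rw [hs, this]
      ring
    · simp only [toS_gaps_cons, toS_gaps_nil, Cyc.toC]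
      push_cast
      ring
  exact (e8.pow hm (by fun_prop) 2).congr (fun _ _ => rfl) fun x => by ring

lemma Ex.eventually_ne_zero {m M : ℕ} {N f : ℝ → ℂ} {c : ℂ} (hf : Ex m N M f fun x => c * x ^ M)
    (hN : ∀ T, N T ≠ 0) (hc : c ≠ 0) : ∀ᶠ T in atTop, f T ≠ 0 := by
  obtain ⟨g, hg, h⟩ := hf.leading
  filter_upwards [hg.eventually_ne hc, eventually_gt_atTop 0] with T hT hT0
  rw [h T hT0]
  exact mul_ne_zero (mul_ne_zero (hN T) (pow_ne_zero _ (ep_ne_zero m T))) hT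

lemma Ex.eventually_det_ne {m p q p' q' : ℕ} {N f g f' g' : ℝ → ℂ} {a b a' b' : ℂ}
    (hf : Ex m N p f fun x => a * x ^ p) (hg : Ex m N q g fun x => b * x ^ q)
    (hf' : Ex m N p' f' fun x => a' * x ^ p') (hg' : Ex m N q' g' fun x => b' * x ^ q')
    (hN : ∀ T, N T ≠ 0) (hpq : p + q = p' + q') (hab : a * b ≠ a' * b') :
    ∀ᶠ T in atTop, f T * g T ≠ f' T * g' T := by
  obtain ⟨r, hr, h⟩ := hf.leading
  obtain ⟨s, hs, k⟩ := hg.leading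
  obtain ⟨r', hr', h'⟩ := hf'.leading
  obtain ⟨s', hs', k'⟩ := hg'.leading
  filter_upwards [((hr.mul hs).sub (hr'.mul hs')).eventually_ne (sub_ne_zero.2 hab),
    eventually_gt_atTop 0] with T hT hT0
  rw [h T hT0, k T hT0, h' T hT0, k' T hT0, ← sub_ne_zero]
  have hp : ep m T ^ p' * ep m T ^ q' = ep m T ^ p * ep m T ^ q := by
    rw [← pow_add, ← pow_add, hpq]
  have he : N T * N T * (ep m T ^ p * ep m T ^ q) ≠ 0 :=
    mul_ne_zero (mul_ne_zero (hN T) (hN T))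
      (mul_ne_zero (pow_ne_zero _ (ep_ne_zero m T)) (pow_ne_zero _ (ep_ne_zero m T)))
  have := mul_ne_zero he hT
  intro h0
  apply this
  linear_combination h0 + N T * N T * (r' T * s' T) * hp

lemma Ex.mul_leading {m a b : ℕ} {N g f : ℝ → ℂ} {c d : ℂ}
    (hg : Ex m (fun _ => 1) a g fun x => c * x ^ a) (hf : Ex m N b f fun x => d * x ^ b) :
    Ex m N (a + b) (fun T => g T * f T) fun x => c * d * x ^ (a + b) := by
  obtain ⟨r, hr, h⟩ := hg.leading
  obtain ⟨s, hs, k⟩ := hf.leading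
  refine ⟨fun T => r T * s T - c * d, by simpa using (hr.mul hs).sub_const (c * d),
    fun T hT => ?_⟩
  simp only [h T hT, k T hT]
  ring

/-- The derivative of a linear combination of rescaled theta functions. -/
lemma fderiv_eq_sum {τ : ℂ} {F : (Fin 8 → ℂ) → ℂ} {n : ℕ} (a t C : Fin n → ℂ)
    (ht : ∀ k, 0 < (t k).im) (hF : ∀ z, F z = ∑ k, a k * Theta (t k) fun i => C k * z i)
    (v : Fin 8 → ℤ) :
    fderiv ℂ F (zPt τ) (fun i => (v i : ℂ)) = ∑ k, a k * dTh (t k) (C k) τ v := by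
  have h := HasFDerivAt.fun_sum (u := Finset.univ) fun k (_ : k ∈ Finset.univ) =>
    (hasFDerivAt_Theta_mul (ht k) (C k) (zPt τ)).const_mul (a k)
  rw [funext hF, h.fderiv]
  simp [dTh]

/-- A direction in the special fibre. -/
def vEta : Fin 8 → ℤ := ![0, 0, 1, -1, 0, 0, 0, 0]

/-- A direction in the special fibre. -/
def vE : Fin 8 → ℤ := ![0, 1, -1, 0, 0, 0, 0, 0]

/-- A direction in the special fibre. -/
def vK : Fin 8 → ℤ := ![1, -1, 0, 0, 0, 0, 0, 0]

lemma sum_vEta : ∑ i, vEta i = 0 := by decide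
lemma sum_vE : ∑ i, vE i = 0 := by decide
lemma sum_vK : ∑ i, vK i = 0 := by decide

lemma nondegenerate_idx_one :
    ∀ᶠ T : ℝ in atTop, ∃ u, fderiv ℂ (nineForms 0 (I * T)) (zPt (I * T)) u ≠ 0 := by
  have h := ex_direct (c := 1) (j := 1) (K := 0) (m := 1) (M := 4) (by norm_num) (by norm_num)
    (by norm_num) (by norm_num) (by norm_num) (by norm_num) sum_vEta (l := [(4, (0, 2, 0, 0))])
    (by decide +kernel) (C := 1) (by simp) (τ' := fun T => I * T) (by simp) (W := 1) (by simp)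
  have h' : Ex 1 (Nm 1) 4 (fun T => dTh (I * T) 1 (I * T) vEta) fun x => 2 * z12 * x ^ 4 := by
    refine h.congr (fun T _ => by simp) fun x => ?_
    simp [toS_gaps_cons, toS_gaps_nil, Cyc.toC, sg]
    ring
  filter_upwards [h'.eventually_ne_zero (Nm_ne_zero 1) (by simp [z12_ne_zero])] with T hT
  refine ⟨fun i => (vEta i : ℂ), ?_⟩
  simp only [dTh, one_mul] at hT
  exact hT

lemma im_div {m : ℕ} (hm : 0 < m) {T : ℝ} (hT : 0 < T) (k : ℂ) (hk : k.im = 0) :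
    0 < ((I * T + k) / m).im := by
  have : ((I * T + k) / m : ℂ).im = T / m := by simp [Complex.div_natCast_im, hk]
  rw [this]
  positivity

lemma z12_poly_ne_zero : (2 - z12 ^ 2) ≠ 0 := fun h => by
  have h4 := z12_pow_four
  have : (3 : ℂ) = 0 := by linear_combination (1 + z12 ^ 2) * h + h4
  norm_num at this

lemma one_add_z12_sq_ne_zero : (1 + z12 ^ 2) ≠ 0 := fun h => by
  have h4 := z12_pow_four
  have : (3 : ℂ) = 0 := by linear_combination (2 - z12 ^ 2) * h + h4
  norm_num at this

/-- The expansions of the theta functions entering the forms of index two. -/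
lemma ex_half {M : ℕ} (hM : M + 1 ≤ 40) (k : ℕ) {v : Fin 8 → ℤ} (hv : ∑ i, v i = 0)
    {l : List (ℕ × Cyc)}
    (hl : eqZ (blkT (dprodT (M + 1)) (M + 1) 2 (eZ (1 : ℕ) k) fun i => (1 : ℕ) * v i)
      (gaps l) = true) :
    Ex 2 (Nm 2) M (fun T => dTh ((I * T + k) / 2) 1 (I * T) v)
      fun x => toS (gaps l) (x * sg (k / 2)) := by
  have h := ex_direct (c := 1) (j := 2) (K := k) (m := 2) (M := M) (by norm_num) (by norm_num)
    (by norm_num) (by norm_num) (by norm_num) hM hv (l := l)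
    hl (C := 1) (by simp) (τ' := fun T => (I * T + k) / 2) (fun T => by push_cast; ring) (W := 1)
    (by simp [pow_mul])
  simpa using h

lemma sg_eq_ep_two (T : ℝ) : sg (I * T) = ep 2 T ^ 2 * 1 := by
  rw [ep, sg, sg, ← Complex.exp_nat_mul, mul_one]
  congr 1
  push_cast
  ring

lemma ex_th3 : Ex 2 (fun _ => 1) 12 (fun T => th3 0 (I * T)) fun x => 1 + 2 * x ^ 12 := by
  refine (ex_phi (M := 6) (j := 0) (e := 0) (by norm_num) (by norm_num)
    (l := [(0, (1, 0, 0, 0)), (5, (2, 0, 0, 0))]) (by decide +kernel) (m := 2) (by norm_num)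
    (n := 2) (by norm_num) 1).congr (fun T _ => by rw [th3_zero, sg_eq_ep_two]) fun x => ?_
  simp [toS_gaps_cons, toS_gaps_nil, Cyc.toC]
  ring

lemma ex_th4 : Ex 2 (fun _ => 1) 12 (fun T => th4 0 (I * T)) fun x => 1 - 2 * x ^ 12 := by
  refine (ex_phi (M := 6) (j := 0) (e := 6) (by norm_num) (by norm_num)
    (l := [(0, (1, 0, 0, 0)), (5, (-2, 0, 0, 0))]) (by decide +kernel) (m := 2) (by norm_num)
    (n := 2) (by norm_num) 1).congr (fun T _ => by rw [th4_zero, sg_eq_ep_two]) fun x => ?_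
  simp [toS_gaps_cons, toS_gaps_nil, Cyc.toC]
  ring

lemma ex_th2 : Ex 2 (fun _ => 1) 12 (fun T => th2 0 (I * T) ^ 4) fun x => 16 * x ^ 12 := by
  have h := ((ex_phi (M := 0) (j := -3) (e := 0) (by norm_num) (by norm_num)
    (l := [(0, (2, 0, 0, 0))]) (by decide +kernel) (m := 2) (by norm_num)
    (n := 2) (by norm_num) 1).pow (by norm_num) (continuous_toS_gaps _ _ _) 4).shift 12
  refine h.congr (fun T _ => ?_) fun x => ?_
  · rw [th2_zero_pow_four, sg_eq_ep_two]
    ring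
  · simp [toS_gaps_cons, toS_gaps_nil, Cyc.toC]
    ring

lemma ex_ee1 : Ex 2 (fun _ => 1) 0 (fun T => ee1 (I * T)) fun _ => 1 / 6 := by
  have h3 := (ex_th3.pow two_pos (by fun_prop) 4).mono two_pos (M' := 0) (by norm_num)
  have h4 := (ex_th4.pow two_pos (by fun_prop) 4).mono two_pos (M' := 0) (by norm_num)
  refine Ex.congr_poly two_pos (((h3.add h4).const_mul (1 / 12)).congr
    (g := fun T => ee1 (I * T)) (fun T _ => ?_) fun _ => rfl)
    (fun x => 4 * x ^ 23 + 8 / 3 * x ^ 47) (by fun_prop) fun x => ?_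
  · rw [ee1]
    ring
  · ring

lemma ex_ee_sub : Ex 2 (fun _ => 1) 12 (fun T => ee3 (I * T) - ee2 (I * T))
    fun x => -4 * x ^ 12 := by
  have h3 := ex_th3.pow two_pos (by fun_prop) 4
  have h4 := ex_th4.pow two_pos (by fun_prop) 4
  refine Ex.congr_poly two_pos ((((ex_th2.const_mul (-1 / 6)).add (h3.const_mul (-1 / 12))).add
    (h4.const_mul (1 / 12))).congr (g := fun T => ee3 (I * T) - ee2 (I * T))
    (fun T _ => ?_) fun _ => rfl)
    (fun x => -(16 / 3) * x ^ 23) (by fun_prop) fun x => ?_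
  · rw [ee2, ee3]
    ring
  · ring

lemma fderiv_A2 {T : ℝ} (hT : 0 < T) (v : Fin 8 → ℤ) :
    fderiv ℂ (nineForms 1 (I * T)) (zPt (I * T)) (fun i => (v i : ℂ)) =
      8 / 9 * (dTh (2 * (I * T)) 2 (I * T) v + 1 / 16 *
        (dTh ((I * T + 0) / 2) 1 (I * T) v + dTh ((I * T + 1) / 2) 1 (I * T) v)) := by
  rw [fderiv_eq_sum ![8 / 9, 1 / 18, 1 / 18] ![2 * (I * T), (I * T + 0) / 2, (I * T + 1) / 2]
    ![2, 1, 1]]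
  · simp [Fin.sum_univ_three]
    ring
  · intro k
    fin_cases k
    · simpa using hT
    · simpa using im_div (m := 2) (by norm_num) hT 0 (by simp)
    · simpa using im_div (m := 2) (by norm_num) hT 1 (by simp)
  · intro z
    simp [nineForms, A2, AM, Finset.sum_range_succ, Fin.sum_univ_three]
    ring

lemma fderiv_B2 {T : ℝ} (hT : 0 < T) (v : Fin 8 → ℤ) :
    fderiv ℂ (nineForms 5 (I * T)) (zPt (I * T)) (fun i => (v i : ℂ)) =
      32 / 5 * (ee1 (I * T) * dTh (2 * (I * T)) 2 (I * T) v + 1 / 16 *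
        (ee3 (I * T) * dTh ((I * T + 0) / 2) 1 (I * T) v +
          ee2 (I * T) * dTh ((I * T + 1) / 2) 1 (I * T) v)) := by
  rw [fderiv_eq_sum ![32 / 5 * ee1 (I * T), 2 / 5 * ee3 (I * T), 2 / 5 * ee2 (I * T)]
    ![2 * (I * T), (I * T + 0) / 2, (I * T + 1) / 2] ![2, 1, 1]]
  · simp [Fin.sum_univ_three]
    ring
  · intro k
    fin_cases k
    · simpa using hT
    · simpa using im_div (m := 2) (by norm_num) hT 0 (by simp)
    · simpa using im_div (m := 2) (by norm_num) hT 1 (by simp)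
  · intro z
    simp [nineForms, B2, Fin.sum_univ_three]
    ring

lemma ee_sum (τ : ℂ) : ee1 τ + ee2 τ + ee3 τ = 0 := by
  rw [ee1, ee2, ee3]
  ring

lemma nondegenerate_idx_two : ∀ᶠ T : ℝ in atTop, ∃ u v,
    fderiv ℂ (nineForms 1 (I * T)) (zPt (I * T)) u *
      fderiv ℂ (nineForms 5 (I * T)) (zPt (I * T)) v ≠
    fderiv ℂ (nineForms 1 (I * T)) (zPt (I * T)) v *
      fderiv ℂ (nineForms 5 (I * T)) (zPt (I * T)) u := by
  have hu0 : sg ((0 : ℕ) / 2) ^ 4 = 1 := by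
    simpa using sg_div_pow (K := 0) (j := 2) (n := 4) (r := 0)
  have hu1 : sg ((1 : ℕ) / 2) ^ 4 = z12 ^ 2 := by
    simpa using sg_div_pow (K := 1) (j := 2) (n := 4) (r := 2)
  have he0 := ex_half (M := 0) (by norm_num) 0 sum_vE (l := [(0, (-2, 0, 2, 0))])
    (by decide +kernel)
  have he1 := ex_half (M := 0) (by norm_num) 1 sum_vE (l := [(0, (-2, 0, 2, 0))])
    (by decide +kernel)
  have hη0 : Ex 2 (Nm 2) 4 (fun T => dTh ((I * T + 0) / 2) 1 (I * T) vEta)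
      fun x => (4 - 2 * z12 ^ 2) * x ^ 4 := by
    refine (ex_half (M := 4) (by norm_num) 0 sum_vEta (l := [(4, (4, 0, -2, 0))])
      (by decide +kernel)).congr (fun T _ => by simp) fun x => ?_
    simp only [toS_gaps_cons, toS_gaps_nil, Cyc.toC, mul_pow, hu0]
    push_cast
    ring
  have hη1 : Ex 2 (Nm 2) 4 (fun T => dTh ((I * T + 1) / 2) 1 (I * T) vEta)
      fun x => (-4 + 2 * z12 ^ 2) * x ^ 4 := by
    refine (ex_half (M := 4) (by norm_num) 1 sum_vEta (l := [(4, (-2, 0, 4, 0))])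
      (by decide +kernel)).congr (fun T _ => by simp) fun x => ?_
    simp only [toS_gaps_cons, toS_gaps_nil, Cyc.toC, mul_pow, hu1]
    push_cast
    linear_combination (4 * x ^ 4) * z12_pow_four
  have hD : ∀ M, M + 1 ≤ 40 → ∀ v : Fin 8 → ℤ, ∑ i, v i = 0 → ∀ l,
      eqZ (blkT (dprodT (M + 1)) (M + 1) 1 (eZ (2 : ℕ) (0 : ℕ)) fun i => (2 : ℕ) * v i)
        (gaps l) = true → Ex 2 (Nm 2) (4 * M) (fun T => dTh (2 * (I * T)) 2 (I * T) v)
          fun x => toS (gaps l) (x ^ 4) := fun M hM v hv l hl => by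
    refine (ex_direct (c := 2) (j := 1) (K := 0) (m := 2) (by norm_num) (by norm_num)
      (by norm_num) (by norm_num) (by norm_num) hM hv hl (C := 2) (by simp)
      (τ' := fun T => 2 * (I * T)) (by simp) (W := 1) (by simp)).congr (fun T _ => by simp)
      fun x => by simp [sg]
  have hDη : Ex 2 (Nm 2) 16 (fun T => dTh (2 * (I * T)) 2 (I * T) vEta)
      fun x => (-8 + 4 * z12 ^ 2) * x ^ 16 := by
    refine (hD 4 (by norm_num) vEta sum_vEta [(4, (-8, 0, 4, 0))] (by decide +kernel)).congr
      (fun _ _ => rfl) fun x => ?_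
    simp only [toS_gaps_cons, toS_gaps_nil, Cyc.toC]
    push_cast
    ring
  have hDe : Ex 2 (Nm 2) 12 (fun T => dTh (2 * (I * T)) 2 (I * T) vE) fun _ => 0 :=
    (hD 3 (by norm_num) vE sum_vE [] (by decide +kernel)).congr (fun _ _ => rfl) fun x => rfl
  have hAe : Ex 2 (Nm 2) 0 (fun T => fderiv ℂ (nineForms 1 (I * T)) (zPt (I * T))
      (fun i => (vE i : ℂ))) fun x => (2 / 9 * (z12 ^ 2 - 1)) * x ^ 0 := by
    refine (((hDe.mono two_pos (M' := 0) (by norm_num)).add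
      ((he0.add he1).const_mul (1 / 16))).const_mul (8 / 9)).congr
      (fun T hT => by simp [fderiv_A2 hT]) fun x => ?_
    simp [toS_gaps_cons, toS_gaps_nil, Cyc.toC]
    ring
  have hAη : Ex 2 (Nm 2) 4 (fun T => fderiv ℂ (nineForms 1 (I * T)) (zPt (I * T))
      (fun i => (vEta i : ℂ))) fun x => 0 * x ^ 4 := by
    refine Ex.congr_poly two_pos ((((hDη.mono two_pos (M' := 4) (by norm_num)).add
      ((hη0.add hη1).const_mul (1 / 16))).const_mul (8 / 9)).congr
      (fun T hT => by simp [fderiv_A2 hT]) fun _ => rfl)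
      (fun x => 8 / 9 * (-8 + 4 * z12 ^ 2) * x ^ 11) (by fun_prop) fun x => ?_
    ring
  have hB : ∀ T : ℝ, 0 < T → ∀ v : Fin 8 → ℤ,
      5 / 32 * fderiv ℂ (nineForms 5 (I * T)) (zPt (I * T)) (fun i => (v i : ℂ)) +
        9 / 16 * ee1 (I * T) * fderiv ℂ (nineForms 1 (I * T)) (zPt (I * T)) (fun i => (v i : ℂ)) =
      3 / 2 * (ee1 (I * T) * dTh (2 * (I * T)) 2 (I * T) v) +
        1 / 32 * ((ee3 (I * T) - ee2 (I * T)) * (dTh ((I * T + 0) / 2) 1 (I * T) v +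
          -1 * dTh ((I * T + 1) / 2) 1 (I * T) v)) := fun T hT v => by
    rw [fderiv_A2 hT, fderiv_B2 hT]
    linear_combination 1 / 32 * (dTh ((I * T + 0) / 2) 1 (I * T) v +
      dTh ((I * T + 1) / 2) 1 (I * T) v) * ee_sum (I * T)
  have hee : Ex 2 (fun _ => 1) 0 (fun T => ee1 (I * T)) fun x => 1 / 6 * x ^ 0 :=
    ex_ee1.congr (fun _ _ => rfl) fun x => by simp
  have hBη := (((hee.mul_leading hDη).const_mul (3 / 2)).add
    ((ex_ee_sub.mul_leading ((hη0.add (hη1.const_mul (-1))).congr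
      (q := fun x => (8 - 4 * z12 ^ 2) * x ^ 4) (fun _ _ => rfl) fun x => by ring)).const_mul
        (1 / 32))).congr (q := fun x => (-3 / 2 * (2 - z12 ^ 2)) * x ^ 16)
    (fun T hT => hB T hT vEta) fun x => by ring
  have hBe := (((hee.mul_leading (hDe.congr (q := fun x => 0 * x ^ 12) (fun _ _ => rfl)
      fun x => by simp)).const_mul (3 / 2)).add
    ((ex_ee_sub.mul_leading ((he0.add (he1.const_mul (-1))).congr
      (q := fun x => 0 * x ^ 0) (fun _ _ => rfl) fun x => by
        simp [toS_gaps_cons, toS_gaps_nil, Cyc.toC])).const_mul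
        (1 / 32))).congr (q := fun x => 0 * x ^ 12)
    (fun T hT => by simpa using hB T hT vE) fun x => by ring
  have hz : z12 ^ 2 - 1 ≠ 0 := by
    rw [← z12_pow_four]
    exact pow_ne_zero _ z12_ne_zero
  filter_upwards [hAe.eventually_det_ne hBη hAη hBe (Nm_ne_zero 2) (by norm_num)
    (by simp [hz, z12_poly_ne_zero])] with T hT
  refine ⟨fun i => (vE i : ℂ), fun i => (vEta i : ℂ), fun h => hT ?_⟩
  linear_combination 5 / 32 * h

lemma Ex.const (m M : ℕ) (c : ℂ) : Ex m (fun _ => 1) M (fun _ => c) fun _ => c :=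
  ⟨0, tendsto_const_nhds, by simp⟩

lemma ep_mul_sg {m : ℕ} (hm : 0 < m) (n : ℕ) (k : ℂ) (T : ℝ) :
    ep m T ^ n * sg (k / m) ^ n = sg (n * ((I * T + k) / m)) := by
  have : (m : ℂ) ≠ 0 := by exact_mod_cast hm.ne'
  rw [ep, sg, sg, sg, ← mul_pow, ← Complex.exp_add, ← Complex.exp_nat_mul]
  congr 1
  field_simp

lemma sg_zero : sg 0 = 1 := by simp [sg]

lemma ex_third {M : ℕ} (hM : M + 1 ≤ 40) (k : ℕ) {v : Fin 8 → ℤ} (hv : ∑ i, v i = 0)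
    {l : List (ℕ × Cyc)}
    (hl : eqZ (blkT (dprodT (M + 1)) (M + 1) 3 (eZ (1 : ℕ) k) fun i => (1 : ℕ) * v i)
      (gaps l) = true) :
    Ex 3 (Nm 3) M (fun T => ep 3 T ^ 6 * dTh ((I * T + k) / 3) 1 (I * T) v)
      fun x => z12 ^ (4 * k) * toS (gaps l) (x * sg (k / 3)) := by
  have hu : sg ((k : ℕ) / (3 : ℕ)) ^ 6 = z12 ^ (2 * k) := sg_div_pow (by norm_num) (by ring)
  have h := ex_direct (c := 1) (j := 3) (K := k) (m := 3) (M := M) (by norm_num) (by norm_num)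
    (by norm_num) (by norm_num) (by norm_num) hM hv (l := l)
    hl (C := 1) (by simp) (τ' := fun T => (I * T + k) / 3) (fun T => by push_cast; ring)
    (W := z12 ^ (4 * k)) (by
      rw [show 6 * 3 - 12 = 6 from rfl, hu, ← pow_add, pow_mul (-1 : ℂ) 3,
        show (-1 : ℂ) ^ 3 = -1 by norm_num, ← z12_pow_six, ← pow_mul]
      ring_nf)
  simpa using h

lemma ex_h0_third (k : ℕ) : Ex 3 (fun _ => 1) 24 (fun T => h0 ((I * T + k) / 3) ^ 2 + -1)
    fun x => 12 * z12 ^ (4 * k) * x ^ 12 + 36 * z12 ^ (8 * k) * x ^ 24 := by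
  have h12 : sg ((k : ℕ) / (3 : ℕ)) ^ 12 = z12 ^ (4 * k) := sg_div_pow (by norm_num) (by ring)
  refine ((ex_hs_sq (m := 3) (by norm_num) two_pos (sg ((k : ℕ) / (3 : ℕ)) ^ 2)).add
    (Ex.const 3 24 (-1))).congr (fun T _ => ?_) fun x => ?_
  · rw [ep_mul_sg (by norm_num), h0_eq]
    norm_num
  · have h6 : (x ^ 2 * sg ((k : ℕ) / (3 : ℕ)) ^ 2) ^ 6 = x ^ 12 * z12 ^ (4 * k) := by
      rw [← h12]
      ring
    rw [show (12 : ℕ) = 6 * 2 from rfl, pow_mul (x ^ 2 * _), h6]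
    ring

lemma fderiv_A3 {T : ℝ} (hT : 0 < T) (v : Fin 8 → ℤ) :
    fderiv ℂ (nineForms 2 (I * T)) (zPt (I * T)) (fun i => (v i : ℂ)) =
      27 / 28 * (dTh (3 * (I * T)) 3 (I * T) v +
        1 / 81 * ∑ k ∈ range 3, dTh ((I * T + k) / 3) 1 (I * T) v) := by
  rw [fderiv_eq_sum ![27 / 28, 1 / 84, 1 / 84, 1 / 84]
    ![3 * (I * T), (I * T + 0) / 3, (I * T + 1) / 3, (I * T + 2) / 3] ![3, 1, 1, 1]]
  · simp [Fin.sum_univ_four, sum_range_succ]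
    ring
  · intro k
    fin_cases k
    · simpa using hT
    · simpa using im_div (m := 3) (by norm_num) hT 0 (by simp)
    · simpa using im_div (m := 3) (by norm_num) hT 1 (by simp)
    · simpa using im_div (m := 3) (by norm_num) hT 2 (by simp)
  · intro z
    simp [nineForms, A3, AM, Finset.sum_range_succ, Fin.sum_univ_four]
    ring

lemma fderiv_B3 {T : ℝ} (hT : 0 < T) (v : Fin 8 → ℤ) :
    fderiv ℂ (nineForms 6 (I * T)) (zPt (I * T)) (fun i => (v i : ℂ)) =
      81 / 80 * (h0 (I * T) ^ 2 * dTh (3 * (I * T)) 3 (I * T) v -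
        1 / 243 * ∑ k ∈ range 3,
          h0 ((I * T + k) / 3) ^ 2 * dTh ((I * T + k) / 3) 1 (I * T) v) := by
  rw [fderiv_eq_sum ![81 / 80 * h0 (I * T) ^ 2, -1 / 240 * h0 ((I * T + 0) / 3) ^ 2,
    -1 / 240 * h0 ((I * T + 1) / 3) ^ 2, -1 / 240 * h0 ((I * T + 2) / 3) ^ 2]
    ![3 * (I * T), (I * T + 0) / 3, (I * T + 1) / 3, (I * T + 2) / 3] ![3, 1, 1, 1]]
  · simp [Fin.sum_univ_four, sum_range_succ]
    ring
  · intro k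
    fin_cases k
    · simpa using hT
    · simpa using im_div (m := 3) (by norm_num) hT 0 (by simp)
    · simpa using im_div (m := 3) (by norm_num) hT 1 (by simp)
    · simpa using im_div (m := 3) (by norm_num) hT 2 (by simp)
  · intro z
    simp [nineForms, B3, Finset.sum_range_succ, Fin.sum_univ_four]
    ring

lemma nondegenerate_idx_three : ∀ᶠ T : ℝ in atTop, ∃ u v,
    fderiv ℂ (nineForms 2 (I * T)) (zPt (I * T)) u *
      fderiv ℂ (nineForms 6 (I * T)) (zPt (I * T)) v ≠
    fderiv ℂ (nineForms 2 (I * T)) (zPt (I * T)) v *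
      fderiv ℂ (nineForms 6 (I * T)) (zPt (I * T)) u := by
  have h3 : 0 < 3 := by norm_num
  have e4 := z12_pow_four
  have e8 : z12 ^ 8 = -z12 ^ 2 := by linear_combination z12 ^ 2 * z12_pow_six
  have e12 : z12 ^ 12 = 1 := by linear_combination (z12 ^ 6 - 1) * z12_pow_six
  have e16 : z12 ^ 16 = z12 ^ 2 - 1 := by linear_combination z12 ^ 4 * e12 + e4
  have e24 : z12 ^ 24 = 1 := by linear_combination (z12 ^ 12 + 1) * e12
  have hlead : ∀ k : ℕ, Ex 3 (fun _ => 1) 12 (fun T => h0 ((I * T + k) / 3) ^ 2 + -1)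
      fun x => 12 * z12 ^ (4 * k) * x ^ 12 := fun k =>
    Ex.congr_poly h3 ((ex_h0_third k).mono h3 (by norm_num)) (fun x => 36 * z12 ^ (8 * k) * x ^ 11)
      (by fun_prop) fun x => by ring
  have hη : ∀ k : ℕ, k < 3 → Ex 3 (Nm 3) 6
      (fun T => ep 3 T ^ 6 * dTh ((I * T + k) / 3) 1 (I * T) vEta)
      fun x => -4 * z12 ^ 3 * x ^ 6 := fun k hk => by
    have hu : sg ((k : ℕ) / (3 : ℕ)) ^ 6 = z12 ^ (2 * k) := sg_div_pow (by norm_num) (by ring)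
    refine (ex_third (M := 6) (by norm_num) k sum_vEta (l := [(6, (0, 0, 0, -4 * (-1) ^ k))])
      (by interval_cases k <;> decide +kernel)).congr (fun _ _ => rfl) fun x => ?_
    push_cast at hu
    simp only [toS_gaps_cons, toS_gaps_nil, Cyc.toC, mul_pow, hu]
    push_cast
    have h6 : z12 ^ (4 * k) * z12 ^ (2 * k) * (-1) ^ k = 1 := by
      rw [← pow_add, ← add_mul, pow_mul, z12_pow_six, ← mul_pow]
      norm_num
    linear_combination -4 * z12 ^ 3 * x ^ 6 * h6
  have hκ : ∀ k : ℕ, k < 3 → Ex 3 (Nm 3) 24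
      (fun T => ep 3 T ^ 6 * dTh ((I * T + k) / 3) 1 (I * T) vK)
      fun x => z12 ^ 3 * (4 * z12 ^ (4 * k) - 36 * z12 ^ (8 * k) * x ^ 12 +
        96 * z12 ^ (12 * k) * x ^ 24) := fun k hk => by
    have hu : sg ((k : ℕ) / (3 : ℕ)) ^ 12 = z12 ^ (4 * k) := sg_div_pow (by norm_num) (by ring)
    refine (ex_third (M := 24) (by norm_num) k sum_vK
      (l := [(0, (0, 0, 0, 4)), (11, (0, 0, 0, -36)), (11, (0, 0, 0, 96))])
      (by interval_cases k <;> decide +kernel)).congr (fun _ _ => rfl) fun x => ?_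
    push_cast at hu
    simp only [toS_gaps_cons, toS_gaps_nil, Cyc.toC]
    push_cast
    have h1 : (x * sg (k / 3)) ^ 12 = x ^ 12 * z12 ^ (4 * k) := by rw [mul_pow, hu]
    linear_combination (-36 * z12 ^ 3 * z12 ^ (4 * k) + 96 * z12 ^ 3 * z12 ^ (4 * k) *
      ((x * sg (k / 3)) ^ 12 + x ^ 12 * z12 ^ (4 * k))) * h1
  have hD : ∀ v : Fin 8 → ℤ, ∑ i, v i = 0 →
      eqZ (blkT (dprodT 4) 4 1 (eZ (3 : ℕ) (0 : ℕ)) fun i => (3 : ℕ) * v i) [] = true →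
        Ex 3 (Nm 3) 33 (fun T => ep 3 T ^ 6 * dTh (3 * (I * T)) 3 (I * T) v)
          fun _ => 0 := fun v hv hl => by
    refine ((ex_direct (c := 3) (j := 1) (K := 0) (m := 3) (M := 3) (by norm_num) (by norm_num)
      (by norm_num) (by norm_num) (by norm_num) (by norm_num) hv (l := []) hl (C := 3) (by simp)
      (τ' := fun T => 3 * (I * T)) (by simp) (W := 1) (by simp)).shift 6).congr
      (fun T _ => by simp) fun x => by simp [toS_gaps_nil]
  have hDη := hD vEta sum_vEta (by decide +kernel)
  have hDκ := hD vK sum_vK (by decide +kernel)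
  have hA : ∀ T : ℝ, 0 < T → ∀ v : Fin 8 → ℤ,
      ep 3 T ^ 6 * fderiv ℂ (nineForms 2 (I * T)) (zPt (I * T)) (fun i => (v i : ℂ)) =
      27 / 28 * (ep 3 T ^ 6 * dTh (3 * (I * T)) 3 (I * T) v + 1 / 81 *
        (ep 3 T ^ 6 * dTh ((I * T + (0 : ℕ)) / 3) 1 (I * T) v +
          ep 3 T ^ 6 * dTh ((I * T + (1 : ℕ)) / 3) 1 (I * T) v +
          ep 3 T ^ 6 * dTh ((I * T + (2 : ℕ)) / 3) 1 (I * T) v)) := fun T hT v => by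
    rw [fderiv_A3 hT]
    simp only [sum_range_succ, sum_range_zero]
    ring
  have hB : ∀ T : ℝ, 0 < T → ∀ v : Fin 8 → ℤ,
      ep 3 T ^ 6 * (80 / 81 * fderiv ℂ (nineForms 6 (I * T)) (zPt (I * T)) (fun i => (v i : ℂ)) +
        28 / 81 * fderiv ℂ (nineForms 2 (I * T)) (zPt (I * T)) (fun i => (v i : ℂ))) =
      (h0 (I * T) ^ 2 + 1 / 3) * (ep 3 T ^ 6 * dTh (3 * (I * T)) 3 (I * T) v) + -1 / 243 *
        ((h0 ((I * T + (0 : ℕ)) / 3) ^ 2 + -1) *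
            (ep 3 T ^ 6 * dTh ((I * T + (0 : ℕ)) / 3) 1 (I * T) v) +
          (h0 ((I * T + (1 : ℕ)) / 3) ^ 2 + -1) *
            (ep 3 T ^ 6 * dTh ((I * T + (1 : ℕ)) / 3) 1 (I * T) v) +
          (h0 ((I * T + (2 : ℕ)) / 3) ^ 2 + -1) *
            (ep 3 T ^ 6 * dTh ((I * T + (2 : ℕ)) / 3) 1 (I * T) v)) := fun T hT v => by
    rw [fderiv_A3 hT, fderiv_B3 hT]
    simp only [sum_range_succ, sum_range_zero]
    ring
  have hAη := (((hDη.mono h3 (M' := 6) (by norm_num)).add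
      ((((hη 0 (by norm_num)).add (hη 1 (by norm_num))).add (hη 2 (by norm_num))).const_mul
        (1 / 81))).const_mul (27 / 28)).congr (q := fun x => (-1 / 7 * z12 ^ 3) * x ^ 6)
      (fun T hT => hA T hT vEta) fun x => by ring
  have hAκ := Ex.congr_poly (q := fun x => 0 * x ^ 12) h3
    ((((hDκ.mono h3 (M' := 24) (by norm_num)).add
      ((((hκ 0 (by norm_num)).add (hκ 1 (by norm_num))).add (hκ 2 (by norm_num))).const_mul
        (1 / 81))).const_mul (27 / 28)).mono h3 (M' := 12) (by norm_num) |>.congr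
      (fun T hT => hA T hT vK) fun x => rfl) (fun x => 24 / 7 * z12 ^ 3 * x ^ 11) (by fun_prop)
      fun x => by
        norm_num
        simp only [e4, e8, e12, e16, e24]
        ring
  have hh : Ex 3 (fun _ => 1) 0 (fun T => h0 (I * T) ^ 2 + 1 / 3) fun x => 4 / 3 * x ^ 0 := by
    refine Ex.congr_poly h3 (((ex_hs_sq (m := 3) h3 (n := 6) (by norm_num) 1).mono h3 (M' := 0)
      (by norm_num) |>.add (Ex.const 3 0 (1 / 3))).congr (fun T _ => ?_) fun _ => rfl)
      (fun x => 12 * x ^ 35 + 36 * x ^ 71) (by fun_prop) fun x => by ring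
    have := ep_mul_sg h3 6 0 T
    simp only [zero_div, sg_zero, add_zero, one_pow]  at this
    rw [this, h0_eq]
    congr 4
    push_cast
    ring
  have hBη := ((hh.mul_leading ((hDη.mono h3 (M' := 18) (by norm_num)).congr
      (q := fun x => 0 * x ^ 18) (fun _ _ => rfl) fun x => by simp)).add
    (((((hlead 0).mul_leading (hη 0 (by norm_num))).add
      ((hlead 1).mul_leading (hη 1 (by norm_num)))).add
      ((hlead 2).mul_leading (hη 2 (by norm_num)))).const_mul (-1 / 243))).congr
      (q := fun x => 0 * x ^ 18) (fun T hT => hB T hT vEta) fun x => by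
        norm_num
        simp only [e4, e8]
        ring
  have hBκ := Ex.congr_poly (q := fun x => 32 / 9 * z12 ^ 3 * x ^ 24) h3
    (((hh.mul_leading ((hDκ.mono h3 (M' := 24) (by norm_num)).congr
      (q := fun x => 0 * x ^ 24) (fun _ _ => rfl) fun x => by simp)).add
    (((((ex_h0_third 0).mul h3 (hκ 0 (by norm_num)) (by fun_prop) (by fun_prop)).add
      ((ex_h0_third 1).mul h3 (hκ 1 (by norm_num)) (by fun_prop) (by fun_prop))).add
      ((ex_h0_third 2).mul h3 (hκ 2 (by norm_num)) (by fun_prop) (by fun_prop))).const_mul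
      (-1 / 243))).congr (fun T hT => hB T hT vK) fun x => rfl)
      (fun x => 0) (by fun_prop) fun x => by
        norm_num
        simp only [e4, e8, e12, e16, e24]
        linear_combination (-32 / 81 * x ^ 12 - 64 / 27 * x ^ 24 + 32 / 3 * x ^ 36) * z12 ^ 3 * e4
  filter_upwards [hAη.eventually_det_ne hBκ hAκ hBη (Nm_ne_zero 3) (by norm_num)
    (by simp [z12_ne_zero])] with T hT
  refine ⟨fun i => (vEta i : ℂ), fun i => (vK i : ℂ), fun h => hT ?_⟩
  linear_combination 80 / 81 * ep 3 T ^ 12 * h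

lemma ex_quarter {M : ℕ} (hM : M ≤ 16) (k : ℕ) {v : Fin 8 → ℤ} (hv : ∑ i, v i = 0)
    {l : List (ℕ × Cyc)}
    (hl : eqZ (blkT (dprodT (M + 1)) (M + 1) 2 (fun i => -eZ 1 k i) fun i => -v i)
      (gaps l) = true) :
    Ex 4 (Nm 4) M (fun T => th2 0 ((I * T + k) / 2) ^ 4 * dTh ((I * T + k) / 4) 1 (I * T) v)
      fun x => 16 * toS (gaps l) (x * sg (k / 4)) := by
  have hu : sg ((k : ℕ) / (4 : ℕ)) ^ 12 ≠ 0 := pow_ne_zero _ (sg_ne_zero _)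
  have h := ex_reflect (K := k) (m := 4) (M := M) (by norm_num) (by norm_num) (by omega) hv
    (l := l) hl (τ' := fun T => (I * T + k) / 4) (fun T => by push_cast; ring)
    (W := (sg ((k : ℕ) / (4 : ℕ)) ^ 12)⁻¹) (by
      rw [show 12 * (4 - 3) = 12 from rfl, inv_mul_cancel₀ hu, pow_mul]
      norm_num)
  have hφ := ((ex_phi (M := 8) (j := -3) (e := 0) (by norm_num) (by norm_num)
    (l := [(0, (2, 0, 0, 0))]) (by decide +kernel) (m := 4) (by norm_num)
    (n := 2) (by norm_num) (sg ((k : ℕ) / (4 : ℕ)) ^ 2)).pow (by norm_num)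
    (continuous_toS_gaps _ _ _) 4).mono (by norm_num) (M' := M) (by omega)
  refine (hφ.mul (by norm_num) (h.const_mul (sg ((k : ℕ) / (4 : ℕ)) ^ 12))
    ((continuous_toS_gaps _ _ _).pow 4) ?_).congr (fun T _ => ?_) fun x => ?_
  · have := continuous_toS_gaps l 1 (sg ((k : ℕ) / (4 : ℕ)))
    simp only [pow_one] at this
    fun_prop
  · have e := ep_mul_sg (m := 4) (by norm_num) 2 k T
    have e' : (((2 : ℕ) : ℂ) * ((I * T + k) / (4 : ℕ))) = (I * T + k) / 2 := by
      push_cast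
      ring
    rw [th2_zero_pow_four, ← e', ← e]
    ring
  · rw [mul_inv_cancel_left₀ hu]
    simp only [toS_gaps_cons, toS_gaps_nil, Cyc.toC]
    push_cast
    ring

lemma ex_th4_four : Ex 4 (fun _ => 1) 16 (fun T => th4 0 (2 * (I * T)) ^ 4) fun _ => 1 := by
  refine ((ex_phi (M := 2) (j := 0) (e := 6) (by norm_num) (by norm_num)
    (l := [(0, (1, 0, 0, 0))]) (by decide +kernel) (m := 4) (by norm_num)
    (n := 8) (by norm_num) 1).pow (by norm_num) (continuous_toS_gaps _ _ _) 4).congr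
      (fun T _ => ?_) fun x => ?_
  · have e := ep_mul_sg (m := 4) (by norm_num) 8 0 T
    simp only [zero_div, sg_zero, one_pow] at e
    rw [th4_zero, e]
    congr 3
    push_cast
    ring
  · simp [toS_gaps_cons, toS_gaps_nil, Cyc.toC]

lemma fderiv_A4 {T : ℝ} (v : Fin 8 → ℤ) :
    fderiv ℂ (nineForms 3 (I * T)) (zPt (I * T)) (fun i => (v i : ℂ)) =
      dTh (I * T) 2 (I * T) v := rfl

lemma fderiv_B4 {T : ℝ} (hT : 0 < T) (v : Fin 8 → ℤ) :
    fderiv ℂ (nineForms 7 (I * T)) (zPt (I * T)) (fun i => (v i : ℂ)) =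
      16 / 15 * (th4 0 (2 * (I * T)) ^ 4 * (dTh (4 * (I * T)) 4 (I * T) v +
          -1 / 16 * dTh (I * T + 1 / 2) 2 (I * T) v) + -1 / 1024 * ∑ k ∈ range 4,
          th2 0 ((I * T + k) / 2) ^ 4 * dTh ((I * T + k) / 4) 1 (I * T) v) := by
  rw [fderiv_eq_sum ![16 / 15 * th4 0 (2 * (I * T)) ^ 4, -1 / 15 * th4 0 (2 * (I * T)) ^ 4,
      -1 / 960 * th2 0 ((I * T + 0) / 2) ^ 4, -1 / 960 * th2 0 ((I * T + 1) / 2) ^ 4,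
      -1 / 960 * th2 0 ((I * T + 2) / 2) ^ 4, -1 / 960 * th2 0 ((I * T + 3) / 2) ^ 4]
    ![4 * (I * T), I * T + 1 / 2, (I * T + 0) / 4, (I * T + 1) / 4, (I * T + 2) / 4,
      (I * T + 3) / 4] ![4, 2, 1, 1, 1, 1]]
  · simp [Fin.sum_univ_six, sum_range_succ]
    ring
  · intro k
    fin_cases k
    · simpa using hT
    · simpa using hT
    · simpa using im_div (m := 4) (by norm_num) hT 0 (by simp)
    · simpa using im_div (m := 4) (by norm_num) hT 1 (by simp)
    · simpa using im_div (m := 4) (by norm_num) hT 2 (by simp)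
    · simpa using im_div (m := 4) (by norm_num) hT 3 (by simp)
  · intro z
    simp [nineForms, B4, Finset.sum_range_succ, Fin.sum_univ_six]
    ring

lemma nondegenerate_idx_four : ∀ᶠ T : ℝ in atTop, ∃ u v,
    fderiv ℂ (nineForms 3 (I * T)) (zPt (I * T)) u *
      fderiv ℂ (nineForms 7 (I * T)) (zPt (I * T)) v ≠
    fderiv ℂ (nineForms 3 (I * T)) (zPt (I * T)) v *
      fderiv ℂ (nineForms 7 (I * T)) (zPt (I * T)) u := by
  have h40 : 0 < 4 := by norm_num
  have e4 := z12_pow_four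
  have e8 : z12 ^ 8 = -z12 ^ 2 := by linear_combination z12 ^ 2 * z12_pow_six
  have e12 : z12 ^ 12 = 1 := by linear_combination (z12 ^ 6 - 1) * z12_pow_six
  have hD : ∀ v : Fin 8 → ℤ, ∑ i, v i = 0 →
      eqZ (blkT (dprodT 4) 4 1 (eZ (4 : ℕ) (0 : ℕ)) fun i => (4 : ℕ) * v i) [] = true →
        Ex 4 (Nm 4) 48 (fun T => dTh (4 * (I * T)) 4 (I * T) v)
          fun _ => 0 := fun v hv hl => by
    refine (ex_direct (c := 4) (j := 1) (K := 0) (m := 4) (M := 3) (by norm_num) (by norm_num)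
      (by norm_num) (by norm_num) (by norm_num) (by norm_num) hv (l := []) hl (C := 4) (by simp)
      (τ' := fun T => 4 * (I * T)) (by simp) (W := 1) (by simp)).congr
      (fun T _ => by simp) fun x => by simp [toS_gaps_nil]
  have hE : ∀ (K M : ℕ) (v : Fin 8 → ℤ) (l : List (ℕ × Cyc)), M + 1 ≤ 40 → ∑ i, v i = 0 →
      eqZ (blkT (dprodT (M + 1)) (M + 1) 2 (eZ (2 : ℕ) K) fun i => (2 : ℕ) * v i) (gaps l) = true →
        Ex 4 (Nm 4) (4 * M) (fun T => dTh (I * T + K / 2) 2 (I * T) v)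
          fun x => toS (gaps l) (x ^ 4 * sg (K / 2)) := fun K M v l hM hv hl => by
    refine (ex_direct (c := 2) (j := 2) (K := K) (m := 4) (M := M) (by norm_num) (by norm_num)
      (by norm_num) (by norm_num) (by norm_num) hM hv hl (C := 2) (by simp)
      (τ' := fun T => I * T + K / 2) (fun T => by push_cast; ring) (W := 1)
      (by simp [pow_mul])).congr (fun T _ => by simp) fun x => by simp
  have hu : ∀ k : ℕ, sg ((k : ℕ) / (4 : ℕ)) ^ 4 = z12 ^ k := fun k =>
    sg_div_pow (by norm_num) (by ring)
  push_cast at hu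
  have hAη := (hE 0 4 vEta [(4, (-12, 0, -12, 0))] (by norm_num) sum_vEta
    (by decide +kernel)).congr (q := fun x => (-12 * (1 + z12 ^ 2)) * x ^ 16)
    (g := fun T => fderiv ℂ (nineForms 3 (I * T)) (zPt (I * T)) (fun i => (vEta i : ℂ)))
    (fun T _ => by simp [fderiv_A4]) fun x => by
      simp [toS_gaps_cons, toS_gaps_nil, Cyc.toC, sg_zero]
      ring
  have hAe := (hE 0 0 vE [(0, (0, 0, -4, 0))] (by norm_num) sum_vE
    (by decide +kernel)).congr (q := fun x => (-4 * z12 ^ 2) * x ^ 0)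
    (g := fun T => fderiv ℂ (nineForms 3 (I * T)) (zPt (I * T)) (fun i => (vE i : ℂ)))
    (fun T _ => by simp [fderiv_A4]) fun x => by
      simp [toS_gaps_cons, toS_gaps_nil, Cyc.toC]
  have hEη := (hE 1 4 vEta [(4, (-8, 0, 4, 0))] (by norm_num) sum_vEta
    (by decide +kernel)).congr (q := fun x => (-4 * (1 + z12 ^ 2)) * x ^ 16)
    (fun T _ => rfl) fun x => by
      have h1 := sg_div_pow (K := 1) (j := 2) (n := 4) (r := 2) (by norm_num) (by norm_num)
      push_cast at h1
      simp only [toS_gaps_cons, toS_gaps_nil, Cyc.toC, mul_pow]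
      push_cast
      rw [h1]
      linear_combination 4 * x ^ 16 * e4
  have hEe := (hE 1 0 vE [(0, (0, 0, -4, 0))] (by norm_num) sum_vE
    (by decide +kernel)).congr (q := fun x => (-4 * z12 ^ 2) * x ^ 0)
    (fun T _ => rfl) fun x => by
      simp [toS_gaps_cons, toS_gaps_nil, Cyc.toC]
  have hQ : ∀ (k : ℕ) (a b c d : ℤ), eqZ (blkT (dprodT 17) 17 2 (fun i => -eZ 1 k i)
      fun i => -vEta i) (gaps [(4, (a, 0, b, 0)), (11, (c, 0, d, 0))]) = true →
      Ex 4 (Nm 4) 16 (fun T => th2 0 ((I * T + k) / 2) ^ 4 *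
        dTh ((I * T + k) / 4) 1 (I * T) vEta)
        fun x => 16 * ((a + b * z12 ^ 2) * z12 ^ k * x ^ 4 +
          (c + d * z12 ^ 2) * z12 ^ (4 * k) * x ^ 16) := fun k a b c d hl => by
    refine (ex_quarter (M := 16) (by norm_num) k sum_vEta hl).congr (fun _ _ => rfl) fun x => ?_
    simp only [toS_gaps_cons, toS_gaps_nil, Cyc.toC]
    have h1 : (x * sg (k / 4)) ^ 4 = x ^ 4 * z12 ^ k := by rw [mul_pow, hu]
    have h2 : (x * sg (k / 4)) ^ 16 = x ^ 16 * z12 ^ (4 * k) := by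
      rw [mul_pow, show 16 = 4 * 4 from rfl, pow_mul (sg _), hu, ← pow_mul]
      ring
    push_cast
    linear_combination 16 * (a + b * z12 ^ 2) * h1 + 16 * (c + d * z12 ^ 2) * h2
  have hQe : ∀ k : ℕ, k < 4 → Ex 4 (Nm 4) 0 (fun T => th2 0 ((I * T + k) / 2) ^ 4 *
        dTh ((I * T + k) / 4) 1 (I * T) vE) fun _ => 32 * z12 ^ 2 := fun k hk => by
    refine (ex_quarter (M := 0) (by norm_num) k sum_vE (l := [(0, (0, 0, 2, 0))])
      (by interval_cases k <;> decide +kernel)).congr (fun _ _ => rfl) fun x => ?_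
    simp only [toS_gaps_cons, toS_gaps_nil, Cyc.toC]
    push_cast
    ring
  have hB : ∀ T : ℝ, 0 < T → ∀ v : Fin 8 → ℤ,
      fderiv ℂ (nineForms 7 (I * T)) (zPt (I * T)) (fun i => (v i : ℂ)) =
      16 / 15 * (th4 0 (2 * (I * T)) ^ 4 * (dTh (4 * (I * T)) 4 (I * T) v +
          -1 / 16 * dTh (I * T + (1 : ℕ) / 2) 2 (I * T) v) + -1 / 1024 *
        (th2 0 ((I * T + (0 : ℕ)) / 2) ^ 4 * dTh ((I * T + (0 : ℕ)) / 4) 1 (I * T) v +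
          th2 0 ((I * T + (1 : ℕ)) / 2) ^ 4 * dTh ((I * T + (1 : ℕ)) / 4) 1 (I * T) v +
          th2 0 ((I * T + (2 : ℕ)) / 2) ^ 4 * dTh ((I * T + (2 : ℕ)) / 4) 1 (I * T) v +
          th2 0 ((I * T + (3 : ℕ)) / 2) ^ 4 * dTh ((I * T + (3 : ℕ)) / 4) 1 (I * T) v)) :=
    fun T hT v => by
      rw [fderiv_B4 hT]
      simp only [sum_range_succ, sum_range_zero, zero_add, Nat.cast_one]
  have hBη := (((ex_th4_four.mul h40 (((hD vEta sum_vEta (by decide +kernel)).mono h40 (M' := 16)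
      (by norm_num)).add (hEη.const_mul (-1 / 16))) (by fun_prop) (by fun_prop)).add
    (((((hQ 0 (-2) (-2) 22 22 (by decide +kernel)).add
      (hQ 1 (-2) 4 22 (-44) (by decide +kernel))).add
      (hQ 2 4 (-2) (-44) 22 (by decide +kernel))).add
      (hQ 3 (-2) (-2) 22 22 (by decide +kernel))).const_mul (-1 / 1024))).const_mul
      (16 / 15)).congr (q := fun x => (-6 / 5 * (1 + z12 ^ 2)) * x ^ 16)
      (fun T hT => hB T hT vEta) fun x => by
        norm_num
        simp only [e8, e12]
        linear_combination (-1 / 60) * (-2 * (1 + z12) * x ^ 4 - 44 * (z12 ^ 2 + 1) * x ^ 16) * e4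
  have hBe := ((((ex_th4_four.mono h40 (M' := 0) (by norm_num)).mul h40
      (((hD vE sum_vE (by decide +kernel)).mono h40 (M' := 0)
      (by norm_num)).add (hEe.const_mul (-1 / 16))) (by fun_prop) (by fun_prop)).add
    (((((hQe 0 (by norm_num)).add (hQe 1 (by norm_num))).add (hQe 2 (by norm_num))).add
      (hQe 3 (by norm_num))).const_mul (-1 / 1024))).const_mul
      (16 / 15)).congr (q := fun x => (2 / 15 * z12 ^ 2) * x ^ 0)
      (fun T hT => hB T hT vE) fun x => by ring
  filter_upwards [hAe.eventually_det_ne hBη hAη hBe (Nm_ne_zero 4) (by norm_num) (by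
    intro h
    have : (32 / 5 * (z12 ^ 2 * (1 + z12 ^ 2)) : ℂ) = 0 := by linear_combination h
    simp [z12_ne_zero, one_add_z12_sq_ne_zero] at this)] with T hT
  exact ⟨fun i => (vE i : ℂ), fun i => (vEta i : ℂ), hT⟩

lemma fderiv_A5 {T : ℝ} (hT : 0 < T) (v : Fin 8 → ℤ) :
    fderiv ℂ (nineForms 4 (I * T)) (zPt (I * T)) (fun i => (v i : ℂ)) =
      125 / 126 * (dTh (5 * (I * T)) 5 (I * T) v + 1 / 625 *
        ∑ k ∈ range 5, dTh ((I * T + k) / 5) 1 (I * T) v) := by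
  rw [fderiv_eq_sum ![125 / 126, 1 / 630, 1 / 630, 1 / 630, 1 / 630, 1 / 630]
    ![5 * (I * T), (I * T + 0) / 5, (I * T + 1) / 5, (I * T + 2) / 5, (I * T + 3) / 5,
      (I * T + 4) / 5] ![5, 1, 1, 1, 1, 1]]
  · simp [Fin.sum_univ_six, sum_range_succ]
    ring
  · intro k
    fin_cases k
    · simpa using hT
    · simpa using im_div (m := 5) (by norm_num) hT 0 (by simp)
    · simpa using im_div (m := 5) (by norm_num) hT 1 (by simp)
    · simpa using im_div (m := 5) (by norm_num) hT 2 (by simp)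
    · simpa using im_div (m := 5) (by norm_num) hT 3 (by simp)
    · simpa using im_div (m := 5) (by norm_num) hT 4 (by simp)
  · intro z
    simp [nineForms, A5, AM, Finset.sum_range_succ, Fin.sum_univ_six]
    ring

lemma nondegenerate_idx_five :
    ∀ᶠ T : ℝ in atTop, ∃ u, fderiv ℂ (nineForms 4 (I * T)) (zPt (I * T)) u ≠ 0 := by
  have h5 : 0 < 5 := by norm_num
  have e4 := z12_pow_four
  have e12 : z12 ^ 12 = 1 := by linear_combination (z12 ^ 6 - 1) * z12_pow_six
  have e8 : z12 ^ 8 = -z12 ^ 2 := by linear_combination z12 ^ 2 * z12_pow_six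
  have e16 : z12 ^ 16 = z12 ^ 2 - 1 := by linear_combination z12 ^ 4 * e12 + e4
  have e24 : z12 ^ 24 = 1 := by linear_combination (z12 ^ 12 + 1) * e12
  have e32 : z12 ^ 32 = -z12 ^ 2 := by linear_combination z12 ^ 8 * e24 + e8
  have hR : ∀ (k : ℕ) (a b : ℤ), eqZ (blkT (dprodT 5) 5 1 (fun i => -eZ 1 k i)
      fun i => -vEta i) (gaps [(4, (0, a, 0, b))]) = true →
      Ex 5 (Nm 5) 4 (fun T => ep 5 T ^ 24 * dTh ((I * T + k) / 5) 1 (I * T) vEta)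
        fun x => ((-1) ^ (5 * k) * z12 ^ (8 * k) * (a * z12 + b * z12 ^ 3)) * x ^ 4 :=
    fun k a b hl => by
    have hu0 : sg ((k : ℕ) / (5 : ℕ)) ≠ 0 := sg_ne_zero _
    have hu : sg ((k : ℕ) / (5 : ℕ)) ^ 20 = z12 ^ (4 * k) := sg_div_pow h5 (by ring)
    have hW : (sg ((k : ℕ) / (5 : ℕ)) ^ 24)⁻¹ * sg ((k : ℕ) / (5 : ℕ)) ^ 4 = z12 ^ (8 * k) := by
      have h1 : z12 ^ (8 * k) * z12 ^ (4 * k) = 1 := by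
        rw [← pow_add, ← add_mul, pow_mul, e12, one_pow]
      rw [← hu] at h1
      field_simp
      linear_combination -h1
    refine (ex_reflect (K := k) (m := 5) (M := 4) (by norm_num) (by norm_num) (by omega) sum_vEta
      hl (τ' := fun T => (I * T + k) / 5) (fun T => by push_cast; ring)
      (W := (-1) ^ (5 * k) * (sg ((k : ℕ) / (5 : ℕ)) ^ 24)⁻¹)
      (inv_mul_cancel_right₀ (pow_ne_zero _ hu0) _)).congr (fun _ _ => rfl) fun x => ?_
    simp only [toS_gaps_cons, toS_gaps_nil, Cyc.toC]
    rw [← hW]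
    push_cast
    ring
  have hD : Ex 5 (Nm 5) 75 (fun T => dTh (5 * (I * T)) 5 (I * T) vEta) fun _ => 0 := by
    refine (ex_direct (c := 5) (j := 1) (K := 0) (m := 5) (M := 3) (by norm_num) (by norm_num)
      (by norm_num) (by norm_num) (by norm_num) (by norm_num) sum_vEta (l := [])
      (by decide +kernel) (C := 5) (by simp)
      (τ' := fun T => 5 * (I * T)) (by simp) (W := 1) (by simp)).congr
      (fun T _ => by simp) fun x => by simp [toS_gaps_nil]
  have hA := ((((hD.shift 24).mono h5 (M' := 4) (by norm_num)).add
    ((((((hR 0 (-2) 2 (by decide +kernel)).add (hR 1 0 2 (by decide +kernel))).add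
      (hR 2 2 0 (by decide +kernel))).add (hR 3 2 (-2) (by decide +kernel))).add
      (hR 4 0 (-2) (by decide +kernel))).const_mul (1 / 625))).const_mul (125 / 126)).congr
    (g := fun T => ep 5 T ^ 24 * fderiv ℂ (nineForms 4 (I * T)) (zPt (I * T))
      (fun i => (vEta i : ℂ))) (q := fun x => (1 / 63 * z12 ^ 5) * x ^ 4)
    (fun T hT => by
      rw [fderiv_A5 hT]
      simp only [sum_range_succ, sum_range_zero]
      ring)
    fun x => by
      norm_num
      simp only [e8, e16, e24, e32]
      linear_combination (-1 / 105) * z12 * x ^ 4 * e4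
  filter_upwards [hA.eventually_ne_zero (Nm_ne_zero 5) (by simp [z12_ne_zero])] with T hT
  exact ⟨fun i => (vEta i : ℂ), right_ne_zero_of_mul hT⟩

/-- The common normalization of the values of forms of index six. -/
lemma Em_div_two_ne_zero (T : ℝ) : Em 6 (I * T) / 2 ≠ 0 :=
  div_ne_zero (Em_ne_zero _ _) two_ne_zero

lemma ex_six_sixth (k : ℕ) (hk : k < 6) :
    Ex 6 (fun T => Em 6 (I * T) / 2) 36
      (fun T => ep 6 T ^ 36 * (h0 ((I * T + k) / 3) ^ 2 * Theta ((I * T + k) / 6) (zPt (I * T))))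
      fun x => 2 * z12 ^ (6 * k) - 22 * z12 ^ (8 * k) * x ^ 12 + 114 * z12 ^ (10 * k) * x ^ 24 -
        394 * x ^ 36 := by
  have h6 : 0 < 6 := by norm_num
  have e12 : z12 ^ (12 * k) = 1 := by
    rw [pow_mul, show (12 : ℕ) = 6 * 2 from rfl, pow_mul, z12_pow_six]
    norm_num
  have hu : sg ((k : ℕ) / (6 : ℕ)) ^ 12 = z12 ^ (2 * k) := sg_div_pow h6 (by ring)
  have hu36 : sg ((k : ℕ) / (6 : ℕ)) ^ 36 = z12 ^ (6 * k) := sg_div_pow h6 (by ring)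
  have h := ex_value_reflect (K := k) (m := 6) (M := 36) (by norm_num) (by norm_num) (by norm_num)
    (l := [(0, (2, 0, 0, 0)), (11, (-22, 0, 0, 0)), (11, (90, 0, 0, 0)), (11, (-130, 0, 0, 0))])
    (by interval_cases k <;> decide +kernel) (τ' := fun T => (I * T + k) / 6)
    (fun T => by push_cast; ring) (W := z12 ^ (6 * k)) (by
      rw [show 12 * (6 - 3) = 36 from rfl, hu36, ← pow_add, ← add_mul, show 6 + 6 = 12 from rfl,
        e12, pow_mul]
      norm_num)
  have hh := (ex_hs_sq h6 (n := 4) (by norm_num) (sg ((k : ℕ) / (6 : ℕ)) ^ 4)).mono h6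
    (M' := 36) (by norm_num)
  have hc := continuous_toS_gaps [(0, (2, 0, 0, 0)), (11, (-22, 0, 0, 0)), (11, (90, 0, 0, 0)),
    (11, (-130, 0, 0, 0))] 1 (sg ((k : ℕ) / (6 : ℕ)))
  simp only [pow_one] at hc
  refine Ex.congr_poly h6 ((hh.mul h6 h (by fun_prop) (by fun_prop)).congr (fun T _ => ?_)
    fun _ => rfl) (fun x => z12 ^ (6 * k) * (1152 * sg ((k : ℕ) / (6 : ℕ)) ^ 48 * x ^ 11 -
      2352 * sg ((k : ℕ) / (6 : ℕ)) ^ 60 * x ^ 23 + 3240 * sg ((k : ℕ) / (6 : ℕ)) ^ 72 * x ^ 35 -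
      4680 * sg ((k : ℕ) / (6 : ℕ)) ^ 84 * x ^ 47)) (by fun_prop) fun x => ?_
  · have e := ep_mul_sg h6 4 k T
    have e' : (((4 : ℕ) : ℂ) * ((I * T + k) / (6 : ℕ))) = 2 * ((I * T + k) / 3) := by
      push_cast
      ring
    rw [h0_eq, ← e', ← e]
    ring
  · simp only [toS_gaps_cons, toS_gaps_nil, Cyc.toC]
    push_cast at hu hu36 ⊢
    linear_combination (-22 * z12 ^ (6 * k) * x ^ 12 + 114 * z12 ^ (6 * k) * x ^ 24 *
      (sg (k / 6) ^ 12 + z12 ^ (2 * k))) * hu - 394 * x ^ 36 * (z12 ^ (6 * k) * hu36 + e12)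

lemma ex_six_third (k : ℕ) (hk : k < 3) :
    Ex 6 (fun T => Em 6 (I * T) / 2) 36
      (fun T => ep 6 T ^ 36 * (h0 ((I * T + k) / 3) ^ 2 *
        Theta ((2 * (I * T) + 2 * k) / 3) fun i => 2 * zPt (I * T) i))
      fun x => -4 * z12 ^ (8 * k) * x ^ 12 - 52 * x ^ 36 := by
  have h6 : 0 < 6 := by norm_num
  have e12 : z12 ^ (12 * k) = 1 := by
    rw [pow_mul, show (12 : ℕ) = 6 * 2 from rfl, pow_mul, z12_pow_six]
    norm_num
  have hu : sg ((2 * k : ℕ) / (3 : ℕ)) ^ 6 = z12 ^ (4 * k) := sg_div_pow (by norm_num) (by ring)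
  have h := ex_value_direct (c := 2) (j := 3) (K := 2 * k) (m := 6) (M := 6) (by norm_num)
    (by norm_num) (by norm_num) (by norm_num) (by norm_num)
    (l := [(0, (-4, 0, 0, 0)), (5, (-4, 0, 0, 0))])
    (by interval_cases k <;> decide +kernel) (C := 2) (by simp)
    (τ' := fun T => (2 * (I * T) + 2 * k) / 3)
    (fun T => by push_cast; ring) (W := z12 ^ (8 * k)) (by
      rw [show 6 * 3 - 12 = 6 from rfl, hu, ← pow_add, ← add_mul, show 8 + 4 = 12 from rfl,
        e12, show 3 * (2 * k) = 2 * (3 * k) by ring, pow_mul]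
      norm_num)
  have hh := (ex_hs_sq h6 (n := 4) (by norm_num) (sg ((2 * k : ℕ) / (3 : ℕ)))).mono h6
    (M' := 24) (by norm_num)
  refine Ex.congr_poly h6 (((hh.mul h6 h (by fun_prop)
    ((continuous_toS_gaps _ _ _).const_mul _)).shift 12).congr (fun T _ => ?_)
    fun _ => rfl) (fun x => z12 ^ (8 * k) * (-192 * sg ((2 * k : ℕ) / (3 : ℕ)) ^ 12 * x ^ 23 -
      144 * sg ((2 * k : ℕ) / (3 : ℕ)) ^ 18 * x ^ 47)) (by fun_prop) fun x => ?_
  · have e := sg_eq_ep (τ' := (2 * (I * T) + 2 * k) / 3) (c := 2) (j := 3) (K := 2 * k) (m := 6)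
      (T := T) (by norm_num) (by norm_num) (by norm_num) (by push_cast; ring)
    have e' : (2 * ((I * T + k) / 3)) = (2 * (I * T) + 2 * k) / 3 := by ring
    rw [h0_eq, e', e]
    ring_nf
  · simp only [toS_gaps_cons, toS_gaps_nil, Cyc.toC]
    push_cast at hu ⊢
    linear_combination -52 * x ^ 36 * (z12 ^ (8 * k) * hu + e12)

lemma ex_h0_six (k : ℕ) : Ex 6 (fun _ => 1) 0 (fun T => h0 (I * T + k) ^ 2)
    fun x => 1 * x ^ 0 := by
  have h6 : 0 < 6 := by norm_num
  refine Ex.congr_poly h6 (((ex_hs_sq h6 (n := 12) (by norm_num)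
    (sg ((k : ℕ) / (6 : ℕ)) ^ 12)).mono h6 (M' := 0) (by norm_num)).congr (fun T _ => ?_)
    fun _ => rfl) (fun x => 12 * x ^ 71 * (sg ((k : ℕ) / (6 : ℕ)) ^ 12) ^ 6 +
      36 * x ^ 143 * (sg ((k : ℕ) / (6 : ℕ)) ^ 12) ^ 12) (by fun_prop) fun x => by ring
  rw [ep_mul_sg h6 12 k T, h0_eq]
  congr 3
  push_cast
  ring

lemma ex_six_half (k : ℕ) (hk : k < 2) :
    Ex 6 (fun T => Em 6 (I * T) / 2) 36
      (fun T => ep 6 T ^ 36 * (h0 (I * T + k) ^ 2 *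
        Theta ((3 * (I * T) + 3 * k) / 2) fun i => 3 * zPt (I * T) i))
      fun x => 6 * x ^ 36 := by
  have h6 : 0 < 6 := by norm_num
  have h := ex_value_direct (c := 3) (j := 2) (K := 3 * k) (m := 6) (M := 0) (by norm_num)
    (by norm_num) (by norm_num) (by norm_num) (by norm_num) (l := [(0, (6, 0, 0, 0))])
    (by interval_cases k <;> decide +kernel) (C := 3) (by simp)
    (τ' := fun T => (3 * (I * T) + 3 * k) / 2)
    (fun T => by push_cast; ring) (W := 1) (by simp [pow_mul])
  have h' := h.congr (g := fun T => Theta ((3 * (I * T) + 3 * k) / 2) fun i => 3 * zPt (I * T) i)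
    (q := fun x => 6 * x ^ 0) (fun T _ => by simp)
    fun x => by simp [toS_gaps_cons, toS_gaps_nil, Cyc.toC]
  refine (((ex_h0_six k).mul_leading h').shift 36).congr (fun T _ => ?_) fun x => ?_
  · simp
  · ring

lemma ex_six_one :
    Ex 6 (fun T => Em 6 (I * T) / 2) 36
      (fun T => ep 6 T ^ 36 * (h0 (I * T) ^ 2 *
        Theta (6 * (I * T)) fun i => 6 * zPt (I * T) i))
      fun _ => 0 := by
  have h6 : 0 < 6 := by norm_num
  have h := ex_value_direct (c := 6) (j := 1) (K := 0) (m := 6) (M := 0) (by norm_num)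
    (by norm_num) (by norm_num) (by norm_num) (by norm_num) (l := [])
    (by decide +kernel) (C := 6) (by simp)
    (τ' := fun T => 6 * (I * T))
    (fun T => by push_cast; ring) (W := 1) (by simp)
  have h' := h.congr (g := fun T => Theta (6 * (I * T)) fun i => 6 * zPt (I * T) i)
    (q := fun x => 0 * x ^ 0) (fun T _ => by simp) fun x => by simp [toS_gaps_nil]
  refine (((ex_h0_six 0).mul_leading h').shift 36).congr (fun T _ => ?_) fun x => ?_
  · simp
  · ring

lemma nondegenerate_idx_six : ∀ᶠ T : ℝ in atTop, nineForms 8 (I * T) (zPt (I * T)) ≠ 0 := by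
  have e4 := z12_pow_four
  have e8 : z12 ^ 8 = -z12 ^ 2 := by linear_combination z12 ^ 2 * z12_pow_six
  have e10 : z12 ^ 10 = -z12 ^ 4 := by linear_combination z12 ^ 4 * z12_pow_six
  have e12 : z12 ^ 12 = 1 := by linear_combination (z12 ^ 6 - 1) * z12_pow_six
  have e16 : z12 ^ 16 = z12 ^ 4 := by linear_combination z12 ^ 4 * e12
  have e18 : z12 ^ 18 = -1 := by linear_combination z12 ^ 6 * e12 + z12_pow_six
  have e20 : z12 ^ 20 = -z12 ^ 2 := by linear_combination z12 ^ 8 * e12 + e8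
  have e24 : z12 ^ 24 = 1 := by linear_combination (z12 ^ 12 + 1) * e12
  have e30 : z12 ^ 30 = -1 := by linear_combination z12 ^ 6 * e24 + z12_pow_six
  have e32 : z12 ^ 32 = -z12 ^ 2 := by linear_combination z12 ^ 8 * e24 + e8
  have e40 : z12 ^ 40 = z12 ^ 4 := by linear_combination z12 ^ 16 * e24 + e16
  have e50 : z12 ^ 50 = z12 ^ 2 := by linear_combination (z12 ^ 26 + z12 ^ 2) * e24
  have h := ((((ex_six_one.add (((ex_six_half 0 (by norm_num)).add
    (ex_six_half 1 (by norm_num))).const_mul (1 / 16))).add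
    ((((ex_six_third 0 (by norm_num)).add (ex_six_third 1 (by norm_num))).add
      (ex_six_third 2 (by norm_num))).const_mul (-1 / 243))).add
    (((((((ex_six_sixth 0 (by norm_num)).add (ex_six_sixth 1 (by norm_num))).add
      (ex_six_sixth 2 (by norm_num))).add (ex_six_sixth 3 (by norm_num))).add
      (ex_six_sixth 4 (by norm_num))).add (ex_six_sixth 5 (by norm_num))).const_mul
      (-1 / 3888))).const_mul (9 / 10)).congr
    (g := fun T => ep 6 T ^ 36 * nineForms 8 (I * T) (zPt (I * T))) (q := fun x => 9 / 5 * x ^ 36)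
    (fun T _ => by
      simp only [nineForms, B6, Matrix.cons_val, sum_range_succ, sum_range_zero]
      ring)
    fun x => by
      norm_num
      simp only [z12_pow_six, e8, e10, e12, e16, e18, e20, e24, e30, e32, e40, e50]
      linear_combination 1 / 40 * x ^ 12 * e4
  filter_upwards [h.eventually_ne_zero Em_div_two_ne_zero (by norm_num)] with T hT
  exact right_ne_zero_of_mul hT

lemma eventually_nondegenerate_nineForms :
    ∀ᶠ T : ℝ in atTop, Nondegenerate (I * T) fun i => nineForms i (I * T) := by
  filter_upwards [nondegenerate_idx_one, nondegenerate_idx_two, nondegenerate_idx_three,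
    nondegenerate_idx_four, nondegenerate_idx_five, nondegenerate_idx_six]
    with T h₁ h₂ h₃ h₄ h₅ h₆
  exact ⟨h₁, h₂, h₃, h₄, h₅, h₆⟩

end Asymptotic

/-- The eleven meromorphic Jacobi forms c_0, c_1, c_2, c_3, c_4, d_0, d_2, …, d_6
are algebraically independent over ℂ. -/
theorem cd_algebraically_independent :
    ∀ P : MvPolynomial (Fin 11) ℂ,
      (∀ τ : ℂ, GoodTau τ → ∀ z : Fin 8 → ℂ,
        MvPolynomial.eval (fun i => cdGens i τ z) P = 0) → P = 0 := by
  refine eq_zero_of_nineForms_dense ?_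
  filter_upwards [eventually_nondegenerate_nineForms, Filter.eventually_gt_atTop 0]
    with T hn hT Q hQ
  exact eq_zero_of_nondegenerate hT (isJac_nineForms (by simpa using hT)) hn hQ

end E8Jacobi
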